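/- Parabolic comparison principle. Let Ω ⊂ ℝ^N be an open set of class W^{2,∞}, u₀ ∈ C(cl(Ω)), assume (M), (J0), (J1), and let H = H(x,t,r,p) be either of Bellman type satisfying (C'), (L'), (B') or a coercive Hamiltonian satisfying (H0') and either (He') or (He''); assume also (H'). Let u (resp. v) be a bounded usc subsolution (resp. bounded lsc supersolution) of ∂_t u − I[u(·,t)](x) + H(x,t,u,Du) = 0 in Ω×(0,∞), generalized Neumann condition ∂u/∂n = 0 on ∂Ω×(0,∞), u(·,0) = u₀ on cl(Ω), with u, v ∈ L^∞(cl(Ω)×[0,T]) for all T > 0. Then u ≤ v on cl(Ω)×[0,∞). -/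

import Mathlib

set_option autoImplicit false

/- Common framework for censored nonlocal Hamilton–Jacobi equations with
Neumann boundary conditions (Barles-type viscosity solutions). -/

open Set Metric MeasureTheory Filter Topology Function
open scoped RealInnerProductSpace NNReal ENNReal

noncomputable section

namespace Censored

abbrev Euc (N : ℕ) : Type := EuclideanSpace ℝ (Fin N)

variable {N : ℕ}

/-- Signed distance to the boundary of `Ω`, positive inside `Ω`. -/
def sdist (Ω : Set (Euc N)) (x : Euc N) : ℝ := infDist x Ωᶜ - infDist x Ω

/-- A modulus of continuity. -/
def IsModulus (ω : ℝ → ℝ) : Prop :=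
  (∀ s, 0 ≤ ω s) ∧ Monotone ω ∧ Tendsto ω (nhdsWithin 0 (Ioi 0)) (nhds 0)

/-- A `W^{2,∞}` boundary chart for `Ω` at `s`, with radius `r`: a diffeomorphism of
class `W^{2,∞}` (i.e. `C^1` with Lipschitz differential, with inverse of the same
regularity) whose `N`-th component coincides with the signed distance. -/
def IsW2Chart (hN : 0 < N) (Ω : Set (Euc N)) (s : Euc N) (r : ℝ)
    (ψ ψinv : Euc N → Euc N) : Prop :=
  0 < r ∧
  ContDiffOn ℝ 1 ψ (ball s r) ∧
  (∃ L : ℝ≥0, LipschitzOnWith L (fun x => fderiv ℝ ψ x) (ball s r)) ∧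
  ContDiffOn ℝ 1 ψinv (ψ '' ball s r) ∧
  (∃ L : ℝ≥0, LipschitzOnWith L (fun x => fderiv ℝ ψinv x) (ψ '' ball s r)) ∧
  (∀ x ∈ ball s r, ψinv (ψ x) = x) ∧
  (∀ x ∈ ball s r, ψ x ⟨N - 1, Nat.sub_lt hN Nat.one_pos⟩ = sdist Ω x)

/-- Assumption (O): `Ω` is open of class `W^{2,∞}`. -/
def IsW2Domain (hN : 0 < N) (Ω : Set (Euc N)) : Prop :=
  IsOpen Ω ∧ ∀ s ∈ frontier Ω, ∃ r ψ ψinv, IsW2Chart hN Ω s r ψ ψinv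

/-- `n` is the exterior unit normal vector field to `∂Ω`:  `n = -D d` where `d` is the
signed distance (positive inside). -/
def IsExteriorNormal (Ω : Set (Euc N)) (n : Euc N → Euc N) : Prop :=
  ∀ x ∈ frontier Ω, ‖n x‖ = 1 ∧ HasGradientAt (sdist Ω) (-(n x)) x

/-- First part of assumption (M): the measures `μ_x` have a (measurable, nonnegative)
density `g x` with respect to Lebesgue measure, bounded by `Cμ |z|^{-(N+σ)}`. -/
def AssumptionM1 (Ω : Set (Euc N)) (g : Euc N → Euc N → ℝ) (Cμ σ : ℝ) : Prop :=
  0 < Cμ ∧ σ ∈ Ioo (0:ℝ) 1 ∧ (∀ x, Measurable (g x)) ∧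
  (∀ x ∈ closure Ω, ∀ z : Euc N, 0 ≤ g x z) ∧
  (∀ x ∈ closure Ω, ∀ z : Euc N, g x z ≤ Cμ * ‖z‖ ^ (-((N : ℝ) + σ)))

/-- Assumption (M). -/
def AssumptionM (Ω : Set (Euc N)) (g : Euc N → Euc N → ℝ) (Cμ Dμ σ : ℝ) : Prop :=
  AssumptionM1 Ω g Cμ σ ∧ 0 < Dμ ∧
  (∀ x ∈ closure Ω, ∀ y ∈ closure Ω, ∀ z : Euc N,
    |g x z - g y z| ≤ Dμ * ‖x - y‖ * ‖z‖ ^ (-((N : ℝ) + σ)))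

/-- Assumption (J0). -/
def AssumptionJ0 (Ω : Set (Euc N)) (j : Euc N → Euc N → Euc N) (Aj : ℝ) : Prop :=
  ∀ x ∈ closure Ω,
    ContDiff ℝ 1 (j x) ∧ Function.Bijective (j x) ∧
    ContDiff ℝ 1 (Function.invFun (j x)) ∧
    ∀ z : Euc N, ‖fderiv ℝ (Function.invFun (j x)) z‖ ≤ Aj

/-- Assumption (J1). -/
def AssumptionJ1 (Ω : Set (Euc N)) (j : Euc N → Euc N → Euc N) (Cj' Cj Dj : ℝ) : Prop :=
  0 < Cj' ∧ 0 < Cj ∧ 0 < Dj ∧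
  (∀ x ∈ closure Ω, ∀ z : Euc N, Cj' * ‖z‖ ≤ ‖j x z‖ ∧ ‖j x z‖ ≤ Cj * ‖z‖) ∧
  (∀ x ∈ closure Ω, ∀ y ∈ closure Ω, ∀ z : Euc N, ‖j x z - j y z‖ ≤ Dj * ‖z‖ * ‖x - y‖)

/-- The truncated censored nonlocal term over `{|z| ≥ ξ}` (`I^ξ`). -/
def Iout (Ω : Set (Euc N)) (j : Euc N → Euc N → Euc N) (g : Euc N → Euc N → ℝ)
    (ξ : ℝ) (u : Euc N → ℝ) (x : Euc N) : ℝ :=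
  ∫ z in {z : Euc N | ξ ≤ ‖z‖ ∧ x + j x z ∈ closure Ω}, (u (x + j x z) - u x) * g x z

/-- The truncated censored nonlocal term over `{|z| < ξ}` (`I_ξ`). -/
def Iin (Ω : Set (Euc N)) (j : Euc N → Euc N → Euc N) (g : Euc N → Euc N → ℝ)
    (ξ : ℝ) (φ : Euc N → ℝ) (x : Euc N) : ℝ :=
  ∫ z in {z : Euc N | ‖z‖ < ξ ∧ x + j x z ∈ closure Ω}, (φ (x + j x z) - φ x) * g x z

/-- The censored nonlocal operator of order `σ < 1`, as a principal value. -/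
def Ipv (Ω : Set (Euc N)) (j : Euc N → Euc N → Euc N) (g : Euc N → Euc N → ℝ)
    (u : Euc N → ℝ) (x : Euc N) : ℝ :=
  limUnder (nhdsWithin (0:ℝ) (Ioi 0)) (fun δ =>
    ∫ z in {z : Euc N | δ < ‖z‖ ∧ x + j x z ∈ closure Ω}, (u (x + j x z) - u x) * g x z)

/-- `u` is bounded on `S`. -/
def BddOn (u : Euc N → ℝ) (S : Set (Euc N)) : Prop := ∃ M, ∀ x ∈ S, |u x| ≤ M

/-- `u = u(x,t)` is bounded on `S × I`. -/
def BddOnT (u : Euc N → ℝ → ℝ) (S : Set (Euc N)) (I : Set ℝ) : Prop :=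
  ∃ M, ∀ x ∈ S, ∀ t ∈ I, |u x t| ≤ M

/-- Viscosity subsolution, with generalized Neumann boundary conditions, of the
stationary equation `F(x, u, Du, I[u]) = 0` in `Ω`, `∂u/∂n = 0` on `∂Ω`,
for the censored operator determined by `j, g` (with constant `Cj` from (J1)). -/
def IsSubSol (Ω : Set (Euc N)) (j : Euc N → Euc N → Euc N) (g : Euc N → Euc N → ℝ)
    (n : Euc N → Euc N) (Cj : ℝ) (F : Euc N → ℝ → Euc N → ℝ → ℝ) (u : Euc N → ℝ) : Prop :=
  ∀ ξ > (0:ℝ), ∀ φ : Euc N → ℝ, ContDiff ℝ 1 φ →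
    ∀ x ∈ closure Ω,
      (∀ y ∈ closedBall x (Cj * ξ) ∩ closure Ω, u y - φ y ≤ u x - φ x) →
      (x ∈ Ω → F x (u x) (gradient φ x) (Iin Ω j g ξ φ x + Iout Ω j g ξ u x) ≤ 0) ∧
      (x ∈ frontier Ω →
        min (F x (u x) (gradient φ x) (Iin Ω j g ξ φ x + Iout Ω j g ξ u x))
          ⟪gradient φ x, n x⟫ ≤ 0)

/-- Viscosity supersolution, with generalized Neumann boundary conditions. -/
def IsSuperSol (Ω : Set (Euc N)) (j : Euc N → Euc N → Euc N) (g : Euc N → Euc N → ℝ)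
    (n : Euc N → Euc N) (Cj : ℝ) (F : Euc N → ℝ → Euc N → ℝ → ℝ) (v : Euc N → ℝ) : Prop :=
  ∀ ξ > (0:ℝ), ∀ φ : Euc N → ℝ, ContDiff ℝ 1 φ →
    ∀ x ∈ closure Ω,
      (∀ y ∈ closedBall x (Cj * ξ) ∩ closure Ω, v x - φ x ≤ v y - φ y) →
      (x ∈ Ω → 0 ≤ F x (v x) (gradient φ x) (Iin Ω j g ξ φ x + Iout Ω j g ξ v x)) ∧
      (x ∈ frontier Ω →
        0 ≤ max (F x (v x) (gradient φ x) (Iin Ω j g ξ φ x + Iout Ω j g ξ v x))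
          ⟪gradient φ x, n x⟫)

/-- `F` corresponding to the stationary equation `u - I[u] + H(x,Du) = 0`. -/
def statF (H : Euc N → Euc N → ℝ) : Euc N → ℝ → Euc N → ℝ → ℝ :=
  fun x r p I => r - I + H x p

/-- `F` corresponding to the ergodic equation `λ - I[w] - H(x,Dw) = 0`. -/
def ergF (H : Euc N → Euc N → ℝ) (lam : ℝ) : Euc N → ℝ → Euc N → ℝ → ℝ :=
  fun x _ p I => lam - I - H x p

/-- Parabolic viscosity subsolution with generalized Neumann boundary conditions,
for `F(x, t, ∂_t u, u, Du, I[u(·,t)]) = 0` in `Ω × (0,∞)`. -/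
def IsParSubSol (Ω : Set (Euc N)) (j : Euc N → Euc N → Euc N) (g : Euc N → Euc N → ℝ)
    (n : Euc N → Euc N) (Cj : ℝ) (F : Euc N → ℝ → ℝ → ℝ → Euc N → ℝ → ℝ)
    (u : Euc N → ℝ → ℝ) : Prop :=
  ∀ ξ > (0:ℝ), ∀ φ : Euc N → ℝ → ℝ,
    ContDiff ℝ 1 (fun q : Euc N × ℝ => φ q.1 q.2) →
    ∀ x ∈ closure Ω, ∀ t ∈ Ioi (0:ℝ),
      (∀ y ∈ closedBall x (Cj * ξ) ∩ closure Ω, ∀ s ∈ Ioi (0:ℝ), |s - t| ≤ ξ →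
        u y s - φ y s ≤ u x t - φ x t) →
      (x ∈ Ω →
        F x t (deriv (φ x) t) (u x t) (gradient (fun y => φ y t) x)
          (Iin Ω j g ξ (fun y => φ y t) x + Iout Ω j g ξ (fun y => u y t) x) ≤ 0) ∧
      (x ∈ frontier Ω →
        min (F x t (deriv (φ x) t) (u x t) (gradient (fun y => φ y t) x)
              (Iin Ω j g ξ (fun y => φ y t) x + Iout Ω j g ξ (fun y => u y t) x))
          ⟪gradient (fun y => φ y t) x, n x⟫ ≤ 0)

/-- Parabolic viscosity supersolution with generalized Neumann boundary conditions. -/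
def IsParSuperSol (Ω : Set (Euc N)) (j : Euc N → Euc N → Euc N) (g : Euc N → Euc N → ℝ)
    (n : Euc N → Euc N) (Cj : ℝ) (F : Euc N → ℝ → ℝ → ℝ → Euc N → ℝ → ℝ)
    (v : Euc N → ℝ → ℝ) : Prop :=
  ∀ ξ > (0:ℝ), ∀ φ : Euc N → ℝ → ℝ,
    ContDiff ℝ 1 (fun q : Euc N × ℝ => φ q.1 q.2) →
    ∀ x ∈ closure Ω, ∀ t ∈ Ioi (0:ℝ),
      (∀ y ∈ closedBall x (Cj * ξ) ∩ closure Ω, ∀ s ∈ Ioi (0:ℝ), |s - t| ≤ ξ →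
        v x t - φ x t ≤ v y s - φ y s) →
      (x ∈ Ω →
        0 ≤ F x t (deriv (φ x) t) (v x t) (gradient (fun y => φ y t) x)
          (Iin Ω j g ξ (fun y => φ y t) x + Iout Ω j g ξ (fun y => v y t) x)) ∧
      (x ∈ frontier Ω →
        0 ≤ max (F x t (deriv (φ x) t) (v x t) (gradient (fun y => φ y t) x)
              (Iin Ω j g ξ (fun y => φ y t) x + Iout Ω j g ξ (fun y => v y t) x))
          ⟪gradient (fun y => φ y t) x, n x⟫)

/-- `F` for the parabolic equation `∂_t u - I[u] + H(x,t,u,Du) = 0`. -/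
def parF (H : Euc N → ℝ → ℝ → Euc N → ℝ) : Euc N → ℝ → ℝ → ℝ → Euc N → ℝ → ℝ :=
  fun x t pt r p I => pt - I + H x t r p

/-! ### Hamiltonians: Bellman form and coercive form (stationary) -/




/-- `H` is of Bellman type with drift `b` and cost `l` over the control set `A`. -/
def IsBellman {A : Type} (b : Euc N → A → Euc N) (l : Euc N → A → ℝ)
    (H : Euc N → Euc N → ℝ) : Prop :=
  ∀ x p, H x p = ⨆ α : A, (-⟪b x α, p⟫ - l x α)

/-- Continuity and boundedness of the Bellman data `b, l`. -/
def BellmanData {A : Type} [TopologicalSpace A]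
    (b : Euc N → A → Euc N) (l : Euc N → A → ℝ) : Prop :=
  Continuous (fun q : Euc N × A => b q.1 q.2) ∧ (∃ M, ∀ x α, ‖b x α‖ ≤ M) ∧
  Continuous (fun q : Euc N × A => l q.1 q.2) ∧ (∃ M, ∀ x α, |l x α| ≤ M)

/-- Assumption (C): uniform continuity of the cost `l`. -/
def AssumptionC (Ω : Set (Euc N)) {A : Type} (l : Euc N → A → ℝ) : Prop :=
  ∃ ω, IsModulus ω ∧ ∀ (α : A), ∀ x ∈ closure Ω, ∀ y ∈ closure Ω,
    |l x α - l y α| ≤ ω ‖x - y‖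

/-- Assumption (L): uniform Lipschitz continuity of the drift `b`. -/
def AssumptionL (Ω : Set (Euc N)) {A : Type} (b : Euc N → A → Euc N) : Prop :=
  ∃ C > (0:ℝ), ∀ (α : A), ∀ x ∈ closure Ω, ∀ y ∈ closure Ω,
    ‖b x α - b y α‖ ≤ C * ‖x - y‖

/-- The part of the boundary where the drift points inwards for every control. -/
def GammaIn (Ω : Set (Euc N)) (n : Euc N → Euc N) {A : Type}
    (b : Euc N → A → Euc N) : Set (Euc N) :=
  {x | x ∈ frontier Ω ∧ ∀ α : A, ⟪b x α, n x⟫ < 0}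

/-- The part of the boundary where the drift points outwards for every control. -/
def GammaOut (Ω : Set (Euc N)) (n : Euc N → Euc N) {A : Type}
    (b : Euc N → A → Euc N) : Set (Euc N) :=
  {x | x ∈ frontier Ω ∧ ∀ α : A, 0 < ⟪b x α, n x⟫}

/-- The part of the boundary where the drift points both inwards and outwards. -/
def GammaMix (Ω : Set (Euc N)) (n : Euc N → Euc N) {A : Type}
    (b : Euc N → A → Euc N) : Set (Euc N) :=
  {x | x ∈ frontier Ω ∧ ∃ α₁ α₂ : A, ⟪b x α₁, n x⟫ < 0 ∧ 0 < ⟪b x α₂, n x⟫}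

/-- `S` is a union of connected components of `T`. -/
def IsUnionOfComponents (S T : Set (Euc N)) : Prop :=
  S ⊆ T ∧ ∀ x ∈ S, connectedComponentIn T x ⊆ S

/-- Assumption (B). -/
def AssumptionB (Ω : Set (Euc N)) (n : Euc N → Euc N) {A : Type}
    (b : Euc N → A → Euc N) : Prop :=
  GammaIn Ω n b ∪ GammaOut Ω n b ∪ GammaMix Ω n b = frontier Ω ∧
  IsUnionOfComponents (GammaIn Ω n b) (frontier Ω) ∧
  IsUnionOfComponents (GammaOut Ω n b) (frontier Ω) ∧
  IsUnionOfComponents (GammaMix Ω n b) (frontier Ω)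

/-- All the structural assumptions on a Bellman Hamiltonian: (C), (L), (B) together
with continuity and boundedness of the data. -/
def StatBellmanOK (Ω : Set (Euc N)) (n : Euc N → Euc N) {A : Type} [TopologicalSpace A]
    (b : Euc N → A → Euc N) (l : Euc N → A → ℝ) (H : Euc N → Euc N → ℝ) : Prop :=
  BellmanData b l ∧ IsBellman b l H ∧ AssumptionC Ω l ∧ AssumptionL Ω b ∧ AssumptionB Ω n b

/-- Assumption (H1): superfractional coercivity of order `m > σ`. -/
def AssumptionH1 (Ω : Set (Euc N)) (H : Euc N → Euc N → ℝ) (σ m c₀ D : ℝ) : Prop :=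
  σ < m ∧ 0 < c₀ ∧ 0 < D ∧ ∀ x ∈ closure Ω, ∀ p : Euc N, c₀ * ‖p‖ ^ m - D ≤ H x p

/-- Assumption (Ha) (sublinear case) with constant `C` and modulus `ω₁`. -/
def AssumptionHa (H : Euc N → Euc N → ℝ) (C : ℝ) (ω₁ : ℝ → ℝ) : Prop :=
  0 < C ∧ IsModulus ω₁ ∧
  ∀ x y p q : Euc N, H y p - H x q ≤ ω₁ ‖x - y‖ * (1 + ‖p‖) + C * ‖p - q‖

/-- Assumption (Hb) (superlinear case) with constants `m, A, Cb`. -/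
def AssumptionHb (H : Euc N → Euc N → ℝ) (m A Cb : ℝ) : Prop :=
  1 < m ∧ 0 < A ∧ 0 < Cb ∧
  ∀ μ ∈ Ioo (0:ℝ) 1, ∀ x p : Euc N,
    H x p - μ * H x (μ⁻¹ • p) ≤ (1 - μ) * (Cb * (1 - m) * ‖p‖ ^ m + A)

/-- Assumption (Hc) with constant `C` and modulus `ω₁`. -/
def AssumptionHc (H : Euc N → Euc N → ℝ) (m C : ℝ) (ω₁ : ℝ → ℝ) : Prop :=
  0 < C ∧ IsModulus ω₁ ∧
  ∀ x y p q : Euc N,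
    H y p - H x q ≤ ω₁ ‖x - y‖ * (1 + (max ‖p‖ ‖q‖) ^ m)
      + C * ‖p - q‖ * (max ‖p‖ ‖q‖) ^ (m - 1)

/-- The structural assumptions on a coercive Hamiltonian:
(H1), (Ha) (sublinear) or (H1), (Hb), (Hc) (superlinear). -/
def StatCoerciveOK (Ω : Set (Euc N)) (H : Euc N → Euc N → ℝ) (σ : ℝ) : Prop :=
  ∃ m c₀ D, AssumptionH1 Ω H σ m c₀ D ∧
    ((m ≤ 1 ∧ ∃ C ω₁, AssumptionHa H C ω₁) ∨
     (∃ A Cb, AssumptionHb H m A Cb ∧ ∃ C ω₁, AssumptionHc H m C ω₁))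

/-- Assumption (E). -/
def AssumptionE (Ω : Set (Euc N)) (H : Euc N → Euc N → ℝ) : Prop :=
  ∀ R > (0:ℝ), ∃ HR : ℝ, ∀ x ∈ closure Ω, ∀ p : Euc N, ‖p‖ ≤ R → |H x p| ≤ HR

/-! ### Parabolic Hamiltonians and assumptions -/

/-- `H(x,t,r,p)` is of (time-dependent) Bellman type. -/
def IsParBellman {A : Type} (lam : Euc N → ℝ → A → ℝ) (b : Euc N → ℝ → A → Euc N)
    (l : Euc N → ℝ → A → ℝ) (H : Euc N → ℝ → ℝ → Euc N → ℝ) : Prop :=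
  ∀ x t r p, H x t r p = ⨆ α : A, (lam x t α * r - ⟪b x t α, p⟫ - l x t α)

/-- Continuity and boundedness of the parabolic Bellman data. -/
def ParBellmanData {A : Type} [TopologicalSpace A] (lam : Euc N → ℝ → A → ℝ)
    (b : Euc N → ℝ → A → Euc N) (l : Euc N → ℝ → A → ℝ) : Prop :=
  Continuous (fun q : Euc N × ℝ × A => lam q.1 q.2.1 q.2.2) ∧
  (∃ M, ∀ x t α, |lam x t α| ≤ M) ∧
  Continuous (fun q : Euc N × ℝ × A => b q.1 q.2.1 q.2.2) ∧
  (∃ M, ∀ x t α, ‖b x t α‖ ≤ M) ∧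
  Continuous (fun q : Euc N × ℝ × A => l q.1 q.2.1 q.2.2) ∧
  (∃ M, ∀ x t α, |l x t α| ≤ M)

/-- Assumption (C'): uniform continuity of `l` and `λ` in `(x,t)`, uniformly in `α`. -/
def AssumptionC' (Ω : Set (Euc N)) {A : Type} (lam l : Euc N → ℝ → A → ℝ) : Prop :=
  (∃ ω, IsModulus ω ∧ ∀ (α : A), ∀ x ∈ closure Ω, ∀ y ∈ closure Ω,
      ∀ t ∈ Ici (0:ℝ), ∀ s ∈ Ici (0:ℝ), |l x t α - l y s α| ≤ ω (‖x - y‖ + |t - s|)) ∧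
  (∃ ω, IsModulus ω ∧ ∀ (α : A), ∀ x ∈ closure Ω, ∀ y ∈ closure Ω,
      ∀ t ∈ Ici (0:ℝ), ∀ s ∈ Ici (0:ℝ), |lam x t α - lam y s α| ≤ ω (‖x - y‖ + |t - s|))

/-- Assumption (L'): uniform Lipschitz continuity of the drift `b` in `(x,t)`. -/
def AssumptionL' (Ω : Set (Euc N)) {A : Type} (b : Euc N → ℝ → A → Euc N) : Prop :=
  ∃ C > (0:ℝ), ∀ (α : A), ∀ x ∈ closure Ω, ∀ y ∈ closure Ω, ∀ s ∈ Ici (0:ℝ), ∀ t ∈ Ici (0:ℝ),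
    ‖b x s α - b y t α‖ ≤ C * (‖x - y‖ + |s - t|)

/-- Inward part of the boundary for time-dependent drift. -/
def GammaInT (Ω : Set (Euc N)) (n : Euc N → Euc N) {A : Type}
    (b : Euc N → ℝ → A → Euc N) : Set (Euc N) :=
  {x | x ∈ frontier Ω ∧ ∀ t ∈ Ici (0:ℝ), ∀ α : A, ⟪b x t α, n x⟫ < 0}

/-- Outward part of the boundary for time-dependent drift. -/
def GammaOutT (Ω : Set (Euc N)) (n : Euc N → Euc N) {A : Type}
    (b : Euc N → ℝ → A → Euc N) : Set (Euc N) :=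
  {x | x ∈ frontier Ω ∧ ∀ t ∈ Ici (0:ℝ), ∀ α : A, 0 < ⟪b x t α, n x⟫}

/-- Mixed part of the boundary for time-dependent drift. -/
def GammaMixT (Ω : Set (Euc N)) (n : Euc N → Euc N) {A : Type}
    (b : Euc N → ℝ → A → Euc N) : Set (Euc N) :=
  {x | x ∈ frontier Ω ∧ ∀ t ∈ Ici (0:ℝ),
    ∃ α₁ α₂ : A, ⟪b x t α₁, n x⟫ < 0 ∧ 0 < ⟪b x t α₂, n x⟫}

/-- Assumption (B'). -/
def AssumptionB' (Ω : Set (Euc N)) (n : Euc N → Euc N) {A : Type}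
    (b : Euc N → ℝ → A → Euc N) : Prop :=
  GammaInT Ω n b ∪ GammaOutT Ω n b ∪ GammaMixT Ω n b = frontier Ω ∧
  IsUnionOfComponents (GammaInT Ω n b) (frontier Ω) ∧
  IsUnionOfComponents (GammaOutT Ω n b) (frontier Ω) ∧
  IsUnionOfComponents (GammaMixT Ω n b) (frontier Ω)

/-- All the structural assumptions on a parabolic Bellman Hamiltonian: (C'), (L'), (B'). -/
def ParBellmanOK (Ω : Set (Euc N)) (n : Euc N → Euc N) {A : Type} [TopologicalSpace A]
    (lam : Euc N → ℝ → A → ℝ) (b : Euc N → ℝ → A → Euc N) (l : Euc N → ℝ → A → ℝ)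
    (H : Euc N → ℝ → ℝ → Euc N → ℝ) : Prop :=
  ParBellmanData lam b l ∧ IsParBellman lam b l H ∧
  AssumptionC' Ω lam l ∧ AssumptionL' Ω b ∧ AssumptionB' Ω n b

/-- Assumption (H'): monotonicity of `H` in the `u` variable. -/
def AssumptionH' (Ω : Set (Euc N)) (H : Euc N → ℝ → ℝ → Euc N → ℝ) : Prop :=
  ∃ K : ℝ, ∀ R > (0:ℝ), ∃ γ, -K ≤ γ ∧
    ∀ x ∈ closure Ω, ∀ t ∈ Icc (0:ℝ) R, ∀ r s : ℝ, |r| ≤ R → |s| ≤ R → s ≤ r →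
      ∀ p : Euc N, γ * (r - s) ≤ H x t r p - H x t s p

/-- Assumption (H''): the monotonicity constants `γ_R` are bounded below by some `γ₀ > 0`. -/
def AssumptionH'' (Ω : Set (Euc N)) (H : Euc N → ℝ → ℝ → Euc N → ℝ) : Prop :=
  ∃ γ₀ > (0:ℝ), ∀ R > (0:ℝ), ∃ γ, γ₀ ≤ γ ∧
    ∀ x ∈ closure Ω, ∀ t ∈ Icc (0:ℝ) R, ∀ r s : ℝ, |r| ≤ R → |s| ≤ R → s ≤ r →
      ∀ p : Euc N, γ * (r - s) ≤ H x t r p - H x t s p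

/-- Assumption (E'). -/
def AssumptionE' (Ω : Set (Euc N)) (H : Euc N → ℝ → ℝ → Euc N → ℝ) : Prop :=
  ∀ T > (0:ℝ), ∀ R > (0:ℝ), ∃ HR : ℝ, ∀ x ∈ Ω, ∀ t ∈ Icc (0:ℝ) T, ∀ r : ℝ, ∀ p : Euc N,
    |r| ≤ R → ‖p‖ ≤ R → |H x t r p| ≤ HR

/-- Assumption (H0'): separated structure `H(x,t,r,p) = H₀(x,r,p) - f(x,t)`. -/
def AssumptionH0' (H : Euc N → ℝ → ℝ → Euc N → ℝ) : Prop :=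
  ∃ (H₀ : Euc N → ℝ → Euc N → ℝ) (f : Euc N → ℝ → ℝ),
    Continuous (fun q : Euc N × ℝ × Euc N => H₀ q.1 q.2.1 q.2.2) ∧
    UniformContinuous (fun q : Euc N × ℝ => f q.1 q.2) ∧
    (∃ M, ∀ x t, |f x t| ≤ M) ∧
    ∀ x t r p, H x t r p = H₀ x r p - f x t

/-- Assumption (He'): `H` satisfies (H1), (Ha) in `x`, uniformly in `t`
and uniformly on compact sets in `r` (sublinearly coercive case). -/
def AssumptionHe' (Ω : Set (Euc N)) (H : Euc N → ℝ → ℝ → Euc N → ℝ) (σ : ℝ) : Prop :=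
  ∃ m : ℝ, σ < m ∧ m ≤ 1 ∧
    ∀ R > (0:ℝ),
      (∃ c₀ > (0:ℝ), ∃ D > (0:ℝ), ∀ x ∈ closure Ω, ∀ t ∈ Ici (0:ℝ), ∀ r : ℝ, |r| ≤ R →
        ∀ p : Euc N, c₀ * ‖p‖ ^ m - D ≤ H x t r p) ∧
      (∃ C > (0:ℝ), ∃ ω₁, IsModulus ω₁ ∧ ∀ x y : Euc N, ∀ t ∈ Ici (0:ℝ), ∀ r : ℝ, |r| ≤ R →
        ∀ p q : Euc N, H y t r p - H x t r q ≤ ω₁ ‖x - y‖ * (1 + ‖p‖) + C * ‖p - q‖)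

/-- Assumption (He''): `H` satisfies (H1), (Hb), (Hc) in `x`, uniformly in `t`
and uniformly on compact sets in `r` (superlinearly coercive case, exponent `m`). -/
def AssumptionHe'' (Ω : Set (Euc N)) (H : Euc N → ℝ → ℝ → Euc N → ℝ) (σ m : ℝ) : Prop :=
  1 < m ∧ σ < m ∧
  ∀ R > (0:ℝ),
    (∃ c₀ > (0:ℝ), ∃ D > (0:ℝ), ∀ x ∈ closure Ω, ∀ t ∈ Ici (0:ℝ), ∀ r : ℝ, |r| ≤ R →
      ∀ p : Euc N, c₀ * ‖p‖ ^ m - D ≤ H x t r p) ∧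
    (∃ A > (0:ℝ), ∃ Cb > (0:ℝ), ∀ μ ∈ Ioo (0:ℝ) 1, ∀ x ∈ closure Ω, ∀ t ∈ Ici (0:ℝ),
      ∀ r : ℝ, |r| ≤ R → ∀ p : Euc N,
        H x t r p - μ * H x t r (μ⁻¹ • p) ≤ (1 - μ) * (Cb * (1 - m) * ‖p‖ ^ m + A)) ∧
    (∃ C > (0:ℝ), ∃ ω₁, IsModulus ω₁ ∧ ∀ x y : Euc N, ∀ t ∈ Ici (0:ℝ), ∀ r : ℝ, |r| ≤ R →
      ∀ p q : Euc N, H y t r p - H x t r q ≤ ω₁ ‖x - y‖ * (1 + (max ‖p‖ ‖q‖) ^ m)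
        + C * ‖p - q‖ * (max ‖p‖ ‖q‖) ^ (m - 1))

/-- Structural parabolic coercive assumptions: (H0') and (He') or (He''). -/
def ParCoerciveOK (Ω : Set (Euc N)) (H : Euc N → ℝ → ℝ → Euc N → ℝ) (σ : ℝ) : Prop :=
  AssumptionH0' H ∧ (AssumptionHe' Ω H σ ∨ ∃ m, AssumptionHe'' Ω H σ m)

/-! ### Iterative covering property -/

/-- The iterated reachable sets `X_r(x)` of the censored jump process. -/
def Xiter (Ω : Set (Euc N)) (j : Euc N → Euc N → Euc N) (g : Euc N → Euc N → ℝ)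
    (x : Euc N) : ℕ → Set (Euc N)
  | 0 => {x}
  | r + 1 => (⋃ ξ ∈ Xiter Ω j g x r,
      (fun z => ξ + j ξ z) '' closure (Function.support (g ξ))) ∩ closure Ω

/-- Iterative covering property: `𝒳(x) = Ω` (i.e. the closure of the reachable set
is all of `closure Ω`) for every `x ∈ Ω`. -/
def CoveringProperty (Ω : Set (Euc N)) (j : Euc N → Euc N → Euc N)
    (g : Euc N → Euc N → ℝ) : Prop :=
  ∀ x ∈ Ω, closure (⋃ r : ℕ, Xiter Ω j g x r) = closure Ω

/-- the reference kernel -/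
def kern (σ : ℝ) (z : Euc N) : ℝ := ‖z‖ ^ (-((N : ℝ) + σ))

lemma kern_nonneg (σ : ℝ) (z : Euc N) : 0 ≤ kern σ z := Real.rpow_nonneg (norm_nonneg _) _

lemma kern_measurable (σ : ℝ) : Measurable (kern (N := N) σ) := by
  unfold kern
  exact measurable_norm.pow_const _

lemma pow_mul_kern {N : ℕ} (hN : 0 < N) (σ y : ℝ) (hy : 0 < y) :
    y ^ (N - 1) • (y ^ (-((N : ℝ) + σ))) = y ^ (-1 - σ) := by
  rw [smul_eq_mul, ← Real.rpow_natCast, ← Real.rpow_add hy]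
  congr 1
  rw [Nat.cast_sub hN]; push_cast; ring

lemma pow_mul_kern' {N : ℕ} (hN : 0 < N) (σ y : ℝ) (hy : 0 < y) :
    y ^ (N - 1) • (y * y ^ (-((N : ℝ) + σ))) = y ^ (-σ) := by
  have := pow_mul_kern hN σ y hy
  rw [smul_eq_mul] at *
  rw [mul_left_comm, this]
  nth_rw 1 [← Real.rpow_one y]
  rw [← Real.rpow_add hy]; congr 1; ring

lemma kern_facts (hN : 0 < N) (σ : ℝ) (hσ : σ ∈ Ioo (0:ℝ) 1) :
    ∃ C > (0:ℝ), ∀ r > (0:ℝ),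
      IntegrableOn (fun z : Euc N => ‖z‖ * kern σ z) (ball 0 r) ∧
      ∫ z in ball (0 : Euc N) r, ‖z‖ * kern σ z ≤ C * r ^ (1 - σ) ∧
      IntegrableOn (fun z : Euc N => kern σ z) {z | r ≤ ‖z‖} ∧
      ∫ z in {z : Euc N | r ≤ ‖z‖}, kern σ z ≤ C * r ^ (-σ) := by
  obtain ⟨h0, h1⟩ := hσ
  haveI : Nonempty (Fin N) := ⟨⟨0, hN⟩⟩
  haveI : Nontrivial (Euc N) := inferInstance
  set V : ℝ := N * (volume : Measure (Euc N)).real (ball 0 1) with hV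
  have hV0 : 0 ≤ V := by positivity
  have hdim : Module.finrank ℝ (Euc N) = N := by simp
  refine ⟨V / (1 - σ) + V / σ + 1, ?_, fun r hr => ?_⟩
  · have : 0 < 1 - σ := by linarith
    positivity
  have hs : (0:ℝ) < 1 - σ := by linarith
  have hr1 : 0 < r ^ (1 - σ) := Real.rpow_pos_of_pos hr _
  have hr2 : 0 < r ^ (-σ) := Real.rpow_pos_of_pos hr _
  have i1 : IntegrableOn (fun y : ℝ => y ^ (N - 1) • (y * y ^ (-((N : ℝ) + σ)))) (Ioo 0 r) := by
    rw [integrableOn_congr_fun (g := fun y : ℝ => y ^ (-σ))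
      (fun y hy => pow_mul_kern' hN σ y hy.1) measurableSet_Ioo]
    exact (intervalIntegral.integrableOn_Ioo_rpow_iff hr).2 (by linarith)
  have i2 : IntegrableOn (fun y : ℝ => y ^ (-1 - σ)) (Ici r) := by
    rw [integrableOn_Ici_iff_integrableOn_Ioi]
    exact integrableOn_Ioi_rpow_of_lt (by linarith) hr
  have e2 : (fun y : ℝ => y ^ (N - 1) • ((Ici r).indicator (fun y : ℝ => y ^ (-((N : ℝ) + σ))) y))
      = (Ici r).indicator (fun y : ℝ => y ^ (-1 - σ)) := by
    funext y
    by_cases hy : y ∈ Ici r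
    · rw [indicator_of_mem hy, indicator_of_mem hy,
        pow_mul_kern hN σ y (lt_of_lt_of_le hr hy)]
    · rw [indicator_of_notMem hy, indicator_of_notMem hy, smul_zero]
  have hm : MeasurableSet {z : Euc N | r ≤ ‖z‖} := measurableSet_le measurable_const measurable_norm
  have e3 : ({z : Euc N | r ≤ ‖z‖}).indicator (fun z => kern σ z) =
      fun z => (Ici r).indicator (fun y : ℝ => y ^ (-((N : ℝ) + σ))) ‖z‖ := by
    funext z
    by_cases hz : r ≤ ‖z‖ <;> simp [indicator, hz, kern]
  have e4 : (ball (0 : Euc N) r).indicator (fun z => ‖z‖ * kern σ z) =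
      fun z => (Iio r).indicator (fun y : ℝ => y * y ^ (-((N : ℝ) + σ))) ‖z‖ := by
    funext z
    by_cases hz : ‖z‖ < r <;> simp [indicator, hz, kern]
  refine ⟨?_, ?_, ?_, ?_⟩
  · have := (integrableOn_fun_norm_addHaar (volume : Measure (Euc N))
      (f := fun y : ℝ => y * y ^ (-((N : ℝ) + σ))) (r := r)).2 (by rw [hdim]; exact i1)
    exact this
  · rw [← integral_indicator measurableSet_ball, e4, integral_fun_norm_addHaar, hdim]
    have : ∫ y in Ioi (0:ℝ), y ^ (N - 1) • (Iio r).indicator (fun y : ℝ => y * y ^ (-((N : ℝ) + σ))) y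
        = r ^ (1 - σ) / (1 - σ) := by
      have : ∀ y ∈ Ioi (0:ℝ), y ^ (N - 1) • (Iio r).indicator (fun y : ℝ => y * y ^ (-((N : ℝ) + σ))) y
        = (Iio r).indicator (fun y : ℝ => y ^ (-σ)) y := by
        intro y hy
        by_cases hy' : y ∈ Iio r
        · rw [indicator_of_mem hy', indicator_of_mem hy', pow_mul_kern' hN σ y hy]
        · rw [indicator_of_notMem hy', indicator_of_notMem hy', smul_zero]
      rw [setIntegral_congr_fun measurableSet_Ioi this, setIntegral_indicator measurableSet_Iio,
        Ioi_inter_Iio, ← integral_Ioc_eq_integral_Ioo, ← intervalIntegral.integral_of_le hr.le,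
        integral_rpow (Or.inl (by linarith)), Real.zero_rpow (by linarith)]
      rw [show -σ + 1 = 1 - σ by ring]; ring
    rw [this]
    simp only [nsmul_eq_mul, smul_eq_mul]
    rw [← mul_assoc, ← hV]
    have h3 : 0 ≤ V / σ + 1 := by positivity
    have : V * (r ^ (1 - σ) / (1 - σ)) = V / (1 - σ) * r ^ (1 - σ) := by ring
    rw [this]; nlinarith
  · rw [← integrable_indicator_iff hm, e3, integrable_fun_norm_addHaar, hdim, e2]
    exact (i2.integrable_indicator measurableSet_Ici).integrableOn
  · rw [← integral_indicator hm, e3, integral_fun_norm_addHaar, hdim, e2,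
      setIntegral_indicator measurableSet_Ici]
    have : Ioi (0:ℝ) ∩ Ici r = Ici r := inter_eq_right.2 (fun y hy => lt_of_lt_of_le hr hy)
    rw [this, integral_Ici_eq_integral_Ioi, integral_Ioi_rpow_of_lt (by linarith) hr]
    simp only [nsmul_eq_mul, smul_eq_mul]
    rw [← mul_assoc, ← hV]
    have h3 : 0 ≤ V / (1 - σ) + 1 := by positivity
    have : V * (-r ^ (-1 - σ + 1) / (-1 - σ + 1)) = V / σ * r ^ (-σ) := by
      rw [show -1 - σ + 1 = -σ by ring]; field_simp
    rw [this]; nlinarith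

/-- dyadic estimate for the mismatch set -/
lemma mismatch_integral (hN : 0 < N) (σ : ℝ) (hσ : σ ∈ Ioo (0:ℝ) 1) :
    ∃ C > (0:ℝ), ∀ (S : Set (Euc N)) (ρ a Cm : ℝ), MeasurableSet S → 0 < ρ → 0 ≤ a → 0 ≤ Cm →
      ∀ k : ℕ, (∀ i < k, (volume (S ∩ ball 0 (ρ * 2⁻¹ ^ i))).toReal ≤
          Cm * a * (ρ * 2⁻¹ ^ i) ^ N) →
        ∫ z in S ∩ {z | ρ * 2⁻¹ ^ k ≤ ‖z‖ ∧ ‖z‖ < ρ}, ‖z‖ * kern σ z ≤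
          C * Cm * a * (ρ ^ (1 - σ) - (ρ * 2⁻¹ ^ k) ^ (1 - σ)) := by
  obtain ⟨h0, h1⟩ := hσ
  have hs : (0:ℝ) < 1 - σ := by linarith
  have hq : (2⁻¹:ℝ) ^ (1 - σ) < 1 := Real.rpow_lt_one (by norm_num) (by norm_num) hs
  set q : ℝ := (2⁻¹:ℝ) ^ (1 - σ) with hqdef
  refine ⟨(2:ℝ) ^ ((N:ℝ) + σ) / (1 - q), by
    have : 0 < 1 - q := by linarith
    positivity, ?_⟩
  intro S ρ a Cm hS hρ ha hCm k
  have hq' : 0 < 1 - q := by linarith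
  have hmA : ∀ s t : ℝ, MeasurableSet {z : Euc N | s ≤ ‖z‖ ∧ ‖z‖ < t} := fun s t =>
    (measurableSet_le measurable_const measurable_norm).inter
      (measurableSet_lt measurable_norm measurable_const)
  obtain ⟨C0, -, hC0⟩ := kern_facts hN σ ⟨h0, h1⟩
  have hint := (hC0 ρ hρ).1
  induction k with
  | zero =>
    intro _
    have : S ∩ {z : Euc N | ρ * 2⁻¹ ^ 0 ≤ ‖z‖ ∧ ‖z‖ < ρ} = ∅ := by
      ext z; simp
    rw [this]; simp
  | succ k ih =>
    intro hv
    have ih' := ih (fun i hi => hv i (by omega))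
    have hvk := hv k (by omega)
    set s : ℝ := ρ * 2⁻¹ ^ k with hsdef
    have hs0 : 0 < s := by positivity
    have hs1 : ρ * 2⁻¹ ^ (k+1) = s * 2⁻¹ := by rw [pow_succ, ← mul_assoc]
    rw [hs1]
    have hsρ : s ≤ ρ := by
      have : (2⁻¹:ℝ) ^ k ≤ 1 := pow_le_one₀ (by norm_num) (by norm_num)
      nlinarith
    have hsplit : S ∩ {z : Euc N | s * 2⁻¹ ≤ ‖z‖ ∧ ‖z‖ < ρ} =
        (S ∩ {z | s ≤ ‖z‖ ∧ ‖z‖ < ρ}) ∪ (S ∩ {z | s * 2⁻¹ ≤ ‖z‖ ∧ ‖z‖ < s}) := by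
      rw [← inter_union_distrib_left]; congr 1
      ext z; simp only [mem_setOf_eq, mem_union]
      constructor
      · rintro ⟨h, h'⟩
        rcases le_or_gt s ‖z‖ with h2 | h2
        · exact Or.inl ⟨h2, h'⟩
        · exact Or.inr ⟨h, h2⟩
      · rintro (⟨h, h'⟩ | ⟨h, h'⟩)
        · exact ⟨by linarith, h'⟩
        · exact ⟨h, by linarith⟩
    have hio : ∀ s' t, t ≤ ρ → IntegrableOn (fun z : Euc N => ‖z‖ * kern σ z)
        (S ∩ {z | s' ≤ ‖z‖ ∧ ‖z‖ < t}) := fun s' t ht =>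
      hint.mono_set (fun z hz => by simpa using lt_of_lt_of_le hz.2.2 ht)
    rw [hsplit, setIntegral_union ?_ (hS.inter (hmA _ _)) (hio _ _ le_rfl) (hio _ _ hsρ)]
    swap
    · rw [Set.disjoint_left]; rintro z ⟨_, hz, _⟩ ⟨_, _, hz'⟩; linarith
    have hshell : ∫ z in S ∩ {z : Euc N | s * 2⁻¹ ≤ ‖z‖ ∧ ‖z‖ < s}, ‖z‖ * kern σ z ≤
        (s * (s * 2⁻¹) ^ (-((N:ℝ) + σ))) * (volume (S ∩ ball (0 : Euc N) s)).toReal := by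
      have hfin : volume (S ∩ ball (0 : Euc N) s) ≠ ⊤ :=
        measure_ne_top_of_subset inter_subset_right measure_ball_lt_top.ne
      have hsub : S ∩ {z : Euc N | s * 2⁻¹ ≤ ‖z‖ ∧ ‖z‖ < s} ⊆ S ∩ ball 0 s :=
        fun z hz => ⟨hz.1, by simpa using hz.2.2⟩
      calc ∫ z in S ∩ {z : Euc N | s * 2⁻¹ ≤ ‖z‖ ∧ ‖z‖ < s}, ‖z‖ * kern σ z
          ≤ ∫ z in S ∩ {z : Euc N | s * 2⁻¹ ≤ ‖z‖ ∧ ‖z‖ < s},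
              (s * (s * 2⁻¹) ^ (-((N:ℝ) + σ))) := by
            refine setIntegral_mono_on (hio _ _ hsρ) ?_ (hS.inter (hmA _ _)) ?_
            · exact integrableOn_const (measure_ne_top_of_subset hsub hfin)
            · rintro z ⟨_, hz, hz'⟩
              refine mul_le_mul hz'.le ?_ (kern_nonneg _ _) hs0.le
              exact Real.rpow_le_rpow_of_nonpos (by positivity) hz (by
                have : (0:ℝ) ≤ N := by positivity
                linarith)
        _ = (volume.real (S ∩ {z : Euc N | s * 2⁻¹ ≤ ‖z‖ ∧ ‖z‖ < s})) *
              (s * (s * 2⁻¹) ^ (-((N:ℝ) + σ))) := by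
            rw [setIntegral_const, smul_eq_mul]
        _ ≤ _ := by
            rw [mul_comm]
            refine mul_le_mul_of_nonneg_left ?_ (by positivity)
            exact ENNReal.toReal_mono hfin (measure_mono hsub)
    have hcalc : (s * (s * 2⁻¹) ^ (-((N:ℝ) + σ))) * (Cm * a * s ^ N) =
        (2:ℝ) ^ ((N:ℝ) + σ) * Cm * a * s ^ (1 - σ) := by
      rw [Real.mul_rpow hs0.le (by norm_num), Real.inv_rpow (by norm_num),
        Real.rpow_neg (by norm_num : (0:ℝ) ≤ 2), inv_inv]
      have : s * s ^ (-((N:ℝ) + σ)) * s ^ N = s ^ (1 - σ) := by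
        rw [← Real.rpow_natCast s N]
        nth_rw 1 [← Real.rpow_one s]
        rw [← Real.rpow_add hs0, ← Real.rpow_add hs0]; congr 1; ring
      rw [← this]; ring
    have h2 : (s * 2⁻¹) ^ (1 - σ) = s ^ (1 - σ) * q := by
      rw [Real.mul_rpow hs0.le (by norm_num)]
    have h3 : (s * (s * 2⁻¹) ^ (-((N:ℝ) + σ))) * (volume (S ∩ ball (0 : Euc N) s)).toReal ≤
        (2:ℝ) ^ ((N:ℝ) + σ) * Cm * a * s ^ (1 - σ) := by
      rw [← hcalc]
      exact mul_le_mul_of_nonneg_left hvk (by positivity)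
    rw [h2]
    have h4 : (2:ℝ) ^ ((N:ℝ) + σ) / (1 - q) * Cm * a * (ρ ^ (1 - σ) - s ^ (1 - σ) * q) =
      (2:ℝ) ^ ((N:ℝ) + σ) / (1 - q) * Cm * a * (ρ ^ (1 - σ) - s ^ (1 - σ)) +
      (2:ℝ) ^ ((N:ℝ) + σ) * Cm * a * s ^ (1 - σ) := by
      field_simp; ring
    rw [h4]
    linarith

lemma sdist_lip (Ω : Set (Euc N)) (x y : Euc N) : |sdist Ω x - sdist Ω y| ≤ 2 * ‖x - y‖ := by
  have h1 := (lipschitz_infDist_pt Ω).dist_le_mul x y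
  have h2 := (lipschitz_infDist_pt Ωᶜ).dist_le_mul x y
  rw [Real.dist_eq, dist_eq_norm] at h1 h2
  simp only [NNReal.coe_one, one_mul] at h1 h2
  unfold sdist
  rw [abs_le] at *
  constructor <;> linarith [h1.1, h1.2, h2.1, h2.2]

lemma sdist_lipschitz (Ω : Set (Euc N)) : LipschitzWith 2 (sdist Ω) :=
  LipschitzWith.of_dist_le_mul fun x y => by
    rw [Real.dist_eq, dist_eq_norm]; exact_mod_cast sdist_lip Ω x y

lemma mem_closure_iff_sdist {Ω : Set (Euc N)} (hne : Ω.Nonempty) (x : Euc N) :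
    x ∈ closure Ω ↔ 0 ≤ sdist Ω x := by
  unfold sdist
  constructor
  · intro h
    rw [(mem_closure_iff_infDist_zero hne).1 h]; simpa using infDist_nonneg
  · intro h
    rw [mem_closure_iff_infDist_zero hne]
    by_contra h'
    have h0 : 0 < infDist x Ω := lt_of_le_of_ne infDist_nonneg (Ne.symm h')
    have : x ∈ Ωᶜ := by
      intro hx; exact h' (infDist_zero_of_mem hx)
    rw [infDist_zero_of_mem this] at h
    linarith

lemma sdist_frontier {Ω : Set (Euc N)} (hΩ : IsOpen Ω) {x : Euc N} (hx : x ∈ frontier Ω) :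
    sdist Ω x = 0 := by
  have hx' : x ∈ closure Ω ∧ x ∉ Ω := by
    rw [hΩ.frontier_eq] at hx; exact hx
  have hne : Ω.Nonempty := closure_nonempty_iff.1 ⟨x, hx'.1⟩
  unfold sdist
  rw [(mem_closure_iff_infDist_zero hne).1 hx'.1, infDist_zero_of_mem (show x ∈ Ωᶜ from hx'.2)]
  simp

/-- local regularity of the signed distance near a boundary point -/
lemma sdist_regular {hN : 0 < N} {Ω : Set (Euc N)} (hΩ : IsW2Domain hN Ω) {s : Euc N}
    (hs : s ∈ frontier Ω) :
    ∃ r > (0:ℝ), ∃ L > (0:ℝ), ContDiffOn ℝ 1 (sdist Ω) (ball s r) ∧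
      ∀ x ∈ ball s r, ∀ y ∈ ball s r,
        ‖fderiv ℝ (sdist Ω) x - fderiv ℝ (sdist Ω) y‖ ≤ L * ‖x - y‖ := by
  obtain ⟨r, ψ, ψinv, hr, hψ, ⟨L, hL⟩, -, -, -, hd⟩ := hΩ.2 s hs
  set i : Fin N := ⟨N - 1, Nat.sub_lt hN Nat.one_pos⟩
  set P : Euc N →L[ℝ] ℝ := EuclideanSpace.proj i with hP
  have heq : ∀ x ∈ ball s r, sdist Ω x = (P ∘ ψ) x := fun x hx => by
    rw [← hd x hx]; simp [hP]
  have hfd : ∀ x ∈ ball s r, fderiv ℝ (sdist Ω) x = P.comp (fderiv ℝ ψ x) := by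
    intro x hx
    have he : sdist Ω =ᶠ[𝓝 x] (P ∘ ψ) := by
      filter_upwards [isOpen_ball.mem_nhds hx] with y hy using heq y hy
    rw [he.fderiv_eq]
    have hdx : DifferentiableAt ℝ ψ x :=
      (hψ.contDiffAt (isOpen_ball.mem_nhds hx)).differentiableAt (by norm_num)
    exact (P.hasFDerivAt.comp x hdx.hasFDerivAt).fderiv
  refine ⟨r, hr, ‖P‖ * L + 1, by positivity, ?_, ?_⟩
  · exact (P.contDiff.comp_contDiffOn hψ).congr heq
  · intro x hx y hy
    rw [hfd x hx, hfd y hy, ← ContinuousLinearMap.comp_sub]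
    have h1 := hL.dist_le_mul x hx y hy
    rw [dist_eq_norm, dist_eq_norm] at h1
    calc _ ≤ ‖P‖ * ‖fderiv ℝ ψ x - fderiv ℝ ψ y‖ := ContinuousLinearMap.opNorm_comp_le _ _
      _ ≤ ‖P‖ * (L * ‖x - y‖) := by gcongr
      _ ≤ _ := by nlinarith [norm_nonneg (x - y)]

lemma fderiv_sdist_frontier {Ω : Set (Euc N)} {n : Euc N → Euc N} (hn : IsExteriorNormal Ω n)
    {x : Euc N} (hx : x ∈ frontier Ω) (h : Euc N) :
    fderiv ℝ (sdist Ω) x h = -⟪n x, h⟫ := by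
  have := (hn x hx).2.hasFDerivAt.fderiv
  rw [this]; simp

lemma norm_fderiv_sdist_le (Ω : Set (Euc N)) (x : Euc N) : ‖fderiv ℝ (sdist Ω) x‖ ≤ 2 := by
  simpa using norm_fderiv_le_of_lipschitz ℝ (sdist_lipschitz Ω) (x₀ := x)

/-- mixed second differences -/
lemma mixed_diff {F : Type*} [NormedAddCommGroup F] [NormedSpace ℝ F]
    {f : Euc N → F} {xb : Euc N} {r L : ℝ}
    (hd : ∀ x ∈ ball xb r, DifferentiableAt ℝ f x)
    (hL : ∀ x ∈ ball xb r, ∀ y ∈ ball xb r, ‖fderiv ℝ f x - fderiv ℝ f y‖ ≤ L * ‖x - y‖)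
    {x y h : Euc N} (hx : ‖x - xb‖ < r / 2) (hy : ‖y - xb‖ < r / 2) (hh : ‖h‖ < r / 2) :
    ‖(f (x + h) - f x) - (f (y + h) - f y)‖ ≤ L * ‖x - y‖ * ‖h‖ := by
  have hin : ∀ x : Euc N, ‖x - xb‖ < r / 2 → ∀ k ∈ ball (0 : Euc N) (r/2), x + k ∈ ball xb r := by
    intro x hx k hk
    rw [mem_ball_zero_iff] at hk
    rw [mem_ball, dist_eq_norm]
    calc ‖x + k - xb‖ = ‖(x - xb) + k‖ := by congr 1; abel
      _ ≤ ‖x - xb‖ + ‖k‖ := norm_add_le _ _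
      _ < r := by linarith
  have hr : 0 < r / 2 := lt_of_le_of_lt (norm_nonneg _) hh
  have key := Convex.norm_image_sub_le_of_norm_hasFDerivWithin_le (𝕜 := ℝ)
    (f := fun k => f (x + k) - f (y + k)) (f' := fun k => fderiv ℝ f (x + k) - fderiv ℝ f (y + k))
    (s := ball (0 : Euc N) (r/2)) (C := L * ‖x - y‖) (x := 0) (y := h) ?_ ?_ (convex_ball _ _)
    (by simpa using hr) (by simpa using hh)
  · simp only [add_zero, sub_zero] at key
    convert key using 2
    abel
  · intro k hk
    have h1 := (hd _ (hin x hx k hk)).hasFDerivAt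
    have h2 := (hd _ (hin y hy k hk)).hasFDerivAt
    have a1 : HasFDerivAt (fun k => f (x + k)) (fderiv ℝ f (x + k)) k := (hasFDerivAt_comp_add_left x).2 h1
    have a2 : HasFDerivAt (fun k => f (y + k)) (fderiv ℝ f (y + k)) k := (hasFDerivAt_comp_add_left y).2 h2
    exact (a1.sub a2).hasFDerivWithinAt
  · intro k hk
    have := hL _ (hin x hx k hk) _ (hin y hy k hk)
    simpa using this

/-- first order Taylor with quadratic remainder -/
lemma taylor_quad {F : Type*} [NormedAddCommGroup F] [NormedSpace ℝ F]
    {f : Euc N → F} {xb : Euc N} {r L : ℝ} (hL0 : 0 ≤ L)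
    (hd : ∀ x ∈ ball xb r, DifferentiableAt ℝ f x)
    (hL : ∀ x ∈ ball xb r, ∀ y ∈ ball xb r, ‖fderiv ℝ f x - fderiv ℝ f y‖ ≤ L * ‖x - y‖)
    {x y : Euc N} (hx : x ∈ ball xb r) (hy : y ∈ ball xb r) :
    ‖f y - f x - fderiv ℝ f x (y - x)‖ ≤ L * ‖x - y‖ * ‖x - y‖ := by
  have hseg : segment ℝ x y ⊆ ball xb r := (convex_ball xb r).segment_subset hx hy
  have := Convex.norm_image_sub_le_of_norm_hasFDerivWithin_le' (𝕜 := ℝ)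
    (f := f) (f' := fun k => fderiv ℝ f k) (φ := fderiv ℝ f x)
    (s := segment ℝ x y) (C := L * ‖x - y‖) (x := x) (y := y) ?_ ?_ (convex_segment _ _)
    (left_mem_segment _ _ _) (right_mem_segment _ _ _)
  · rwa [norm_sub_rev y x] at this
  · intro k hk; exact (hd k (hseg hk)).hasFDerivAt.hasFDerivWithinAt
  · intro k hk
    refine (hL k (hseg hk) x hx).trans ?_
    gcongr
    have h3 := norm_sub_le_of_mem_segment hk
    rwa [norm_sub_rev y x] at h3

/-- abstract slab estimate: a function decreasing along a unit direction. -/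
lemma slab_abstract (hN : 0 < N) (f : Euc N → ℝ) (hf : Measurable f) (e : Euc N) (he : ‖e‖ = 1)
    (R ϑ : ℝ) (hR : 0 < R) (hϑ : 0 < ϑ)
    (hdec : ∀ h : Euc N, ‖h‖ < R → ∀ a : ℝ, 0 ≤ a → ‖h + a • e‖ < R → f (h + a • e) ≤ f h - a / 2) :
    (volume {h : Euc N | ‖h‖ < R ∧ 0 ≤ f h ∧ f h ≤ ϑ}).toReal ≤
      8 * 2 ^ N * (volume (ball (0 : Euc N) 1)).toReal * ϑ * R ^ (N - 1) := by
  set S : Set (Euc N) := {h : Euc N | ‖h‖ < R ∧ 0 ≤ f h ∧ f h ≤ ϑ} with hS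
  set V := (volume (ball (0 : Euc N) 1)).toReal
  have hV : 0 ≤ V := ENNReal.toReal_nonneg
  have hball : ∀ R > (0:ℝ), (volume (ball (0 : Euc N) R)).toReal = R ^ N * V := by
    intro R hR
    rw [Measure.addHaar_ball_of_pos volume 0 hR, ENNReal.toReal_mul, ENNReal.toReal_ofReal (by positivity)]
    simp [V]
  have hSm : MeasurableSet S := by
    refine (measurableSet_lt measurable_norm measurable_const).inter ?_
    exact (measurableSet_le measurable_const hf).inter (measurableSet_le hf measurable_const)
  have hSb : S ⊆ ball 0 R := fun h hh => by simpa using hh.1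
  have hpow : R ^ N = R * R ^ (N - 1) := by
    rw [← pow_succ', Nat.sub_add_cancel hN]
  have hSR : (volume S).toReal ≤ R ^ N * V := by
    rw [← hball R hR]
    exact ENNReal.toReal_mono measure_ball_lt_top.ne (measure_mono hSb)
  have h2N : (1:ℝ) ≤ 2 ^ N := one_le_pow₀ (by norm_num)
  have hRp : 0 < R ^ (N - 1) := by positivity
  rcases lt_or_ge (R / 4) ϑ with hc | hc
  · refine hSR.trans ?_
    rw [hpow]
    have h1 : R ≤ 8 * 2 ^ N * ϑ := by nlinarith
    have : R * R ^ (N - 1) * V ≤ (8 * 2 ^ N * ϑ) * R ^ (N - 1) * V := by gcongr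
    linarith
  · -- many disjoint translates
    set m : ℕ := ⌊R / (4 * ϑ)⌋₊ with hm
    have hx1 : 1 ≤ R / (4 * ϑ) := by rw [le_div_iff₀ (by positivity)]; linarith
    have hm1 : 1 ≤ m := Nat.le_floor (by simpa using hx1)
    have hmle : (m : ℝ) ≤ R / (4 * ϑ) := Nat.floor_le (by positivity)
    have hmge : R / (4 * ϑ) < m + 1 := Nat.lt_floor_add_one _
    have hm1' : (1:ℝ) ≤ m := by exact_mod_cast hm1
    set T : ℕ → Set (Euc N) := fun k => (fun h => h + (-(4 * k * ϑ)) • e) ⁻¹' S with hT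
    have hTvol : ∀ k, volume (T k) = volume S := fun k => measure_preimage_add_right _ _ _
    have hTm : ∀ k, MeasurableSet (T k) := fun k => hSm.preimage (measurable_add_const _)
    have hdisj : ∀ k l : ℕ, k < l → Disjoint (T k) (T l) := by
      intro k l hkl
      rw [Set.disjoint_left]
      intro h hk hl
      have hkl' : (1:ℝ) ≤ (l:ℝ) - k := by
        have : (k:ℝ) + 1 ≤ l := by exact_mod_cast hkl
        linarith
      have hk' : h + (-(4 * (k:ℝ) * ϑ)) • e ∈ S := hk
      have hl' : h + (-(4 * (l:ℝ) * ϑ)) • e ∈ S := hl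
      have heq : h + (-(4 * (k:ℝ) * ϑ)) • e =
          (h + (-(4 * (l:ℝ) * ϑ)) • e) + (4 * ((l:ℝ) - k) * ϑ) • e := by
        rw [add_assoc, ← add_smul]; congr 2; ring
      have := hdec _ hl'.1 (4 * ((l:ℝ) - k) * ϑ) (by positivity) (by rw [← heq]; exact hk'.1)
      rw [← heq] at this
      have h3 := hk'.2.1
      have h4 := hl'.2.2
      nlinarith
    have hsub : (⋃ k ∈ Finset.range m, T k) ⊆ ball 0 (2 * R) := by
      intro h hh
      simp only [mem_iUnion] at hh
      obtain ⟨k, hk, hh⟩ := hh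
      have hk' : (k:ℝ) ≤ m := by exact_mod_cast (Finset.mem_range.1 hk).le
      have h1 : ‖h + (-(4 * (k:ℝ) * ϑ)) • e‖ < R := hh.1
      rw [mem_ball_zero_iff]
      have h2 : ‖(4 * (k:ℝ) * ϑ) • e‖ ≤ R := by
        rw [norm_smul, he, mul_one, Real.norm_of_nonneg (by positivity)]
        have : (k:ℝ) * (4 * ϑ) ≤ R := by
          have h5 := hk'.trans hmle
          rwa [le_div_iff₀ (by positivity)] at h5
        linarith
      calc ‖h‖ = ‖(h + (-(4 * (k:ℝ) * ϑ)) • e) + (4 * (k:ℝ) * ϑ) • e‖ := by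
            congr 1; rw [add_assoc, ← add_smul]; simp
        _ ≤ _ := norm_add_le _ _
        _ < 2 * R := by linarith
    have hsum : volume (⋃ k ∈ Finset.range m, T k) = m * volume S := by
      rw [measure_biUnion_finset ?_ (fun k _ => hTm k)]
      · simp [hTvol]
      · intro k _ l _ hkl
        rcases lt_or_gt_of_ne hkl with h | h
        · exact hdisj k l h
        · exact (hdisj l k h).symm
    have hle : (m:ℝ) * (volume S).toReal ≤ (2 * R) ^ N * V := by
      rw [← hball (2 * R) (by positivity)]
      have := ENNReal.toReal_mono measure_ball_lt_top.ne (measure_mono (μ := volume) hsub)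
      rwa [hsum, ENNReal.toReal_mul, ENNReal.toReal_natCast] at this
    have h8 : R ≤ 8 * ϑ * m := by
      have h9 : R < (m + 1) * (4 * ϑ) := by rwa [div_lt_iff₀ (by positivity)] at hmge
      nlinarith
    have hSnn : 0 ≤ (volume S).toReal := ENNReal.toReal_nonneg
    rw [mul_pow, hpow] at hle
    have : R * (volume S).toReal ≤ R * (8 * 2 ^ N * V * ϑ * R ^ (N - 1)) := by
      calc R * (volume S).toReal ≤ (8 * ϑ * m) * (volume S).toReal := by gcongr
        _ = 8 * ϑ * (m * (volume S).toReal) := by ring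
        _ ≤ 8 * ϑ * (2 ^ N * (R * R ^ (N - 1)) * V) := by gcongr
        _ = _ := by ring
    exact le_of_mul_le_mul_left this hR

/-- slab estimate for the signed distance near a boundary point -/
lemma slab_sdist {hN : 0 < N} {Ω : Set (Euc N)} (hΩ : IsW2Domain hN Ω)
    {n : Euc N → Euc N} (hn : IsExteriorNormal Ω n) {xb : Euc N} (hxb : xb ∈ frontier Ω) :
    ∃ r > (0:ℝ), ∃ C > (0:ℝ), ∀ x : Euc N, ‖x - xb‖ < r → ∀ R : ℝ, 0 < R → R ≤ r →
      ∀ ϑ > (0:ℝ), (volume {h : Euc N | ‖h‖ < R ∧ 0 ≤ sdist Ω (x + h) ∧ sdist Ω (x + h) ≤ ϑ}).toReal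
        ≤ C * ϑ * R ^ (N - 1) := by
  obtain ⟨r, hr, L, hL, hc, hlip⟩ := sdist_regular hΩ hxb
  have hnorm := (hn xb hxb).1
  set r' : ℝ := min (r / 2) (1 / (4 * L)) with hr'
  have hr'0 : 0 < r' := by positivity
  refine ⟨r', hr'0, 8 * 2 ^ N * (volume (ball (0 : Euc N) 1)).toReal + 1, by positivity, ?_⟩
  intro x hx R hR hRr ϑ hϑ
  have hrr : r' ≤ r / 2 := min_le_left _ _
  have hrL : r' ≤ 1 / (4 * L) := min_le_right _ _
  have hin : ∀ h : Euc N, ‖h‖ < R → ‖x + h - xb‖ < 2 * r' := by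
    intro h hh
    calc ‖x + h - xb‖ = ‖(x - xb) + h‖ := by congr 1; abel
      _ ≤ _ := norm_add_le _ _
      _ < 2 * r' := by linarith
  have hder : ∀ y : Euc N, ‖y - xb‖ < 2 * r' → fderiv ℝ (sdist Ω) y (n xb) ≤ -(1/2) := by
    intro y hy
    have h1 := hlip y (by rw [mem_ball, dist_eq_norm]; linarith) xb (mem_ball_self hr)
    have h2 : |(fderiv ℝ (sdist Ω) y - fderiv ℝ (sdist Ω) xb) (n xb)| ≤ L * ‖y - xb‖ := by
      refine ((fderiv ℝ (sdist Ω) y - fderiv ℝ (sdist Ω) xb).le_opNorm (n xb)).trans ?_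
      rw [hnorm, mul_one]; exact h1
    have h3 : L * ‖y - xb‖ ≤ 1 / 2 := by
      have : ‖y - xb‖ ≤ 2 * (1 / (4 * L)) := by linarith
      calc L * ‖y - xb‖ ≤ L * (2 * (1 / (4 * L))) := by gcongr
        _ = 1 / 2 := by field_simp; norm_num
    rw [ContinuousLinearMap.sub_apply, fderiv_sdist_frontier hn hxb, real_inner_self_eq_norm_sq,
      hnorm] at h2
    have := (abs_le.1 h2).2
    linarith
  have := slab_abstract hN (fun h => sdist Ω (x + h))
    (((sdist_lipschitz Ω).continuous.comp (continuous_const.add continuous_id)).measurable)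
    (n xb) hnorm R ϑ hR hϑ ?_
  · refine this.trans ?_
    have h0 : 0 ≤ ϑ * R ^ (N - 1) := by positivity
    nlinarith
  · intro h hh a ha hha
    rcases ha.eq_or_lt with rfl | ha
    · simp
    -- one-dimensional mean value
    set γ : ℝ → ℝ := fun τ => sdist Ω (x + (h + τ • n xb)) with hγ
    have hseg : ∀ τ ∈ Icc (0:ℝ) a, ‖h + τ • n xb‖ < R := by
      intro τ hτ
      have : h + τ • n xb ∈ ball (0 : Euc N) R := by
        refine (convex_ball (0 : Euc N) R).segment_subset (x := h) (y := h + a • n xb)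
          (by simpa using hh) (by simpa using hha) ?_
        rw [segment_eq_image_lineMap]
        refine ⟨τ / a, ⟨div_nonneg hτ.1 ha.le, (div_le_one ha).2 hτ.2⟩, ?_⟩
        rw [AffineMap.lineMap_apply_module']
        rw [add_sub_cancel_left, smul_smul, div_mul_cancel₀ _ ha.ne', add_comm]
      simpa using this
    have hdγ : ∀ τ ∈ Icc (0:ℝ) a, HasDerivAt γ (fderiv ℝ (sdist Ω) (x + (h + τ • n xb)) (n xb)) τ := by
      intro τ hτ
      have hy := hin _ (hseg τ hτ)
      have hdx : DifferentiableAt ℝ (sdist Ω) (x + (h + τ • n xb)) :=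
        (hc.contDiffAt (isOpen_ball.mem_nhds (by
          rw [mem_ball, dist_eq_norm]; linarith))).differentiableAt (by norm_num)
      have hg : HasDerivAt (fun τ : ℝ => x + (h + τ • n xb)) (n xb) τ := by
        have := ((hasDerivAt_id τ).smul_const (n xb)).const_add h |>.const_add x
        simpa using this
      exact hdx.hasFDerivAt.comp_hasDerivAt τ hg
    obtain ⟨c, hc1, hc2⟩ := exists_hasDerivAt_eq_slope γ _ ha
      (fun τ hτ => (hdγ τ hτ).continuousAt.continuousWithinAt)
      (fun τ hτ => hdγ τ (Ioo_subset_Icc_self hτ))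
    have h5 := hder _ (hin _ (hseg c (Ioo_subset_Icc_self hc1)))
    rw [hc2, sub_zero, div_le_iff₀ ha] at h5
    simp only [hγ, zero_smul, add_zero] at h5
    linarith

/-- the boundary is Lebesgue-null -/
lemma frontier_null {hN : 0 < N} {Ω : Set (Euc N)} (hΩ : IsW2Domain hN Ω)
    {n : Euc N → Euc N} (hn : IsExteriorNormal Ω n) : volume (frontier Ω) = 0 := by
  refine measure_null_of_locally_null _ fun xb hxb => ?_
  obtain ⟨r, hr, C, hC, hs⟩ := slab_sdist hΩ hn hxb
  refine ⟨ball xb r ∩ frontier Ω, ?_, ?_⟩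
  · exact inter_mem (mem_nhdsWithin_of_mem_nhds (ball_mem_nhds _ hr)) self_mem_nhdsWithin
  set S : ℝ → Set (Euc N) := fun ϑ =>
    {h : Euc N | ‖h‖ < r ∧ 0 ≤ sdist Ω (xb + h) ∧ sdist Ω (xb + h) ≤ ϑ}
  have hsub : ∀ ϑ > 0, ball xb r ∩ frontier Ω ⊆ (fun h => h + (-xb)) ⁻¹' S ϑ := by
    rintro ϑ hϑ y ⟨hy, hy'⟩
    have h1 : xb + (y + -xb) = y := by abel
    change ‖y + -xb‖ < r ∧ 0 ≤ sdist Ω (xb + (y + -xb)) ∧ sdist Ω (xb + (y + -xb)) ≤ ϑ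
    refine ⟨?_, ?_, ?_⟩
    · rw [← sub_eq_add_neg, ← dist_eq_norm]; exact hy
    · rw [h1, sdist_frontier hΩ.1 hy']
    · rw [h1, sdist_frontier hΩ.1 hy']; exact le_of_lt hϑ
  have hfin : volume (ball xb r ∩ frontier Ω) ≠ ⊤ :=
    measure_ne_top_of_subset inter_subset_left measure_ball_lt_top.ne
  have hle : ∀ ϑ > 0, (volume (ball xb r ∩ frontier Ω)).toReal ≤ C * ϑ * r ^ (N - 1) := by
    intro ϑ hϑ
    refine le_trans ?_ (hs xb (by simpa using hr) r hr le_rfl ϑ hϑ)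
    refine ENNReal.toReal_mono ?_ ?_
    · refine ((measure_mono (t := ball 0 r) (fun h hh => ?_)).trans_lt measure_ball_lt_top).ne
      simpa using hh.1
    · refine (measure_mono (hsub ϑ hϑ)).trans ?_
      rw [measure_preimage_add_right]
  have h0 : (volume (ball xb r ∩ frontier Ω)).toReal ≤ 0 := by
    refine le_of_forall_pos_le_add fun η hη => ?_
    have hk : 0 < C * r ^ (N - 1) := by positivity
    have := hle (η / (C * r ^ (N - 1))) (by positivity)
    refine this.trans (le_of_eq ?_)
    field_simp; ring
  have := le_antisymm h0 ENNReal.toReal_nonneg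
  rcases (ENNReal.toReal_eq_zero_iff _).1 this with h | h
  · exact h
  · exact absurd h hfin

/-- determinant bound -/
lemma det_bound (A : ℝ) : ∃ C > (0:ℝ), ∀ T : Euc N →L[ℝ] Euc N, ‖T‖ ≤ A → |T.det| ≤ C := by
  have hc : Continuous fun T : Euc N →L[ℝ] Euc N => |T.det| :=
    ContinuousLinearMap.continuous_det.abs
  obtain ⟨C, hC⟩ := (isCompact_closedBall (0 : Euc N →L[ℝ] Euc N) A).exists_bound_of_continuousOn
    hc.continuousOn
  refine ⟨|C| + 1, by positivity, fun T hT => ?_⟩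
  have := hC T (by simpa using hT)
  simp only [Real.norm_eq_abs, abs_abs] at this
  linarith [le_abs_self C]

lemma preimage_j_volume {Ω : Set (Euc N)} {j : Euc N → Euc N → Euc N} {Aj : ℝ}
    (hJ0 : AssumptionJ0 Ω j Aj) :
    ∃ C > (0:ℝ), ∀ x ∈ closure Ω, ∀ B : Set (Euc N), MeasurableSet B → volume B ≠ ⊤ →
      volume (j x ⁻¹' B) ≠ ⊤ ∧ (volume (j x ⁻¹' B)).toReal ≤ C * (volume B).toReal := by
  obtain ⟨C, hC, hdet⟩ := det_bound (N := N) Aj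
  refine ⟨C, hC, fun x hx B hB hfin => ?_⟩
  obtain ⟨-, hbij, hinv, hb⟩ := hJ0 x hx
  have himg : j x ⁻¹' B = invFun (j x) '' B := by
    ext z; constructor
    · intro hz; exact ⟨j x z, hz, leftInverse_invFun hbij.1 z⟩
    · rintro ⟨w, hw, rfl⟩
      rw [mem_preimage, rightInverse_invFun hbij.2 w]; exact hw
  have h1 : volume (j x ⁻¹' B) ≤ ENNReal.ofReal C * volume B := by
    rw [himg]
    refine (addHaar_image_le_lintegral_abs_det_fderiv volume hB (f' := fderiv ℝ (invFun (j x)))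
      (fun z _ => ((hinv.differentiable (by norm_num)) z).hasFDerivAt.hasFDerivWithinAt)).trans ?_
    calc _ ≤ ∫⁻ _ in B, ENNReal.ofReal C := lintegral_mono fun z =>
            ENNReal.ofReal_le_ofReal (hdet _ (hb z))
      _ = _ := by rw [setLIntegral_const]
  have h2 : ENNReal.ofReal C * volume B ≠ ⊤ := ENNReal.mul_ne_top ENNReal.ofReal_ne_top hfin
  refine ⟨ne_top_of_le_ne_top h2 h1, ?_⟩
  have := ENNReal.toReal_mono h2 h1
  rwa [ENNReal.toReal_mul, ENNReal.toReal_ofReal hC.le] at this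

lemma preimage_j_null {Ω : Set (Euc N)} {j : Euc N → Euc N → Euc N} {Aj : ℝ}
    (hJ0 : AssumptionJ0 Ω j Aj) {x : Euc N} (hx : x ∈ closure Ω) {B : Set (Euc N)}
    (hB : volume B = 0) : volume {z | x + j x z ∈ B} = 0 := by
  obtain ⟨-, hbij, hinv, hb⟩ := hJ0 x hx
  set B' : Set (Euc N) := (fun h => h + x) ⁻¹' B with hB'
  have h0 : volume B' = 0 := by rw [hB', measure_preimage_add_right, hB]
  have himg : {z | x + j x z ∈ B} = invFun (j x) '' B' := by
    ext z; constructor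
    · intro hz; exact ⟨j x z, by simpa [hB', add_comm] using hz, leftInverse_invFun hbij.1 z⟩
    · rintro ⟨w, hw, rfl⟩
      change x + j x (invFun (j x) w) ∈ B
      rw [rightInverse_invFun hbij.2 w, add_comm]; exact hw
  rw [himg]
  exact addHaar_image_eq_zero_of_differentiableOn_of_addHaar_eq_zero volume
    (hinv.differentiable (by norm_num)).differentiableOn h0

/-- mismatch set of the two jump domains -/
def mis (Ω : Set (Euc N)) (j : Euc N → Euc N → Euc N) (x y : Euc N) : Set (Euc N) :=
  {z | ¬ (x + j x z ∈ closure Ω ↔ y + j y z ∈ closure Ω)}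

/-- Control of the measure of the mismatch set near `xb`, in terms of `Z`. -/
def MisBound (Ω : Set (Euc N)) (j : Euc N → Euc N → Euc N) (Z : Euc N → Euc N) (xb : Euc N) : Prop :=
  ∃ r > (0:ℝ), ∃ C > (0:ℝ), ∀ x ∈ closure Ω, ∀ y ∈ closure Ω, ‖x - xb‖ < r → ‖y - xb‖ < r →
    ∀ s : ℝ, 0 < s → s ≤ r →
      (volume (mis Ω j x y ∩ ball 0 s)).toReal ≤ C * (‖Z x - Z y‖ + s * ‖x - y‖) * s ^ (N - 1)

lemma misBound_interior {Ω : Set (Euc N)} (hΩ : IsOpen Ω) {j : Euc N → Euc N → Euc N}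
    {Cj' Cj Dj : ℝ} (hJ1 : AssumptionJ1 Ω j Cj' Cj Dj) (Z : Euc N → Euc N) {xb : Euc N}
    (hxb : xb ∈ Ω) : MisBound Ω j Z xb := by
  obtain ⟨-, hCj, -, hJ, -⟩ := hJ1
  obtain ⟨r, hr, hball⟩ := Metric.isOpen_iff.1 hΩ xb hxb
  refine ⟨min (r/2) (r/(2*Cj)), by positivity, 1, one_pos, fun x hx y hy hxr hyr s hs hsr => ?_⟩
  have hin : ∀ x ∈ closure Ω, ‖x - xb‖ < min (r/2) (r/(2*Cj)) → ∀ z ∈ ball (0 : Euc N) s,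
      x + j x z ∈ closure Ω := by
    intro x hx hxr z hz
    apply subset_closure
    apply hball
    rw [mem_ball_zero_iff] at hz
    rw [mem_ball, dist_eq_norm]
    have h1 := (hJ x hx z).2
    have h2 : Cj * ‖z‖ < r / 2 := by
      have : ‖z‖ < r / (2 * Cj) := lt_of_lt_of_le hz (hsr.trans (min_le_right _ _))
      rw [lt_div_iff₀ (by positivity)] at this
      linarith
    have h3 := lt_of_lt_of_le hxr (min_le_left _ _)
    calc ‖x + j x z - xb‖ = ‖(x - xb) + j x z‖ := by congr 1; abel
      _ ≤ _ := norm_add_le _ _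
      _ < r := by linarith
  have : mis Ω j x y ∩ ball 0 s = ∅ := by
    rw [eq_empty_iff_forall_notMem]
    rintro z ⟨hz, hzs⟩
    exact hz ⟨fun _ => hin y hy hyr z hzs, fun _ => hin x hx hxr z hzs⟩
  rw [this]; simp; positivity

set_option maxHeartbeats 800000 in
lemma misBound_frontier {hN : 0 < N} {Ω : Set (Euc N)} (hΩ : IsW2Domain hN Ω)
    {n : Euc N → Euc N} (hn : IsExteriorNormal Ω n) {j : Euc N → Euc N → Euc N}
    {Aj : ℝ} (hJ0 : AssumptionJ0 Ω j Aj)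
    {Cj' Cj Dj : ℝ} (hJ1 : AssumptionJ1 Ω j Cj' Cj Dj) {xb : Euc N}
    (hxb : xb ∈ frontier Ω) (Z : Euc N → Euc N) {CZ rZ : ℝ} (hrZ : 0 < rZ) (hCZ : 0 < CZ)
    (hZ : ∀ x ∈ closure Ω, ∀ y ∈ closure Ω, ‖x - xb‖ < rZ → ‖y - xb‖ < rZ →
      |sdist Ω x - sdist Ω y| ≤ CZ * ‖Z x - Z y‖) : MisBound Ω j Z xb := by
  obtain ⟨-, hCj, hDj, hJ, hJD⟩ := hJ1
  obtain ⟨r1, hr1, C1, hC1, hslab⟩ := slab_sdist hΩ hn hxb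
  obtain ⟨r2, hr2, L, hL, hc, hlip⟩ := sdist_regular hΩ hxb
  obtain ⟨C3, hC3, hpre⟩ := preimage_j_volume hJ0
  have hne : Ω.Nonempty := closure_nonempty_iff.1 ⟨xb, frontier_subset_closure hxb⟩
  have hdiff : ∀ x ∈ ball xb r2, DifferentiableAt ℝ (sdist Ω) x := fun x hx =>
    (hc.contDiffAt (isOpen_ball.mem_nhds hx)).differentiableAt (by norm_num)
  set r : ℝ := min (min r1 (r1 / Cj)) (min (min (r2/2) (r2/(2*Cj))) rZ) with hr
  have hr0 : 0 < r := by positivity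
  set K : ℝ := L * Cj + 2 * Dj with hK
  have hK0 : 0 < K := by positivity
  refine ⟨r, hr0, 2 * C3 * C1 * Cj ^ (N-1) * (CZ + K), by positivity,
    fun x hx y hy hxr hyr s hs hsr => ?_⟩
  rcases eq_or_ne x y with rfl | hxy
  · have : mis Ω j x x = ∅ := by simp [mis]
    rw [this]; simp
  have hη : 0 < ‖x - y‖ := norm_pos_iff.2 (sub_ne_zero.2 hxy)
  have rr1 : r ≤ r1 := (min_le_left _ _).trans (min_le_left _ _)
  have rr2 : r ≤ r1 / Cj := (min_le_left _ _).trans (min_le_right _ _)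
  have rr3 : r ≤ r2 / 2 := (min_le_right _ _).trans ((min_le_left _ _).trans (min_le_left _ _))
  have rr4 : r ≤ r2 / (2*Cj) := (min_le_right _ _).trans ((min_le_left _ _).trans (min_le_right _ _))
  have rr5 : r ≤ rZ := (min_le_right _ _).trans (min_le_right _ _)
  set ϑ : ℝ := |sdist Ω x - sdist Ω y| + K * s * ‖x - y‖ with hϑ
  have hϑ0 : 0 < ϑ := by positivity
  have hϑle : ϑ ≤ (CZ + K) * (‖Z x - Z y‖ + s * ‖x - y‖) := by
    have h1 := hZ x hx y hy (by linarith) (by linarith)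
    have h2 : 0 ≤ ‖Z x - Z y‖ := norm_nonneg _
    have h3 : 0 ≤ s * ‖x - y‖ := by positivity
    rw [hϑ]; nlinarith
  have hCs : Cj * s ≤ r1 := by
    have := hsr.trans rr2
    rwa [le_div_iff₀ hCj, mul_comm] at this
  set S : Euc N → Set (Euc N) := fun x =>
    {h : Euc N | ‖h‖ < Cj * s ∧ 0 ≤ sdist Ω (x + h) ∧ sdist Ω (x + h) ≤ ϑ} with hS
  have hSm : ∀ x, MeasurableSet (S x) := by
    intro x
    have hf : Measurable fun h => sdist Ω (x + h) :=
      ((sdist_lipschitz Ω).continuous.comp (continuous_const.add continuous_id)).measurable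
    exact (measurableSet_lt measurable_norm measurable_const).inter
      ((measurableSet_le measurable_const hf).inter (measurableSet_le hf measurable_const))
  have hSfin : ∀ x, volume (S x) ≠ ⊤ := fun x =>
    ((measure_mono (t := ball 0 (Cj * s)) (fun h hh => by
      simpa using hh.1)).trans_lt measure_ball_lt_top).ne
  -- pointwise difference
  have hdif : ∀ z : Euc N, ‖z‖ < s →
      |sdist Ω (x + j x z) - sdist Ω (y + j y z)| ≤ ϑ := by
    intro z hz
    have hjz := (hJ x hx z).2
    have hh : ‖j x z‖ < r2 / 2 := by
      have h1 : ‖z‖ < r2 / (2 * Cj) := by linarith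
      rw [lt_div_iff₀ (by positivity)] at h1
      nlinarith
    have m1 := mixed_diff hdiff hlip (x := x) (y := y) (h := j x z) (by linarith) (by linarith) hh
    have m2 := sdist_lip Ω (y + j x z) (y + j y z)
    rw [add_sub_add_left_eq_sub] at m2
    have m3 := hJD x hx y hy z
    rw [Real.norm_eq_abs] at m1
    have m4 : L * ‖x - y‖ * ‖j x z‖ ≤ L * Cj * s * ‖x - y‖ := by
      have : ‖j x z‖ ≤ Cj * s := hjz.trans (by gcongr)
      calc L * ‖x - y‖ * ‖j x z‖ ≤ L * ‖x - y‖ * (Cj * s) := by gcongr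
        _ = _ := by ring
    have m5 : 2 * ‖j x z - j y z‖ ≤ 2 * Dj * s * ‖x - y‖ := by
      calc 2 * ‖j x z - j y z‖ ≤ 2 * (Dj * ‖z‖ * ‖x - y‖) := by gcongr
        _ ≤ 2 * (Dj * s * ‖x - y‖) := by gcongr
        _ = _ := by ring
    have m6 := abs_le.1 (m1.trans m4)
    have m7 := abs_le.1 (m2.trans m5)
    have m8 := abs_le.1 (le_refl |sdist Ω x - sdist Ω y|)
    have m9 : ϑ = |sdist Ω x - sdist Ω y| + L * Cj * s * ‖x - y‖ + 2 * Dj * s * ‖x - y‖ := by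
      rw [hϑ, hK]; ring
    rw [abs_le, m9]
    constructor <;> linarith [m6.1, m6.2, m7.1, m7.2, m8.1, m8.2]
  have hnb : ∀ x ∈ closure Ω, ∀ z : Euc N, ‖z‖ < s → ‖j x z‖ < Cj * s := fun x hx z hz =>
    ((hJ x hx z).2).trans_lt (by gcongr)
  have hsub : mis Ω j x y ∩ ball 0 s ⊆ (j x ⁻¹' S x) ∪ (j y ⁻¹' S y) := by
    rintro z ⟨hz, hzs⟩
    rw [mem_ball_zero_iff] at hzs
    have hd := abs_le.1 (hdif z hzs)
    simp only [mis, mem_setOf_eq, mem_closure_iff_sdist hne] at hz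
    by_cases hx' : 0 ≤ sdist Ω (x + j x z)
    · left
      refine ⟨hnb x hx z hzs, hx', ?_⟩
      have hy' : ¬ 0 ≤ sdist Ω (y + j y z) := fun h => hz ⟨fun _ => h, fun _ => hx'⟩
      push Not at hy'
      linarith [hd.2]
    · right
      have hy' : 0 ≤ sdist Ω (y + j y z) := by
        by_contra h; exact hz ⟨fun h' => absurd h' hx', fun h' => absurd h' h⟩
      refine ⟨hnb y hy z hzs, hy', ?_⟩
      push Not at hx'
      linarith [hd.1]
  have px := hpre x hx (S x) (hSm x) (hSfin x)
  have py := hpre y hy (S y) (hSm y) (hSfin y)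
  have sx := hslab x (by linarith) (Cj * s) (by positivity) hCs ϑ hϑ0
  have sy := hslab y (by linarith) (Cj * s) (by positivity) hCs ϑ hϑ0
  have h1 : (volume (mis Ω j x y ∩ ball 0 s)).toReal ≤
      (volume (j x ⁻¹' S x)).toReal + (volume (j y ⁻¹' S y)).toReal := by
    rw [← ENNReal.toReal_add px.1 py.1]
    exact ENNReal.toReal_mono (ENNReal.add_ne_top.2 ⟨px.1, py.1⟩)
      ((measure_mono hsub).trans (measure_union_le _ _))
  calc (volume (mis Ω j x y ∩ ball 0 s)).toReal
      ≤ (volume (j x ⁻¹' S x)).toReal + (volume (j y ⁻¹' S y)).toReal := h1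
    _ ≤ C3 * (C1 * ϑ * (Cj * s) ^ (N-1)) + C3 * (C1 * ϑ * (Cj * s) ^ (N-1)) :=
        add_le_add (px.2.trans (by gcongr)) (py.2.trans (by gcongr))
    _ = 2 * C3 * C1 * Cj ^ (N-1) * ϑ * s ^ (N-1) := by rw [mul_pow]; ring
    _ ≤ 2 * C3 * C1 * Cj ^ (N-1) * ((CZ + K) * (‖Z x - Z y‖ + s * ‖x - y‖)) * s ^ (N-1) := by
        gcongr
    _ = _ := by ring

lemma near_algebra {A B gx gy a c γ d : ℝ} (hA : A ≤ a) (hB : B ≤ a) (hAB : A + B ≤ c)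
    (hgx : 0 ≤ gx) (hgy : 0 ≤ gy) (hgx' : gx ≤ γ) (hd : |gx - gy| ≤ d) (ha : 0 ≤ a) (hc : 0 ≤ c) :
    A * gx + B * gy ≤ c * γ + a * d := by
  have h := abs_le.1 hd
  rcases le_total gy gx with h1 | h1
  · have : A * gx + B * gy = (A + B) * gy + A * (gx - gy) := by ring
    rw [this]
    have h2 : (A + B) * gy ≤ c * γ := by
      calc (A+B) * gy ≤ c * gy := by gcongr
        _ ≤ c * γ := by gcongr; linarith
    have h3 : A * (gx - gy) ≤ a * d := by
      have : 0 ≤ gx - gy := by linarith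
      calc A * (gx - gy) ≤ a * (gx - gy) := by gcongr
        _ ≤ a * d := by gcongr; linarith
    linarith
  · have : A * gx + B * gy = (A + B) * gx + B * (gy - gx) := by ring
    rw [this]
    have h2 : (A + B) * gx ≤ c * γ := by
      calc (A+B) * gx ≤ c * gx := by gcongr
        _ ≤ c * γ := by gcongr
    have h3 : B * (gy - gx) ≤ a * d := by
      have : 0 ≤ gy - gx := by linarith
      calc B * (gy - gx) ≤ a * (gy - gx) := by gcongr
        _ ≤ a * d := by gcongr; linarith
    linarith

/-- estimate of the nonlocal difference near the origin -/
lemma near_bound (hN : 0 < N) (σ : ℝ) (hσ : σ ∈ Ioo (0:ℝ) 1) :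
    ∃ C > (0:ℝ), ∀ (Tx Ty : Set (Euc N)) (A B gx gy : Euc N → ℝ) (ρ : ℝ) (k : ℕ)
      (a Lm J Cμ Dη Cm : ℝ), 0 < ρ → 0 ≤ a → 0 ≤ Lm → 0 ≤ J → 0 ≤ Cμ → 0 ≤ Dη → 0 ≤ Cm →
      MeasurableSet {z | ¬ (z ∈ Tx ↔ z ∈ Ty)} →
      (∀ i < k, (volume ({z | ¬ (z ∈ Tx ↔ z ∈ Ty)} ∩ ball 0 (ρ * 2⁻¹ ^ i))).toReal ≤
          Cm * a * (ρ * 2⁻¹ ^ i) ^ N) →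
      (∀ z, 0 ≤ gx z ∧ gx z ≤ Cμ * kern σ z) → (∀ z, 0 ≤ gy z ∧ gy z ≤ Cμ * kern σ z) →
      (∀ z, |gx z - gy z| ≤ Dη * kern σ z) →
      (∀ z, ‖z‖ < ρ → z ∈ Tx → A z ≤ Lm * ‖z‖) → (∀ z, ‖z‖ < ρ → z ∈ Ty → B z ≤ Lm * ‖z‖) →
      (∀ z, ‖z‖ < ρ → ρ * 2⁻¹ ^ k ≤ ‖z‖ → z ∈ Tx → z ∈ Ty → A z + B z ≤ J * ‖z‖) →
      IntegrableOn (fun z => Tx.indicator (fun z => A z * gx z) z +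
        Ty.indicator (fun z => B z * gy z) z) (ball 0 ρ) →
      ∫ z in ball 0 ρ, (Tx.indicator (fun z => A z * gx z) z +
        Ty.indicator (fun z => B z * gy z) z) ≤
        C * (Lm * Cμ * (ρ * 2⁻¹ ^ k) ^ (1 - σ) + (J * Cμ + Lm * Dη) * ρ ^ (1 - σ) +
          Lm * Cμ * Cm * a * ρ ^ (1 - σ)) := by
  obtain ⟨C1, hC1, h1⟩ := kern_facts hN σ hσ
  obtain ⟨C2, hC2, h2⟩ := mismatch_integral hN σ hσ
  refine ⟨2 * C1 + C2, by positivity, ?_⟩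
  intro Tx Ty A B gx gy ρ k a Lm J Cμ Dη Cm hρ ha hLm hJ hCμ hDη hCm hSm hvol hgx hgy hgg hA hB hAB hint
  set S : Set (Euc N) := {z | ¬ (z ∈ Tx ↔ z ∈ Ty)} with hS
  set r1 : ℝ := ρ * 2⁻¹ ^ k with hr1
  have hr10 : 0 < r1 := by positivity
  have hr1ρ : r1 ≤ ρ := by
    have : (2⁻¹:ℝ) ^ k ≤ 1 := pow_le_one₀ (by norm_num) (by norm_num)
    rw [hr1]; nlinarith
  set W : Set (Euc N) := S ∩ {z | r1 ≤ ‖z‖ ∧ ‖z‖ < ρ} with hW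
  have hWm : MeasurableSet W := hSm.inter
    ((measurableSet_le measurable_const measurable_norm).inter
      (measurableSet_lt measurable_norm measurable_const))
  have hWb : W ⊆ ball 0 ρ := fun z hz => by simpa using hz.2.2
  set κ : Euc N → ℝ := fun z => ‖z‖ * kern σ z with hκ
  have hκ0 : ∀ z, 0 ≤ κ z := fun z => mul_nonneg (norm_nonneg _) (kern_nonneg _ _)
  have i1 : IntegrableOn (fun z => (J * Cμ + Lm * Dη) * κ z) (ball 0 ρ) := (h1 ρ hρ).1.const_mul _
  have i2 : IntegrableOn ((ball (0 : Euc N) r1).indicator fun z => 2 * (Lm * Cμ) * κ z) (ball 0 ρ) :=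
    by
      have q : IntegrableOn (fun z => 2 * (Lm * Cμ) * κ z) (ball 0 r1) := (h1 r1 hr10).1.const_mul _
      exact (q.integrable_indicator measurableSet_ball).integrableOn
  have i3 : IntegrableOn (W.indicator fun z => Lm * Cμ * κ z) (ball 0 ρ) :=
    by
      have q : IntegrableOn (fun z => Lm * Cμ * κ z) W := ((h1 ρ hρ).1.mono_set hWb).const_mul _
      exact (q.integrable_indicator hWm).integrableOn
  have hpt : ∀ z ∈ ball (0 : Euc N) ρ, Tx.indicator (fun z => A z * gx z) z +
        Ty.indicator (fun z => B z * gy z) z ≤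
      (J * Cμ + Lm * Dη) * κ z + (ball (0 : Euc N) r1).indicator (fun z => 2 * (Lm * Cμ) * κ z) z
        + W.indicator (fun z => Lm * Cμ * κ z) z := by
    intro z hz
    rw [mem_ball_zero_iff] at hz
    have t1 : 0 ≤ (J * Cμ + Lm * Dη) * κ z := mul_nonneg (by positivity) (hκ0 z)
    have t2 : 0 ≤ (ball (0 : Euc N) r1).indicator (fun z => 2 * (Lm * Cμ) * κ z) z :=
      indicator_nonneg (fun z _ => mul_nonneg (by positivity) (hκ0 z)) z
    have t3 : 0 ≤ W.indicator (fun z => Lm * Cμ * κ z) z :=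
      indicator_nonneg (fun z _ => mul_nonneg (by positivity) (hκ0 z)) z
    have bx : Tx.indicator (fun z => A z * gx z) z ≤ Lm * Cμ * κ z := by
      by_cases hx : z ∈ Tx
      · rw [indicator_of_mem hx]
        calc A z * gx z ≤ (Lm * ‖z‖) * gx z := mul_le_mul_of_nonneg_right (hA z hz hx) (hgx z).1
          _ ≤ (Lm * ‖z‖) * (Cμ * kern σ z) := mul_le_mul_of_nonneg_left (hgx z).2 (by positivity)
          _ = _ := by rw [hκ]; ring
      · rw [indicator_of_notMem hx]; exact mul_nonneg (by positivity) (hκ0 z)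
    have bY : Ty.indicator (fun z => B z * gy z) z ≤ Lm * Cμ * κ z := by
      by_cases hy : z ∈ Ty
      · rw [indicator_of_mem hy]
        calc B z * gy z ≤ (Lm * ‖z‖) * gy z := mul_le_mul_of_nonneg_right (hB z hz hy) (hgy z).1
          _ ≤ (Lm * ‖z‖) * (Cμ * kern σ z) := mul_le_mul_of_nonneg_left (hgy z).2 (by positivity)
          _ = _ := by rw [hκ]; ring
      · rw [indicator_of_notMem hy]; exact mul_nonneg (by positivity) (hκ0 z)
    rcases lt_or_ge ‖z‖ r1 with hr | hr
    · rw [indicator_of_mem (show z ∈ ball (0 : Euc N) r1 by simpa using hr)] at *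
      linarith
    · by_cases hx : z ∈ Tx
      · by_cases hy : z ∈ Ty
        · rw [indicator_of_mem hx, indicator_of_mem hy]
          have := near_algebra (hA z hz hx) (hB z hz hy) (hAB z hz hr hx hy) (hgx z).1 (hgy z).1
            (hgx z).2 (hgg z) (by positivity) (by positivity)
          have e : (J * Cμ + Lm * Dη) * κ z = J * ‖z‖ * (Cμ * kern σ z) + Lm * ‖z‖ * (Dη * kern σ z) := by
            rw [hκ]; ring
          linarith
        · have hzW : z ∈ W := ⟨fun h => hy (h.1 hx), hr, hz⟩
          rw [indicator_of_mem hzW, indicator_of_notMem hy]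
          linarith
      · by_cases hy : z ∈ Ty
        · have hzW : z ∈ W := ⟨fun h => hx (h.2 hy), hr, hz⟩
          rw [indicator_of_mem hzW, indicator_of_notMem hx]
          linarith
        · rw [indicator_of_notMem hx, indicator_of_notMem hy]
          linarith
  have hI := setIntegral_mono_on hint ((i1.add i2).add i3) measurableSet_ball hpt
  have i12 : IntegrableOn (fun z => (J * Cμ + Lm * Dη) * κ z +
    (ball (0 : Euc N) r1).indicator (fun z => 2 * (Lm * Cμ) * κ z) z) (ball 0 ρ) := i1.add i2
  have e1 : ∫ z in ball 0 ρ, ((J * Cμ + Lm * Dη) * κ z +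
      (ball (0 : Euc N) r1).indicator (fun z => 2 * (Lm * Cμ) * κ z) z
        + W.indicator (fun z => Lm * Cμ * κ z) z) =
      (J * Cμ + Lm * Dη) * (∫ z in ball 0 ρ, κ z) + (2 * (Lm * Cμ) * (∫ z in ball 0 r1, κ z) +
       Lm * Cμ * (∫ z in W, κ z)) := by
    rw [integral_add i12 i3, integral_add i1 i2, integral_const_mul,
      setIntegral_indicator measurableSet_ball, setIntegral_indicator hWm,
      inter_eq_right.2 (ball_subset_ball hr1ρ), inter_eq_right.2 hWb, integral_const_mul,
      integral_const_mul, add_assoc]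
  have f1 := (h1 ρ hρ).2.1
  have f2 := (h1 r1 hr10).2.1
  have f3 := h2 S ρ a Cm hSm hρ ha hCm k hvol
  have g0 : 0 ≤ ρ ^ (1 - σ) := by positivity
  have g1 : 0 ≤ r1 ^ (1 - σ) := by positivity
  refine hI.trans ((le_of_eq e1).trans ?_)
  have k1 : (J * Cμ + Lm * Dη) * (∫ z in ball (0 : Euc N) ρ, κ z) ≤
      (J * Cμ + Lm * Dη) * (C1 * ρ ^ (1 - σ)) := by gcongr
  have k2 : 2 * (Lm * Cμ) * (∫ z in ball (0 : Euc N) r1, κ z) ≤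
      2 * (Lm * Cμ) * (C1 * r1 ^ (1 - σ)) := by gcongr
  have k3 : Lm * Cμ * (∫ z in W, κ z) ≤ Lm * Cμ * (C2 * Cm * a * ρ ^ (1 - σ)) := by
    refine mul_le_mul_of_nonneg_left (f3.trans ?_) (by positivity)
    refine mul_le_mul_of_nonneg_left ?_ (by positivity)
    have : 0 ≤ (ρ * 2⁻¹ ^ k) ^ (1 - σ) := by positivity
    linarith
  have p1 : 0 ≤ (J * Cμ + Lm * Dη) * ρ ^ (1 - σ) := by positivity
  have p2 : 0 ≤ Lm * Cμ * r1 ^ (1 - σ) := by positivity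
  have p3 : 0 ≤ Lm * Cμ * Cm * a * ρ ^ (1 - σ) := by positivity
  set P1 := (J * Cμ + Lm * Dη) * ρ ^ (1 - σ) with hP1
  set P2 := Lm * Cμ * r1 ^ (1 - σ) with hP2
  set P3 := Lm * Cμ * Cm * a * ρ ^ (1 - σ) with hP3
  have k1' : (J * Cμ + Lm * Dη) * (C1 * ρ ^ (1 - σ)) = C1 * P1 := by rw [hP1]; ring
  have k2' : 2 * (Lm * Cμ) * (C1 * r1 ^ (1 - σ)) = 2 * C1 * P2 := by rw [hP2]; ring
  have k3' : Lm * Cμ * (C2 * Cm * a * ρ ^ (1 - σ)) = C2 * P3 := by rw [hP3]; ring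
  have q1 : 0 ≤ C1 * P1 := by positivity
  have q2 : 0 ≤ C1 * P2 := by positivity
  have q3 : 0 ≤ C1 * P3 := by positivity
  have q4 : 0 ≤ C2 * P1 := by positivity
  have q5 : 0 ≤ C2 * P2 := by positivity
  have : (2 * C1 + C2) * (P2 + P1 + P3) = 2 * (C1 * P1) + 2 * (C1 * P2) + 2 * (C1 * P3) + C2 * P1 + C2 * P2 + C2 * P3 := by ring
  rw [this]
  linarith

lemma usc_indicator_measurable {Ω : Set (Euc N)} {W : Euc N → ℝ → ℝ}
    (hW : UpperSemicontinuousOn (fun q : Euc N × ℝ => W q.1 q.2) (closure Ω ×ˢ Ici 0)) {t : ℝ}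
    (ht : 0 ≤ t) : Measurable ((closure Ω).indicator (fun y => W y t)) := by
  have h1 : UpperSemicontinuousOn (fun y => W y t) (closure Ω) := by
    intro y hy a ha
    have := hW (y, t) ⟨hy, ht⟩ a ha
    have hc : Tendsto (fun y' : Euc N => (y', t)) (𝓝[closure Ω] y) (𝓝[closure Ω ×ˢ Ici 0] (y, t)) := by
      refine tendsto_nhdsWithin_iff.2 ⟨?_, ?_⟩
      · exact ((continuous_id.prodMk continuous_const).tendsto y).mono_left nhdsWithin_le_nhds
      · filter_upwards [self_mem_nhdsWithin] with y' hy'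
        exact ⟨hy', ht⟩
    exact hc.eventually this
  refine measurable_of_restrict_of_restrict_compl (isClosed_closure.measurableSet (s := closure Ω)) ?_ ?_
  · have : (closure Ω).domRestrict ((closure Ω).indicator (fun y => W y t)) =
        (closure Ω).domRestrict (fun y => W y t) := by
      ext y
      exact indicator_of_mem y.2 _
    rw [this]
    exact (upperSemicontinuousOn_iff_restrict.2 h1).measurable
  · have : (closure Ω)ᶜ.domRestrict ((closure Ω).indicator (fun y => W y t)) = fun _ => 0 := by
      ext y
      exact indicator_of_notMem y.2 _
    rw [this]
    exact measurable_const

def TT (Ω : Set (Euc N)) (j : Euc N → Euc N → Euc N) (x : Euc N) : Set (Euc N) :=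
  {z | x + j x z ∈ closure Ω}

def nlA (j : Euc N → Euc N → Euc N) (ξ : ℝ) (φ W : Euc N → ℝ) (x z : Euc N) : ℝ :=
  if ‖z‖ < ξ then φ (x + j x z) - φ x else W (x + j x z) - W x

lemma TT_measurable {Ω : Set (Euc N)} {j : Euc N → Euc N → Euc N} {Aj : ℝ} (hJ0 : AssumptionJ0 Ω j Aj)
    {x : Euc N} (hx : x ∈ closure Ω) : MeasurableSet (TT Ω j x) :=
  (isClosed_closure.preimage (continuous_const.add (hJ0 x hx).1.continuous)).measurableSet

lemma diff_measurable {Ω : Set (Euc N)} {j : Euc N → Euc N → Euc N} {Aj : ℝ} (hJ0 : AssumptionJ0 Ω j Aj)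
    {x : Euc N} (hx : x ∈ closure Ω) {W : Euc N → ℝ}
    (hW : Measurable ((closure Ω).indicator W)) {g : Euc N → Euc N → ℝ} (hg : ∀ x, Measurable (g x)) :
    Measurable ((TT Ω j x).indicator (fun z => (W (x + j x z) - W x) * g x z)) := by
  have hjm : Measurable (fun z => x + j x z) :=
    (continuous_const.add (hJ0 x hx).1.continuous).measurable
  have e : (TT Ω j x).indicator (fun z => (W (x + j x z) - W x) * g x z) =
      (TT Ω j x).indicator (fun z => ((closure Ω).indicator W (x + j x z) - W x) * g x z) := by
    ext z
    by_cases hz : z ∈ TT Ω j x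
    · rw [indicator_of_mem hz, indicator_of_mem hz, indicator_of_mem (show x + j x z ∈ closure Ω from hz)]
    · rw [indicator_of_notMem hz, indicator_of_notMem hz]
  rw [e]
  exact (((hW.comp hjm).sub_const _).mul (hg x)).indicator (TT_measurable hJ0 hx)

lemma far_integrable (hN : 0 < N) {Ω : Set (Euc N)} {g : Euc N → Euc N → ℝ} {Cμ σ : ℝ}
    (hM : AssumptionM1 Ω g Cμ σ)
    {j : Euc N → Euc N → Euc N} {Aj : ℝ} (hJ0 : AssumptionJ0 Ω j Aj)
    {x : Euc N} (hx : x ∈ closure Ω) {W : Euc N → ℝ} {M : ℝ} (hWM : ∀ y ∈ closure Ω, |W y| ≤ M)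
    (hW : Measurable ((closure Ω).indicator W)) {r : ℝ} (hr : 0 < r) :
    IntegrableOn ((TT Ω j x).indicator (fun z => (W (x + j x z) - W x) * g x z)) {z | r ≤ ‖z‖} := by
  obtain ⟨C1, hC1, h1⟩ := kern_facts hN σ hM.2.1
  have q := ((h1 r hr).2.2.1).const_mul (2 * M * Cμ)
  refine q.mono' (diff_measurable hJ0 hx hW hM.2.2.1).aestronglyMeasurable ?_
  refine Eventually.of_forall fun z => ?_
  have hM0 : 0 ≤ M := (abs_nonneg _).trans (hWM x hx)
  have hc := hM.1
  by_cases hz : z ∈ TT Ω j x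
  · rw [indicator_of_mem hz, Real.norm_eq_abs, abs_mul, abs_of_nonneg (hM.2.2.2.1 x hx z)]
    have a1 : |W (x + j x z) - W x| ≤ 2 * M := by
      have := hWM _ hz; have := hWM _ hx
      have := abs_sub (W (x + j x z)) (W x); linarith
    calc _ ≤ 2 * M * (Cμ * kern σ z) := by
          gcongr
          · exact hM.2.2.2.1 x hx z
          · exact hM.2.2.2.2 x hx z
      _ = _ := by ring
  · rw [indicator_of_notMem hz, norm_zero]
    have := kern_nonneg σ z
    positivity

lemma near_integrable (hN : 0 < N) {Ω : Set (Euc N)} {g : Euc N → Euc N → ℝ} {Cμ σ : ℝ}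
    (hM : AssumptionM1 Ω g Cμ σ)
    {j : Euc N → Euc N → Euc N} {Aj : ℝ} (hJ0 : AssumptionJ0 Ω j Aj)
    {Cj' Cj Dj : ℝ} (hJ1 : AssumptionJ1 Ω j Cj' Cj Dj)
    {x : Euc N} (hx : x ∈ closure Ω) {φ : Euc N → ℝ} (hφ : ContDiff ℝ 1 φ) {r : ℝ} (hr : 0 < r) :
    IntegrableOn ((TT Ω j x).indicator (fun z => (φ (x + j x z) - φ x) * g x z)) (ball 0 r) := by
  obtain ⟨C1, hC1, h1⟩ := kern_facts hN σ hM.2.1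
  have hc := hM.1
  obtain ⟨hj1, hj2, hj3, hj4, hj5⟩ := hJ1
  -- Lipschitz bound
  obtain ⟨L, hL⟩ : ∃ L, ∀ y ∈ closedBall x (Cj * r), ‖fderiv ℝ φ y‖ ≤ L :=
    (isCompact_closedBall x (Cj * r)).exists_bound_of_continuousOn
      (hφ.continuous_fderiv one_ne_zero).continuousOn
  have hL0 : 0 ≤ L := (norm_nonneg _).trans (hL x (mem_closedBall_self (by positivity)))
  have q := ((h1 r hr).1).const_mul (L * Cj * Cμ)
  have hm : Measurable ((TT Ω j x).indicator (fun z => (φ (x + j x z) - φ x) * g x z)) :=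
    diff_measurable hJ0 hx (hφ.continuous.measurable.indicator isClosed_closure.measurableSet) hM.2.2.1
  refine q.mono' hm.aestronglyMeasurable ?_
  refine (ae_restrict_iff' measurableSet_ball).2 (Eventually.of_forall fun z hzr => ?_)
  rw [mem_ball_zero_iff] at hzr
  by_cases hz : z ∈ TT Ω j x
  · rw [indicator_of_mem hz, Real.norm_eq_abs, abs_mul, abs_of_nonneg (hM.2.2.2.1 x hx z)]
    have hjz := (hj4 x hx z).2
    have a1 : |φ (x + j x z) - φ x| ≤ L * (Cj * ‖z‖) := by
      have := (convex_closedBall x (Cj * r)).norm_image_sub_le_of_norm_fderiv_le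
        (fun y _ => (hφ.differentiable one_ne_zero).differentiableAt) hL
        (mem_closedBall_self (by positivity)) (show x + j x z ∈ closedBall x (Cj * r) by
          rw [mem_closedBall, dist_eq_norm, add_sub_cancel_left]
          exact hjz.trans (by gcongr))
      rw [add_sub_cancel_left] at this
      exact this.trans (by gcongr)
    calc _ ≤ L * (Cj * ‖z‖) * (Cμ * kern σ z) := by
          gcongr
          · exact hM.2.2.2.1 x hx z
          · exact hM.2.2.2.2 x hx z
      _ = _ := by ring
  · rw [indicator_of_notMem hz, norm_zero]
    have := kern_nonneg σ z
    positivity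

lemma nl_facts (hN : 0 < N) {Ω : Set (Euc N)} {g : Euc N → Euc N → ℝ} {Cμ σ : ℝ}
    (hM : AssumptionM1 Ω g Cμ σ)
    {j : Euc N → Euc N → Euc N} {Aj : ℝ} (hJ0 : AssumptionJ0 Ω j Aj)
    {Cj' Cj Dj : ℝ} (hJ1 : AssumptionJ1 Ω j Cj' Cj Dj)
    {x : Euc N} (hx : x ∈ closure Ω) {φ : Euc N → ℝ} (hφ : ContDiff ℝ 1 φ)
    {W : Euc N → ℝ} {M : ℝ} (hWM : ∀ y ∈ closure Ω, |W y| ≤ M)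
    (hW : Measurable ((closure Ω).indicator W)) {ξ : ℝ} (hξ : 0 < ξ) :
    Integrable ((TT Ω j x).indicator (fun z => nlA j ξ φ W x z * g x z)) ∧
    Iin Ω j g ξ φ x + Iout Ω j g ξ W x =
      ∫ z, (TT Ω j x).indicator (fun z => nlA j ξ φ W x z * g x z) z := by
  have hT := TT_measurable hJ0 hx
  have i1 := near_integrable hN hM hJ0 hJ1 hx hφ hξ
  have i2 := far_integrable hN hM hJ0 hx hWM hW hξ
  have hc : (ball (0 : Euc N) ξ)ᶜ = {z | ξ ≤ ‖z‖} := by ext z; simp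
  have j1 : IntegrableOn ((TT Ω j x).indicator (fun z => nlA j ξ φ W x z * g x z)) (ball 0 ξ) := by
    refine i1.congr_fun (fun z hz => ?_) measurableSet_ball
    rw [mem_ball_zero_iff] at hz
    simp only [indicator, nlA, hz, if_true]
  have j2 : IntegrableOn ((TT Ω j x).indicator (fun z => nlA j ξ φ W x z * g x z)) (ball 0 ξ)ᶜ := by
    rw [hc]
    refine i2.congr_fun (fun z hz => ?_) (measurableSet_le measurable_const measurable_norm)
    have hz' : ¬ ‖z‖ < ξ := not_lt.2 hz
    simp only [indicator, nlA, hz', if_false]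
  have hint : Integrable ((TT Ω j x).indicator (fun z => nlA j ξ φ W x z * g x z)) := by
    rw [← integrableOn_univ, ← union_compl_self (ball (0 : Euc N) ξ)]
    exact j1.union j2
  refine ⟨hint, ?_⟩
  rw [← integral_add_compl measurableSet_ball hint]
  congr 1
  · rw [setIntegral_indicator hT, Iin]
    have e : {z : Euc N | ‖z‖ < ξ ∧ x + j x z ∈ closure Ω} = ball 0 ξ ∩ TT Ω j x := by
      ext z; simp [TT]
    rw [e]
    refine setIntegral_congr_fun (measurableSet_ball.inter hT) fun z hz => ?_
    have : ‖z‖ < ξ := by simpa using hz.1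
    simp only [nlA, this, if_true]
  · rw [setIntegral_indicator hT, Iout]
    have e : {z : Euc N | ξ ≤ ‖z‖ ∧ x + j x z ∈ closure Ω} = (ball 0 ξ)ᶜ ∩ TT Ω j x := by
      ext z; simp [TT]
    rw [e]
    refine setIntegral_congr_fun (measurableSet_ball.compl.inter hT) fun z hz => ?_
    have : ¬ ‖z‖ < ξ := by simpa using hz.1
    simp only [nlA, this, if_false]

/-- viscosity inequality in integrated form -/
lemma visc_ineq {Ω : Set (Euc N)} (hΩ : IsOpen Ω) {g : Euc N → Euc N → ℝ}
    {j : Euc N → Euc N → Euc N} {n : Euc N → Euc N} {Cj : ℝ} {H : Euc N → ℝ → ℝ → Euc N → ℝ}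
    {W : Euc N → ℝ → ℝ} (hW : IsParSubSol Ω j g n Cj (parF H) W)
    {ξ : ℝ} (hξ : 0 < ξ) {φ : Euc N → ℝ → ℝ}
    (hφ : ContDiff ℝ 1 (fun q : Euc N × ℝ => φ q.1 q.2)) {x : Euc N} (hx : x ∈ closure Ω)
    {t : ℝ} (ht : 0 < t)
    (hmax : ∀ y ∈ closedBall x (Cj * ξ) ∩ closure Ω, ∀ s ∈ Ioi (0:ℝ), |s - t| ≤ ξ →
        W y s - φ y s ≤ W x t - φ x t)
    (hneu : x ∈ frontier Ω → 0 < ⟪gradient (fun y => φ y t) x, n x⟫) :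
    deriv (φ x) t - (Iin Ω j g ξ (fun y => φ y t) x + Iout Ω j g ξ (fun y => W y t) x)
      + H x t (W x t) (gradient (fun y => φ y t) x) ≤ 0 := by
  obtain ⟨h1, h2⟩ := hW ξ hξ φ hφ x hx t ht hmax
  by_cases hxO : x ∈ Ω
  · exact h1 hxO
  · have hxf : x ∈ frontier Ω := by rw [hΩ.frontier_eq]; exact ⟨hx, hxO⟩
    rcases min_le_iff.1 (h2 hxf) with h | h
    · exact h
    · exact absurd h (not_le.2 (hneu hxf))

lemma far_usc (hN : 0 < N) {Ω : Set (Euc N)} (hΩ : IsOpen Ω) (hfr : volume (frontier Ω) = 0)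
    {g : Euc N → Euc N → ℝ} {Cμ Dμ σ : ℝ} (hM : AssumptionM Ω g Cμ Dμ σ)
    {j : Euc N → Euc N → Euc N} {Aj : ℝ} (hJ0 : AssumptionJ0 Ω j Aj)
    {Cj' Cj Dj : ℝ} (hJ1 : AssumptionJ1 Ω j Cj' Cj Dj)
    {W : Euc N → ℝ → ℝ}
    (hW : UpperSemicontinuousOn (fun q : Euc N × ℝ => W q.1 q.2) (closure Ω ×ˢ Ici 0))
    {M T : ℝ} (hWM : ∀ y ∈ closure Ω, ∀ t ∈ Icc 0 T, |W y t| ≤ M)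
    {x : ℕ → Euc N} {t : ℕ → ℝ} {xb : Euc N} {tb : ℝ} (hxb : xb ∈ closure Ω) (htb : tb ∈ Icc 0 T)
    (hx : ∀ᶠ n in atTop, x n ∈ closure Ω) (ht : ∀ᶠ n in atTop, t n ∈ Icc 0 T)
    (hxt : Tendsto x atTop (𝓝 xb)) (htt : Tendsto t atTop (𝓝 tb))
    (hWt : Tendsto (fun n => W (x n) (t n)) atTop (𝓝 (W xb tb))) {ρ : ℝ} (hρ : 0 < ρ)
    {ϑ : ℝ} (hϑ : 0 < ϑ) :
    ∀ᶠ n in atTop,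
      ∫ z in {z | ρ ≤ ‖z‖}, (TT Ω j (x n)).indicator
        (fun z => (W (x n + j (x n) z) (t n) - W (x n) (t n)) * g (x n) z) z ≤
      (∫ z in {z | ρ ≤ ‖z‖}, (TT Ω j xb).indicator
        (fun z => (W (xb + j xb z) tb - W xb tb) * g xb z) z) + ϑ := by
  have hM1 := hM.1
  have hcμ := hM1.1
  obtain ⟨C1, hC1, h1⟩ := kern_facts hN σ hM1.2.1
  set S : Set (Euc N) := {z | ρ ≤ ‖z‖} with hS
  have hSm : MeasurableSet S := measurableSet_le measurable_const measurable_norm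
  set F : ℕ → Euc N → ℝ := fun n => (TT Ω j (x n)).indicator
        (fun z => (W (x n + j (x n) z) (t n) - W (x n) (t n)) * g (x n) z) with hF
  set F0 : Euc N → ℝ := (TT Ω j xb).indicator
        (fun z => (W (xb + j xb z) tb - W xb tb) * g xb z) with hF0
  have hbd : ∀ x ∈ closure Ω, ∀ t ∈ Icc 0 T, ∀ z, |(TT Ω j x).indicator
        (fun z => (W (x + j x z) t - W x t) * g x z) z| ≤ 2 * M * Cμ * kern σ z := by
    intro x hx t ht z
    have hM0 : 0 ≤ M := (abs_nonneg _).trans (hWM x hx t ht)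
    by_cases hz : z ∈ TT Ω j x
    · rw [indicator_of_mem hz, abs_mul, abs_of_nonneg (hM1.2.2.2.1 x hx z)]
      have a1 : |W (x + j x z) t - W x t| ≤ 2 * M := by
        have := hWM _ hz t ht; have := hWM _ hx t ht
        have := abs_sub (W (x + j x z) t) (W x t); linarith
      calc _ ≤ 2 * M * (Cμ * kern σ z) := by
            gcongr
            · exact hM1.2.2.2.1 x hx z
            · exact hM1.2.2.2.2 x hx z
        _ = _ := by ring
    · rw [indicator_of_notMem hz, abs_zero]
      have := kern_nonneg σ z
      positivity
  have hme : ∀ x ∈ closure Ω, ∀ t ∈ Icc 0 T, Measurable ((TT Ω j x).indicator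
        (fun z => (W (x + j x z) t - W x t) * g x z)) := fun x hx t ht =>
    diff_measurable hJ0 hx (W := fun y => W y t) (usc_indicator_measurable hW ht.1) hM1.2.2.1
  have hin : ∀ x ∈ closure Ω, ∀ t ∈ Icc 0 T, IntegrableOn ((TT Ω j x).indicator
        (fun z => (W (x + j x z) t - W x t) * g x z)) S := fun x hx t ht =>
    far_integrable hN hM1 hJ0 hx (W := fun y => W y t) (fun y hy => hWM y hy t ht)
      (usc_indicator_measurable hW ht.1) hρ
  have hk : IntegrableOn (fun z => 4 * M * Cμ * kern σ z) S := (h1 ρ hρ).2.2.1.const_mul _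
  have hae : ∀ᵐ z ∂(volume.restrict S), xb + j xb z ∉ frontier Ω := by
    refine ae_restrict_of_ae ?_
    have := preimage_j_null hJ0 hxb hfr
    rw [ae_iff]
    simpa using this
  have hlim : Tendsto (fun n => ∫ z in S, max (F n z - F0 z) 0) atTop (𝓝 (∫ z in S, (0:ℝ))) := by
    refine tendsto_integral_filter_of_dominated_convergence (fun z => 4 * M * Cμ * kern σ z) ?_ ?_ hk ?_
    · filter_upwards [hx, ht] with n hxn htn
      exact (((hme _ hxn _ htn).sub (hme _ hxb _ htb)).max measurable_const).aestronglyMeasurable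
    · filter_upwards [hx, ht] with n hxn htn
      refine Eventually.of_forall fun z => ?_
      have a := hbd _ hxn _ htn z
      have b := hbd _ hxb _ htb z
      rw [Real.norm_eq_abs, abs_of_nonneg (le_max_right _ _)]
      have h4 : 4 * M * Cμ * kern σ z = 2 * M * Cμ * kern σ z + 2 * M * Cμ * kern σ z := by ring
      rw [h4]
      have := abs_le.1 a; have := abs_le.1 b
      refine max_le ?_ ?_
      · simp only [hF, hF0]; linarith
      · linarith
    · filter_upwards [hae] with z hz
      -- continuity of base point
      have hj : Tendsto (fun n => x n + j (x n) z) atTop (𝓝 (xb + j xb z)) := by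
        refine hxt.add ?_
        rw [tendsto_iff_norm_sub_tendsto_zero]
        have hd : Tendsto (fun n => Dj * ‖z‖ * ‖x n - xb‖) atTop (𝓝 0) := by
          have := (tendsto_iff_norm_sub_tendsto_zero.1 hxt).const_mul (Dj * ‖z‖)
          simpa using this
        refine squeeze_zero' (Eventually.of_forall fun n => norm_nonneg _) ?_ hd
        filter_upwards [hx] with n hxn
        exact hJ1.2.2.2.2 _ hxn _ hxb z
      have hgt : Tendsto (fun n => g (x n) z) atTop (𝓝 (g xb z)) := by
        rw [tendsto_iff_norm_sub_tendsto_zero]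
        have hd : Tendsto (fun n => Dμ * ‖x n - xb‖ * ‖z‖ ^ (-((N : ℝ) + σ))) atTop (𝓝 0) := by
          have := ((tendsto_iff_norm_sub_tendsto_zero.1 hxt).const_mul Dμ).mul_const
            (‖z‖ ^ (-((N : ℝ) + σ)))
          simpa using this
        refine squeeze_zero' (Eventually.of_forall fun n => norm_nonneg _) ?_ hd
        filter_upwards [hx] with n hxn
        exact hM.2.2 _ hxn _ hxb z
      by_cases hzO : xb + j xb z ∈ Ω
      · have hzT : z ∈ TT Ω j xb := subset_closure hzO
        have ev1 : ∀ᶠ n in atTop, x n + j (x n) z ∈ Ω := hj (hΩ.mem_nhds hzO)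
        refine tendsto_order.2 ⟨fun a ha => Eventually.of_forall fun n => ha.trans_le (le_max_right _ _), ?_⟩
        intro a ha
        -- choose η
        set w0 := W (xb + j xb z) tb with hw0
        have hcont : Tendsto (fun η : ℝ => (w0 + η - W xb tb) * g xb z) (𝓝[>] 0)
            (𝓝 ((w0 + 0 - W xb tb) * g xb z)) :=
          (Continuous.tendsto (by fun_prop) 0).mono_left nhdsWithin_le_nhds
        have hlt : (w0 + 0 - W xb tb) * g xb z < F0 z + a := by
          rw [hF0, indicator_of_mem hzT]; simp only [add_zero]; linarith
        obtain ⟨η, hη1, hη⟩ := ((hcont.eventually (gt_mem_nhds hlt)).and self_mem_nhdsWithin).exists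
        have hη0 : 0 < η := hη
        have husc := hW (xb + j xb z, tb) ⟨hzT, htb.1⟩ (w0 + η) (by simp only [hw0]; linarith)
        have hpt : Tendsto (fun n => (x n + j (x n) z, t n)) atTop
            (𝓝[closure Ω ×ˢ Ici 0] (xb + j xb z, tb)) := by
          refine tendsto_nhdsWithin_iff.2 ⟨hj.prodMk_nhds htt, ?_⟩
          filter_upwards [ev1, ht] with n h1 h2
          exact ⟨subset_closure h1, h2.1⟩
        have ev2 := hpt.eventually husc
        have hcv : Tendsto (fun n => (w0 + η - W (x n) (t n)) * g (x n) z) atTop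
            (𝓝 ((w0 + η - W xb tb) * g xb z)) := (tendsto_const_nhds.sub hWt).mul hgt
        filter_upwards [ev1, ev2, hcv.eventually (gt_mem_nhds hη1), hx] with n e1 e2 e3 hxn
        refine max_lt ?_ ha
        have hnT : z ∈ TT Ω j (x n) := subset_closure e1
        have : F n z ≤ (w0 + η - W (x n) (t n)) * g (x n) z := by
          rw [hF]; simp only
          rw [indicator_of_mem hnT]
          refine mul_le_mul_of_nonneg_right ?_ (hM1.2.2.2.1 _ hxn z)
          have e2' : W (x n + j (x n) z) (t n) < w0 + η := e2
          linarith
        linarith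
      · have hzc : xb + j xb z ∉ closure Ω := by
          intro h
          exact hz (by rw [hΩ.frontier_eq]; exact ⟨h, hzO⟩)
        have ev1 : ∀ᶠ n in atTop, x n + j (x n) z ∈ (closure Ω)ᶜ :=
          hj (isClosed_closure.isOpen_compl.mem_nhds hzc)
        refine tendsto_const_nhds.congr' ?_
        filter_upwards [ev1] with n hn
        have a1 : F n z = 0 := indicator_of_notMem (show z ∉ TT Ω j (x n) from hn) _
        have a2 : F0 z = 0 := indicator_of_notMem (show z ∉ TT Ω j xb from hzc) _
        rw [a1, a2]; simp
  rw [integral_zero] at hlim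
  filter_upwards [hlim.eventually (gt_mem_nhds hϑ), hx, ht] with n hn hxn htn
  have i1 := hin _ hxn _ htn
  have i0 := hin _ hxb _ htb
  have im : IntegrableOn (fun z => max (F n z - F0 z) 0) S := (i1.sub i0).pos_part
  have : ∫ z in S, F n z ≤ ∫ z in S, (F0 z + max (F n z - F0 z) 0) := by
    refine integral_mono i1 (i0.add im) fun z => ?_
    have := le_max_left (F n z - F0 z) 0
    simp only
    linarith
  rw [integral_add i0 im] at this
  linarith

lemma doubling {X : Type*} [MetricSpace X] {K : Set X} (hK : IsCompact K) {ξb : X} (hξb : ξb ∈ K)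
    {a b : X → ℝ} (ha : UpperSemicontinuousOn a K) (hb : UpperSemicontinuousOn b K)
    (hmax : ∀ ξ ∈ K, ξ ≠ ξb → a ξ + b ξ < a ξb + b ξb)
    {pen : ℕ → X → X → ℝ} (hpc : ∀ n, Continuous (fun q : X × X => pen n q.1 q.2))
    (hp0 : ∀ n ξ ξ', 0 ≤ pen n ξ ξ') {κ : ℕ → ℝ} (hκ : Tendsto κ atTop (𝓝 0)) (hκ0 : ∀ n, 0 ≤ κ n)
    (hd : ∀ n ξ ξ', dist ξ ξ' ^ 2 ≤ κ n * pen n ξ ξ')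
    (hpb : Tendsto (fun n => pen n ξb ξb) atTop (𝓝 0)) :
    ∃ ξ ξ' : ℕ → X, (∀ n, ξ n ∈ K) ∧ (∀ n, ξ' n ∈ K) ∧
      (∀ n, ∀ η ∈ K, ∀ η' ∈ K, a η + b η' - pen n η η' ≤ a (ξ n) + b (ξ' n) - pen n (ξ n) (ξ' n)) ∧
      Tendsto ξ atTop (𝓝 ξb) ∧ Tendsto ξ' atTop (𝓝 ξb) ∧
      Tendsto (fun n => a (ξ n)) atTop (𝓝 (a ξb)) ∧ Tendsto (fun n => b (ξ' n)) atTop (𝓝 (b ξb)) ∧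
      Tendsto (fun n => pen n (ξ n) (ξ' n)) atTop (𝓝 0) := by
  have hKK := hK.prod hK
  have hne : (K ×ˢ K).Nonempty := ⟨(ξb, ξb), hξb, hξb⟩
  have usc1 : UpperSemicontinuousOn (fun q : X × X => a q.1) (K ×ˢ K) := by
    intro q hq c hc
    have : Tendsto Prod.fst (𝓝[K ×ˢ K] q) (𝓝[K] q.1) :=
      tendsto_nhdsWithin_iff.2 ⟨continuous_fst.continuousAt.mono_left nhdsWithin_le_nhds, by
        filter_upwards [self_mem_nhdsWithin] with r hr using hr.1⟩
    exact this.eventually (ha q.1 hq.1 c hc)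
  have usc2 : UpperSemicontinuousOn (fun q : X × X => b q.2) (K ×ˢ K) := by
    intro q hq c hc
    have : Tendsto Prod.snd (𝓝[K ×ˢ K] q) (𝓝[K] q.2) :=
      tendsto_nhdsWithin_iff.2 ⟨continuous_snd.continuousAt.mono_left nhdsWithin_le_nhds, by
        filter_upwards [self_mem_nhdsWithin] with r hr using hr.2⟩
    exact this.eventually (hb q.2 hq.2 c hc)
  have hex : ∀ n, ∃ q ∈ K ×ˢ K, IsMaxOn (fun q : X × X => a q.1 + b q.2 + -pen n q.1 q.2) (K ×ˢ K) q := by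
    intro n
    refine UpperSemicontinuousOn.exists_isMaxOn hne hKK ?_
    exact (usc1.add usc2).add (hpc n).neg.continuousOn.upperSemicontinuousOn
  choose q hqK hq using hex
  have hval : ∀ n, ∀ η ∈ K, ∀ η' ∈ K, a η + b η' - pen n η η' ≤ a (q n).1 + b (q n).2 - pen n (q n).1 (q n).2 := by
    intro n η hη η' hη'
    have := hq n (show (η, η') ∈ K ×ˢ K from ⟨hη, hη'⟩)
    simp only [Set.mem_ofPred_eq] at this
    linarith
  have hlow := fun n => hval n ξb hξb ξb hξb
  obtain ⟨xa, hxa, hxam⟩ := UpperSemicontinuousOn.exists_isMaxOn ⟨ξb, hξb⟩ hK ha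
  obtain ⟨xb, hxb, hxbm⟩ := UpperSemicontinuousOn.exists_isMaxOn ⟨ξb, hξb⟩ hK hb
  have hbd : ∀ᶠ n in atTop, pen n (q n).1 (q n).2 ≤ a xa + b xb - (a ξb + b ξb) + 1 := by
    filter_upwards [hpb.eventually (gt_mem_nhds one_pos)] with n hn
    have h1 := hlow n
    have h2 : a (q n).1 ≤ a xa := hxam (hqK n).1
    have h3 : b (q n).2 ≤ b xb := hxbm (hqK n).2
    linarith
  have hdist : Tendsto (fun n => dist (q n).1 (q n).2 ^ 2) atTop (𝓝 0) := by
    have : Tendsto (fun n => κ n * (a xa + b xb - (a ξb + b ξb) + 1)) atTop (𝓝 0) := by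
      simpa using hκ.mul_const (a xa + b xb - (a ξb + b ξb) + 1)
    refine squeeze_zero' (Eventually.of_forall fun n => sq_nonneg _) ?_ this
    filter_upwards [hbd] with n hn
    exact (hd n _ _).trans (mul_le_mul_of_nonneg_left hn (hκ0 n))
  have hqt : Tendsto q atTop (𝓝 (ξb, ξb)) := by
    refine hKK.tendsto_nhds_of_unique_mapClusterPt (Eventually.of_forall hqK) ?_
    rintro ⟨η, η'⟩ hη hcl
    have he : η = η' := by
      have hcont : Continuous (fun q : X × X => dist q.1 q.2 ^ 2) := by fun_prop
      have hc2 : MapClusterPt (dist η η' ^ 2) atTop (fun n => dist (q n).1 (q n).2 ^ 2) :=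
        hcl.continuousAt_comp hcont.continuousAt
      have h0 : dist η η' ^ 2 = 0 := by
        by_contra hne
        have hpos : 0 < dist η η' ^ 2 := lt_of_le_of_ne (sq_nonneg _) (Ne.symm hne)
        have f1 := hc2.frequently (lt_mem_nhds (half_lt_self hpos))
        obtain ⟨n, hn1, hn2⟩ := (f1.and_eventually (hdist.eventually (gt_mem_nhds (half_pos hpos)))).exists
        linarith
      exact dist_eq_zero.1 (pow_eq_zero_iff two_ne_zero |>.1 h0)
    subst he
    by_contra hneq
    have hη1 : η ≠ ξb := fun h => hneq (by rw [h])
    have hlt := hmax η hη.1 hη1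
    set θ := (a ξb + b ξb - (a η + b η)) / 4 with hθ
    have hθ0 : 0 < θ := by rw [hθ]; linarith
    have e1 := usc1 (η, η) hη (a η + θ) (by simp only; linarith)
    have e2 := usc2 (η, η) hη (b η + θ) (by simp only; linarith)
    have ev : ∀ᶠ n in atTop, ¬ (a (q n).1 < a η + θ ∧ b (q n).2 < b η + θ) := by
      filter_upwards [hpb.eventually (gt_mem_nhds hθ0)] with n hn
      rintro ⟨c1, c2⟩
      have := hlow n
      have := hp0 n (q n).1 (q n).2
      rw [hθ] at *
      linarith
    have hfreq := hcl.frequently (p := fun q' => q' ∈ K ×ˢ K → (a q'.1 < a η + θ ∧ b q'.2 < b η + θ)) (by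
      exact (eventually_nhdsWithin_iff.1 (e1.and e2)))
    obtain ⟨n, hn1, hn2⟩ := (hfreq.and_eventually ev).exists
    exact hn2 (hn1 (hqK n))
  have hqt' : Tendsto q atTop (𝓝[K ×ˢ K] (ξb, ξb)) :=
    tendsto_nhdsWithin_iff.2 ⟨hqt, Eventually.of_forall hqK⟩
  have hmem : (ξb, ξb) ∈ K ×ˢ K := ⟨hξb, hξb⟩
  have ua : ∀ θ > 0, ∀ᶠ n in atTop, a (q n).1 < a ξb + θ := fun θ hθ =>
    hqt'.eventually (usc1 _ hmem (a ξb + θ) (by simp only; linarith))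
  have ub : ∀ θ > 0, ∀ᶠ n in atTop, b (q n).2 < b ξb + θ := fun θ hθ =>
    hqt'.eventually (usc2 _ hmem (b ξb + θ) (by simp only; linarith))
  refine ⟨fun n => (q n).1, fun n => (q n).2, fun n => (hqK n).1, fun n => (hqK n).2, hval,
    (continuous_fst.tendsto _).comp hqt, (continuous_snd.tendsto _).comp hqt, ?_, ?_, ?_⟩
  · refine tendsto_order.2 ⟨fun c hc => ?_, fun c hc => ?_⟩
    · have hc' : 0 < (a ξb - c) / 2 := by linarith
      filter_upwards [ub _ hc', hpb.eventually (gt_mem_nhds hc')] with n h1 h2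
      have := hlow n
      have := hp0 n (q n).1 (q n).2
      linarith
    · filter_upwards [ua (c - a ξb) (by linarith)] with n h; linarith
  · refine tendsto_order.2 ⟨fun c hc => ?_, fun c hc => ?_⟩
    · have hc' : 0 < (b ξb - c) / 2 := by linarith
      filter_upwards [ua _ hc', hpb.eventually (gt_mem_nhds hc')] with n h1 h2
      have := hlow n
      have := hp0 n (q n).1 (q n).2
      linarith
    · filter_upwards [ub (c - b ξb) (by linarith)] with n h; linarith
  · refine tendsto_order.2 ⟨fun c hc => Eventually.of_forall fun n => hc.trans_le (hp0 n _ _), fun c hc => ?_⟩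
    have hc' : 0 < c / 4 := by linarith
    filter_upwards [ua _ hc', ub _ hc', hpb.eventually (gt_mem_nhds hc')] with n h1 h2 h3
    have := hlow n
    linarith

def sq (δ : ℝ) (a : Euc N) : ℝ := √(‖a‖ ^ 2 + δ ^ 2)

def psp (Z : Euc N → Euc N) (ε δ : ℝ) (x y : Euc N) : ℝ :=
  ‖x - y‖ ^ 2 / ε ^ 2 + ε⁻¹ * sq δ (Z x - Z y)

def qv (ε δ : ℝ) (a : Euc N) : Euc N := (ε⁻¹ / sq δ a) • a

lemma sq_nonneg' (δ : ℝ) (a : Euc N) : 0 ≤ sq δ a := Real.sqrt_nonneg _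

lemma sq_sq (δ : ℝ) (a : Euc N) : sq δ a ^ 2 = ‖a‖ ^ 2 + δ ^ 2 := Real.sq_sqrt (by positivity)

lemma sq_pos {δ : ℝ} (hδ : 0 < δ) (a : Euc N) : 0 < sq δ a := Real.sqrt_pos.2 (by positivity)

lemma norm_le_sq (δ : ℝ) (a : Euc N) : ‖a‖ ≤ sq δ a := Real.le_sqrt_of_sq_le (by nlinarith [sq_nonneg δ])

lemma sq_add_le (δ : ℝ) (a b : Euc N) : sq δ (a + b) ≤ sq δ a + ‖b‖ := by
  refine Real.sqrt_le_iff.2 ⟨add_nonneg (sq_nonneg' _ _) (norm_nonneg _), ?_⟩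
  have h1 := norm_add_le a b
  have h2 := sq_sq δ a
  have h3 := norm_le_sq δ a
  have : ‖a + b‖ ^ 2 ≤ (‖a‖ + ‖b‖) ^ 2 := by gcongr
  nlinarith [norm_nonneg b, norm_nonneg a]

lemma psp_symm (Z : Euc N → Euc N) (ε δ : ℝ) (x y : Euc N) : psp Z ε δ x y = psp Z ε δ y x := by
  rw [psp, psp, norm_sub_rev, sq, sq, norm_sub_rev (Z x)]

lemma psp_joint (Z : Euc N → Euc N) {ε : ℝ} (hε : 0 < ε) (δ : ℝ) (x y h k : Euc N) :
    psp Z ε δ (x + h) (y + k) - psp Z ε δ x y ≤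
      (2 * ‖x - y‖ * ‖h - k‖ + ‖h - k‖ ^ 2) / ε ^ 2
      + ε⁻¹ * ‖(Z (x + h) - Z x) - (Z (y + k) - Z y)‖ := by
  have e1 : x + h - (y + k) = (x - y) + (h - k) := by abel
  have e2 : Z (x + h) - Z (y + k) = (Z x - Z y) + ((Z (x + h) - Z x) - (Z (y + k) - Z y)) := by abel
  have h1 := sq_add_le δ (Z x - Z y) ((Z (x + h) - Z x) - (Z (y + k) - Z y))
  have h2 : ‖x + h - (y + k)‖ ^ 2 ≤ ‖x - y‖ ^ 2 + (2 * ‖x - y‖ * ‖h - k‖ + ‖h - k‖ ^ 2) := by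
    rw [e1]
    have := norm_add_le (x - y) (h - k)
    have : ‖(x - y) + (h - k)‖ ^ 2 ≤ (‖x - y‖ + ‖h - k‖) ^ 2 := by gcongr
    linarith
  have h3 : ‖x + h - (y + k)‖ ^ 2 / ε ^ 2 ≤ ‖x - y‖ ^ 2 / ε ^ 2 + (2 * ‖x - y‖ * ‖h - k‖ + ‖h - k‖ ^ 2) / ε ^ 2 := by
    rw [← add_div]; gcongr
  have h4 : ε⁻¹ * sq δ (Z (x + h) - Z (y + k)) ≤ ε⁻¹ * sq δ (Z x - Z y)
      + ε⁻¹ * ‖(Z (x + h) - Z x) - (Z (y + k) - Z y)‖ := by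
    rw [← mul_add, e2]; gcongr
  rw [psp, psp]
  linarith

lemma norm_qv_le {ε δ : ℝ} (hε : 0 < ε) (hδ : 0 < δ) (a : Euc N) : ‖qv ε δ a‖ ≤ ε⁻¹ := by
  have h := sq_pos hδ a
  rw [qv, norm_smul, Real.norm_eq_abs, abs_of_nonneg (by positivity), div_mul_eq_mul_div, div_le_iff₀ h]
  have := norm_le_sq δ a
  gcongr

lemma qv_small {ε δ : ℝ} (hε : 0 < ε) (hδ : 0 < δ) {a : Euc N} (h : ‖qv ε δ a‖ < 1 / (2 * ε)) : ‖a‖ ≤ δ := by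
  by_contra hlt
  push Not at hlt
  have hs := sq_pos hδ a
  rw [qv, norm_smul, Real.norm_eq_abs, abs_of_nonneg (by positivity), div_mul_eq_mul_div, div_lt_iff₀ hs] at h
  have h1 : sq δ a ^ 2 < (2 * ‖a‖) ^ 2 := by
    rw [sq_sq]; nlinarith [norm_nonneg a]
  have h2 : sq δ a < 2 * ‖a‖ := lt_of_pow_lt_pow_left₀ 2 (by positivity) h1
  have h3 : ε⁻¹ * ‖a‖ = 1 / (2 * ε) * (2 * ‖a‖) := by field_simp
  rw [h3] at h
  have h4 : 1 / (2 * ε) * sq δ a < 1 / (2 * ε) * (2 * ‖a‖) := by gcongr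
  linarith

lemma sq_hasFDerivAt {δ : ℝ} (hδ : 0 < δ) (a : Euc N) :
    HasFDerivAt (sq (N := N) δ) ((1 / sq δ a) • innerSL ℝ a) a := by
  have h1 : HasFDerivAt (fun a : Euc N => ‖a‖ ^ 2 + δ ^ 2) (2 • innerSL ℝ a) a :=
    (hasStrictFDerivAt_norm_sq a).hasFDerivAt.add_const _
  have h2 := h1.sqrt (by positivity)
  refine h2.congr_fderiv ?_
  ext h
  simp only [smul_apply, sq, smul_eq_mul, nsmul_eq_mul]
  push_cast
  field_simp

lemma psp_hasFDerivAt {Z : Euc N → Euc N} {x : Euc N} (hZ : DifferentiableAt ℝ Z x) {ε δ : ℝ}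
    (hδ : 0 < δ) (y : Euc N) :
    HasFDerivAt (fun x => psp Z ε δ x y)
      ((2 / ε ^ 2) • innerSL ℝ (x - y) + (innerSL ℝ (qv ε δ (Z x - Z y))).comp (fderiv ℝ Z x)) x := by
  have h1 : HasFDerivAt (fun x : Euc N => ‖x - y‖ ^ 2) ((2 • innerSL ℝ (x - y))) x := by
    have := (hasStrictFDerivAt_norm_sq (x - y)).hasFDerivAt.comp x ((hasFDerivAt_id x).sub_const y)
    exact this
  have h2 : HasFDerivAt (fun x => sq δ (Z x - Z y))
      (((1 / sq δ (Z x - Z y)) • innerSL ℝ (Z x - Z y)).comp (fderiv ℝ Z x)) x :=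
    by
      have hs : HasFDerivAt (fun x => Z x - Z y) (fderiv ℝ Z x) x := hZ.hasFDerivAt.sub_const (Z y)
      exact HasFDerivAt.comp (g := sq δ) (f := fun x => Z x - Z y) x (sq_hasFDerivAt hδ (Z x - Z y)) hs
  have h3 := (h1.mul_const ((ε ^ 2)⁻¹)).add (h2.const_mul ε⁻¹)
  have e : (fun x => psp Z ε δ x y) = (fun x : Euc N => ‖x - y‖ ^ 2 * (ε ^ 2)⁻¹ + ε⁻¹ * sq δ (Z x - Z y)) := by
    ext x; rw [psp, div_eq_mul_inv]
  rw [e]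
  refine h3.congr_fderiv ?_
  ext h
  simp only [add_apply, smul_apply, ContinuousLinearMap.comp_apply, innerSL_apply_apply, qv,
    smul_eq_mul, nsmul_eq_mul, inner_smul_left]
  simp
  ring

lemma psp_contDiff {Z : Euc N → Euc N} (hZ : ContDiff ℝ 1 Z) {ε δ : ℝ} (hδ : 0 < δ) (y : Euc N) :
    ContDiff ℝ 1 (fun x => psp Z ε δ x y) := by
  unfold psp sq
  have h1 : ContDiff ℝ 1 (fun x => ‖Z x - Z y‖ ^ 2 + δ ^ 2) := ((hZ.sub contDiff_const).norm_sq ℝ).add contDiff_const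
  have h2 : ContDiff ℝ 1 (fun x => √(‖Z x - Z y‖ ^ 2 + δ ^ 2)) := h1.sqrt (fun x => by positivity)
  have h3 : ContDiff ℝ 1 (fun x : Euc N => ‖x - y‖ ^ 2) := (contDiff_id.sub contDiff_const).norm_sq ℝ
  exact (h3.div_const _).add (contDiff_const.mul h2)

lemma psp_continuous {Z : Euc N → Euc N} (hZ : Continuous Z) (ε δ : ℝ) :
    Continuous (fun q : Euc N × Euc N => psp Z ε δ q.1 q.2) := by
  unfold psp sq
  fun_prop

/-- One side of the doubling argument: the viscosity inequality at a maximum point. -/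
lemma one_side (hN : 0 < N) {Ω : Set (Euc N)} (hΩ : IsOpen Ω)
    {g : Euc N → Euc N → ℝ} {Cμ σ : ℝ} (hM : AssumptionM1 Ω g Cμ σ)
    {j : Euc N → Euc N → Euc N} {Aj : ℝ} (hJ0 : AssumptionJ0 Ω j Aj)
    {Cj' Cj Dj : ℝ} (hJ1 : AssumptionJ1 Ω j Cj' Cj Dj) {n : Euc N → Euc N}
    {F : Euc N → ℝ → ℝ → Euc N → ℝ}
    {W : Euc N → ℝ → ℝ} (hsub : IsParSubSol Ω j g n Cj (parF F) W)
    (hW : UpperSemicontinuousOn (fun q : Euc N × ℝ => W q.1 q.2) (closure Ω ×ˢ Ici 0))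
    {M T : ℝ} (hWM : ∀ y ∈ closure Ω, ∀ t ∈ Icc 0 T, |W y t| ≤ M)
    {G : Euc N → ℝ} (hG : ContDiff ℝ 1 G) {θ : ℝ → ℝ} (hθ : ContDiff ℝ 1 θ)
    {Z : Euc N → Euc N} (hZ : ContDiff ℝ 1 Z) {xb : Euc N} {tb r LG Lz : ℝ}
    (hr1 : 0 < tb - r) (hr2 : tb + r ≤ T)
    (hLG : ∀ y ∈ closedBall xb r, ‖fderiv ℝ G y‖ ≤ LG)
    (hLz : ∀ y ∈ closedBall xb r, ‖fderiv ℝ Z y‖ ≤ Lz)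
    {ε τ δ ξ : ℝ} (hε : 0 < ε) (hε1 : ε ≤ 1) (hεr : ε ≤ r / 2) (hδ : 0 < δ)
    (hξ : 0 < ξ) (hξε : Cj * ξ ≤ ε) (hξr : ξ ≤ r / 2)
    {x y : Euc N} {t s : ℝ} (hx : x ∈ closure Ω) (hxb : ‖x - xb‖ ≤ r / 2) (htb : |t - tb| ≤ r / 2)
    (hxy : ‖x - y‖ ≤ ε)
    (hmax : ∀ x' ∈ closure Ω, ‖x' - xb‖ ≤ r → ∀ t', |t' - tb| ≤ r →
      W x' t' - G x' - θ t' - psp Z ε δ x' y - (t' - s) ^ 2 / τ ^ 2 ≤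
      W x t - G x - θ t - psp Z ε δ x y - (t - s) ^ 2 / τ ^ 2)
    (hneu : x ∈ frontier Ω → 0 < fderiv ℝ G x (n x) + 2 / ε ^ 2 * ⟪x - y, n x⟫ +
      ⟪qv ε δ (Z x - Z y), fderiv ℝ Z x (n x)⟫) :
    ∃ (P : Euc N) (f : Euc N → ℝ),
      (∀ h, ⟪P, h⟫ = fderiv ℝ G x h + 2 / ε ^ 2 * ⟪x - y, h⟫ + ⟪qv ε δ (Z x - Z y), fderiv ℝ Z x h⟫) ∧
      Integrable ((TT Ω j x).indicator (fun z => f z * g x z)) ∧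
      (deriv θ t + 2 * (t - s) / τ ^ 2 - (∫ z, (TT Ω j x).indicator (fun z => f z * g x z) z)
        + F x t (W x t) P ≤ 0) ∧
      (∀ z, ξ ≤ ‖z‖ → f z = W (x + j x z) t - W x t) ∧
      (∀ z ∈ TT Ω j x, f z ≤ Cj * (3 + Lz + LG + 2 * M) / ε * ‖z‖) := by
  have hr0 : 0 < r := by linarith
  have hCj : 0 < Cj := hJ1.2.1
  have hxbr : x ∈ closedBall xb r := by rw [mem_closedBall, dist_eq_norm]; linarith
  have hLG0 : 0 ≤ LG := (norm_nonneg _).trans (hLG x hxbr)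
  have hLz0 : 0 ≤ Lz := (norm_nonneg _).trans (hLz x hxbr)
  obtain ⟨ht1, ht2⟩ := abs_le.1 htb
  have htT : t ∈ Icc 0 T := ⟨by linarith, by linarith⟩
  have hM0 : 0 ≤ M := (abs_nonneg _).trans (hWM x hx t htT)
  set φ : Euc N → ℝ → ℝ := fun x' t' => G x' + psp Z ε δ x' y + (θ t' + (t' - s) ^ 2 / τ ^ 2) with hφ
  have hsp : ContDiff ℝ 1 (fun x' => G x' + psp Z ε δ x' y) := hG.add (psp_contDiff hZ hδ y)
  have hti : ContDiff ℝ 1 (fun t' => θ t' + (t' - s) ^ 2 / τ ^ 2) :=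
    hθ.add (((contDiff_id.sub contDiff_const).pow 2).div_const _)
  have hφC : ContDiff ℝ 1 (fun q : Euc N × ℝ => φ q.1 q.2) :=
    (hsp.comp contDiff_fst).add (hti.comp contDiff_snd)
  have hφt : ContDiff ℝ 1 (fun x' => φ x' t) := hsp.add contDiff_const
  have hfd : HasFDerivAt (fun x' => φ x' t) (fderiv ℝ G x + ((2 / ε ^ 2) • innerSL ℝ (x - y) +
      (innerSL ℝ (qv ε δ (Z x - Z y))).comp (fderiv ℝ Z x))) x :=
    (((hG.differentiable one_ne_zero).differentiableAt.hasFDerivAt).add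
      (psp_hasFDerivAt (hZ.differentiable one_ne_zero).differentiableAt hδ y)).add_const _
  have hgrad : ∀ h, ⟪gradient (fun x' => φ x' t) x, h⟫ = fderiv ℝ G x h + 2 / ε ^ 2 * ⟪x - y, h⟫ +
      ⟪qv ε δ (Z x - Z y), fderiv ℝ Z x h⟫ := by
    intro h
    rw [gradient, InnerProductSpace.toDual_symm_apply, hfd.fderiv]
    simp only [add_apply, smul_apply, ContinuousLinearMap.comp_apply, innerSL_apply_apply, smul_eq_mul]
    ring
  have hder : deriv (φ x) t = deriv θ t + 2 * (t - s) / τ ^ 2 := by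
    have h1 : HasDerivAt (fun t' => (t' - s) ^ 2 / τ ^ 2) (2 * (t - s) / τ ^ 2) t := by
      have := (((hasDerivAt_id t).sub_const s).pow 2).div_const (τ ^ 2)
      simpa using this
    have h2 := ((((hθ.differentiable one_ne_zero).differentiableAt).hasDerivAt (x := t)).add h1).const_add
      (G x + psp Z ε δ x y)
    exact h2.deriv
  have hmax' : ∀ x' ∈ closure Ω, ‖x' - xb‖ ≤ r → ∀ t', |t' - tb| ≤ r →
      W x' t' - φ x' t' ≤ W x t - φ x t := by
    intro x' h1 h2 t' h3
    have := hmax x' h1 h2 t' h3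
    simp only [hφ]; linarith
  have hball : ∀ h : Euc N, ‖h‖ ≤ ε → ‖x + h - xb‖ ≤ r := by
    intro h hh
    have : x + h - xb = (x - xb) + h := by abel
    rw [this]
    exact (norm_add_le _ _).trans (by linarith)
  have hvis := visc_ineq hΩ hsub hξ hφC hx (t := t) (by linarith) (by
    intro y' hy' s' hs' hss
    refine hmax' y' hy'.2 ?_ s' ?_
    · have h1 := hy'.1
      rw [mem_closedBall, dist_eq_norm] at h1
      have := hball (y' - x) (h1.trans hξε)
      simpa using this
    · have : s' - tb = (s' - t) + (t - tb) := by ring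
      rw [this]
      exact (abs_add_le _ _).trans (by linarith)) (by
    intro hxf
    rw [hgrad]; exact hneu hxf)
  have hnl := nl_facts hN hM hJ0 hJ1 hx hφt (W := fun y => W y t) (fun y hy => hWM y hy t htT)
    (usc_indicator_measurable hW htT.1) hξ
  refine ⟨gradient (fun x' => φ x' t) x, fun z => nlA j ξ (fun y => φ y t) (fun y => W y t) x z, hgrad,
    hnl.1, ?_, ?_, ?_⟩
  · rw [← hnl.2, ← hder]; exact hvis
  · intro z hz
    simp only [nlA, not_lt.2 hz, if_false]
  · intro z hz
    have hjz : ‖j x z‖ ≤ Cj * ‖z‖ := (hJ1.2.2.2.1 x hx z).2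
    -- test function increments
    have hφinc : ∀ h : Euc N, ‖h‖ ≤ ε → φ (x + h) t - φ x t ≤ (3 + Lz + LG) / ε * ‖h‖ := by
      intro h hh
      have hxh : x + h ∈ closedBall xb r := by rw [mem_closedBall, dist_eq_norm]; exact hball h hh
      have g1 := (convex_closedBall xb r).norm_image_sub_le_of_norm_fderiv_le
        (fun y _ => (hG.differentiable one_ne_zero).differentiableAt) hLG hxbr hxh
      have g2 := (convex_closedBall xb r).norm_image_sub_le_of_norm_fderiv_le
        (fun y _ => (hZ.differentiable one_ne_zero).differentiableAt) hLz hxbr hxh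
      have g3 := psp_joint Z hε δ x y h 0
      simp only [add_zero, sub_zero, sub_self, add_sub_cancel_left] at g1 g2 g3
      have g4 : (2 * ‖x - y‖ * ‖h‖ + ‖h‖ ^ 2) / ε ^ 2 ≤ 3 / ε * ‖h‖ := by
        rw [div_le_iff₀ (by positivity)]
        have : 3 / ε * ‖h‖ * ε ^ 2 = 3 * ε * ‖h‖ := by field_simp
        rw [this]
        nlinarith [norm_nonneg h, norm_nonneg (x - y)]
      have g5 : ε⁻¹ * ‖Z (x + h) - Z x‖ ≤ ε⁻¹ * (Lz * ‖h‖) := by gcongr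
      have g6 : LG * ‖h‖ ≤ ε⁻¹ * (LG * ‖h‖) := by
        have : 1 ≤ ε⁻¹ := (one_le_inv₀ hε).2 hε1
        exact le_mul_of_one_le_left (by positivity) this
      have g7 := (le_abs_self _).trans g1
      have e : φ (x + h) t - φ x t = (G (x + h) - G x) + (psp Z ε δ (x + h) y - psp Z ε δ x y) := by
        simp only [hφ]; ring
      have e2 : (3 + Lz + LG) / ε * ‖h‖ = 3 / ε * ‖h‖ + ε⁻¹ * (Lz * ‖h‖) + ε⁻¹ * (LG * ‖h‖) := by
        field_simp
      rw [e, e2]; linarith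
    have hfin : (3 + Lz + LG + 2 * M) / ε * ‖j x z‖ ≤ Cj * (3 + Lz + LG + 2 * M) / ε * ‖z‖ := by
      calc _ ≤ (3 + Lz + LG + 2 * M) / ε * (Cj * ‖z‖) := by gcongr
        _ = _ := by ring
    refine le_trans ?_ hfin
    have hle : (3 + Lz + LG) / ε * ‖j x z‖ ≤ (3 + Lz + LG + 2 * M) / ε * ‖j x z‖ :=
      mul_le_mul_of_nonneg_right (div_le_div_of_nonneg_right (by linarith) hε.le) (norm_nonneg _)
    by_cases hzξ : ‖z‖ < ξ
    · simp only [nlA, hzξ, if_true]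
      refine (hφinc _ (hjz.trans (le_trans ?_ hξε))).trans hle
      gcongr
    · simp only [nlA, hzξ, if_false]
      rcases le_or_gt ‖j x z‖ ε with hh | hh
      · have h1 := hmax' (x + j x z) hz (hball _ hh) t (by linarith)
        have h2 := hφinc _ hh
        linarith
      · have h1 := abs_le.1 (hWM _ hz t htT)
        have h2 := abs_le.1 (hWM _ hx t htT)
        have h3 : W (x + j x z) t - W x t ≤ 2 * M := by linarith
        refine h3.trans ?_
        have h4 : 2 * M ≤ 2 * M / ε * ‖j x z‖ := by
          rw [div_mul_eq_mul_div, le_div_iff₀ hε]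
          gcongr
        exact h4.trans
          (mul_le_mul_of_nonneg_right (div_le_div_of_nonneg_right (by linarith) hε.le) (norm_nonneg _))

/-- crude bound of the nonlocal term -/
lemma crude (hN : 0 < N) {σ : ℝ} (hσ : σ ∈ Ioo (0:ℝ) 1) : ∃ C > (0:ℝ), ∀ (T : Set (Euc N)) (f g : Euc N → ℝ)
    (Λ B Cμ ε : ℝ), 0 < ε → 0 ≤ Λ → 0 ≤ B → 0 ≤ Cμ →
    (∀ z, 0 ≤ g z ∧ g z ≤ Cμ * kern σ z) → (∀ z ∈ T, f z ≤ Λ * ‖z‖) → (∀ z ∈ T, ε ≤ ‖z‖ → f z ≤ B) →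
    Integrable (T.indicator (fun z => f z * g z)) →
    ∫ z, T.indicator (fun z => f z * g z) z ≤ C * (Λ * Cμ * ε ^ (1 - σ) + B * Cμ * ε ^ (-σ)) := by
  obtain ⟨C1, hC1, h1⟩ := kern_facts hN σ hσ
  refine ⟨C1, hC1, ?_⟩
  intro T f g Λ B Cμ ε hε hΛ hB hCμ hg hf1 hf2 hint
  obtain ⟨i1, b1, i2, b2⟩ := h1 ε hε
  rw [← integral_add_compl (measurableSet_ball (x := (0 : Euc N)) (ε := ε)) hint]
  have hc : (ball (0 : Euc N) ε)ᶜ = {z | ε ≤ ‖z‖} := by ext z; simp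
  rw [hc]
  have q1 : IntegrableOn (fun z => Λ * Cμ * (‖z‖ * kern σ z)) (ball 0 ε) := i1.const_mul _
  have q2 : IntegrableOn (fun z => B * Cμ * kern σ z) {z : Euc N | ε ≤ ‖z‖} := i2.const_mul _
  have s1 : ∫ z in ball 0 ε, T.indicator (fun z => f z * g z) z ≤ ∫ z in ball (0 : Euc N) ε, Λ * Cμ * (‖z‖ * kern σ z) := by
    refine integral_mono hint.integrableOn q1 fun z => ?_
    have hk := kern_nonneg σ z
    simp only
    by_cases hz : z ∈ T
    · rw [indicator_of_mem hz]
      calc f z * g z ≤ (Λ * ‖z‖) * g z := mul_le_mul_of_nonneg_right (hf1 z hz) (hg z).1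
        _ ≤ (Λ * ‖z‖) * (Cμ * kern σ z) := mul_le_mul_of_nonneg_left (hg z).2 (by positivity)
        _ = _ := by ring
    · rw [indicator_of_notMem hz]; positivity
  have s2 : ∫ z in {z | ε ≤ ‖z‖}, T.indicator (fun z => f z * g z) z ≤ ∫ z in {z : Euc N | ε ≤ ‖z‖}, B * Cμ * kern σ z := by
    refine setIntegral_mono_on hint.integrableOn q2 (measurableSet_le measurable_const measurable_norm) fun z hzε => ?_
    have hk := kern_nonneg σ z
    by_cases hz : z ∈ T
    · rw [indicator_of_mem hz]
      calc f z * g z ≤ B * g z := mul_le_mul_of_nonneg_right (hf2 z hz hzε) (hg z).1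
        _ ≤ B * (Cμ * kern σ z) := mul_le_mul_of_nonneg_left (hg z).2 (by positivity)
        _ = _ := by ring
    · rw [indicator_of_notMem hz]; positivity
  rw [integral_const_mul] at s1 s2
  have t1 : Λ * Cμ * (∫ z in ball (0 : Euc N) ε, ‖z‖ * kern σ z) ≤ Λ * Cμ * (C1 * ε ^ (1 - σ)) := by gcongr
  have t2 : B * Cμ * (∫ z in {z : Euc N | ε ≤ ‖z‖}, kern σ z) ≤ B * Cμ * (C1 * ε ^ (-σ)) := by gcongr
  have e : C1 * (Λ * Cμ * ε ^ (1 - σ) + B * Cμ * ε ^ (-σ)) = Λ * Cμ * (C1 * ε ^ (1 - σ)) + B * Cμ * (C1 * ε ^ (-σ)) := by ring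
  rw [e]; linarith

lemma lip_ball {F : Type*} [NormedAddCommGroup F] [NormedSpace ℝ F] {f : Euc N → F} {xb : Euc N} {r L : ℝ}
    (hf : ContDiff ℝ 1 f) (hL : ∀ y ∈ ball xb r, ‖fderiv ℝ f y‖ ≤ L) {x y : Euc N}
    (hx : x ∈ ball xb r) (hy : y ∈ ball xb r) : ‖f x - f y‖ ≤ L * ‖x - y‖ :=
  (convex_ball xb r).norm_image_sub_le_of_norm_fderiv_le
    (fun _ _ => (hf.differentiable one_ne_zero).differentiableAt) hL hy hx

lemma add_mem_ball {xb x h : Euc N} {r : ℝ} (hx : ‖x - xb‖ < r / 2) (hh : ‖h‖ < r / 2) :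
    x + h ∈ ball xb r := by
  rw [mem_ball, dist_eq_norm]
  calc ‖x + h - xb‖ = ‖(x - xb) + h‖ := by congr 1; abel
    _ ≤ ‖x - xb‖ + ‖h‖ := norm_add_le _ _
    _ < r := by linarith

lemma joint_inc {G1 G2 : Euc N → ℝ} (hG1 : ContDiff ℝ 1 G1) (hG2 : ContDiff ℝ 1 G2)
    {Z : Euc N → Euc N} (hZ : ContDiff ℝ 1 Z) {xb : Euc N} {r LG1 LG2 Lz : ℝ} (hr : 0 < r)
    (hLG1 : ∀ y ∈ ball xb r, ‖fderiv ℝ G1 y‖ ≤ LG1) (hLG2 : ∀ y ∈ ball xb r, ‖fderiv ℝ G2 y‖ ≤ LG2)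
    (hLz : ∀ y ∈ ball xb r, ‖fderiv ℝ Z y‖ ≤ Lz)
    (hLz' : ∀ x ∈ ball xb r, ∀ y ∈ ball xb r, ‖fderiv ℝ Z x - fderiv ℝ Z y‖ ≤ Lz * ‖x - y‖)
    {ε δ : ℝ} (hε : 0 < ε) {x y h k : Euc N} (hx : ‖x - xb‖ < r / 2) (hy : ‖y - xb‖ < r / 2)
    (hh : ‖h‖ < r / 2) (hk : ‖k‖ < r / 2) {Cj Dj s : ℝ} (hDj : 0 ≤ Dj)
    (hs0 : 0 ≤ s) (hs1 : s ≤ 1) (hhs : ‖h‖ ≤ Cj * s) (hks : ‖k‖ ≤ Cj * s)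
    (hhk : ‖h - k‖ ≤ Dj * s * ‖x - y‖) :
    (G1 (x + h) - G1 x) + (G2 (y + k) - G2 y) + (psp Z ε δ (x + h) (y + k) - psp Z ε δ x y) ≤
      (Cj * (LG1 + LG2) + (2 * Dj + Dj ^ 2) * (‖x - y‖ / ε) ^ 2 + Lz * (Cj + Dj) * (‖x - y‖ / ε)) * s := by
  have h0 : ‖(0 : Euc N)‖ < r / 2 := by simpa using hr
  have hx0 : x ∈ ball xb r := by simpa using add_mem_ball hx h0
  have hy0 : y ∈ ball xb r := by simpa using add_mem_ball hy h0
  have hxh := add_mem_ball hx hh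
  have hyk := add_mem_ball hy hk
  have hyh := add_mem_ball hy hh
  have a0 : 0 ≤ LG1 := (norm_nonneg _).trans (hLG1 x hx0)
  have b0 : 0 ≤ LG2 := (norm_nonneg _).trans (hLG2 x hx0)
  have c0 : 0 ≤ Lz := (norm_nonneg _).trans (hLz x hx0)
  set η := ‖x - y‖ with hη
  have hη0 : 0 ≤ η := norm_nonneg _
  have g1 : G1 (x + h) - G1 x ≤ LG1 * (Cj * s) := by
    have := lip_ball hG1 hLG1 hxh hx0
    rw [add_sub_cancel_left] at this
    exact ((le_abs_self _).trans this).trans (by gcongr)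
  have g2 : G2 (y + k) - G2 y ≤ LG2 * (Cj * s) := by
    have := lip_ball hG2 hLG2 hyk hy0
    rw [add_sub_cancel_left] at this
    exact ((le_abs_self _).trans this).trans (by gcongr)
  have m1 := mixed_diff (fun x _ => (hZ.differentiable one_ne_zero).differentiableAt) hLz' hx hy hh
  have m2 := lip_ball hZ hLz hyh hyk
  have e2 : y + h - (y + k) = h - k := by abel
  rw [e2] at m2
  have m3 : ‖(Z (x + h) - Z x) - (Z (y + k) - Z y)‖ ≤ Lz * (Cj + Dj) * η * s := by
    have e : (Z (x + h) - Z x) - (Z (y + k) - Z y) =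
      ((Z (x + h) - Z x) - (Z (y + h) - Z y)) + (Z (y + h) - Z (y + k)) := by abel
    rw [e]
    have q1 : Lz * η * ‖h‖ ≤ Lz * η * (Cj * s) := mul_le_mul_of_nonneg_left hhs (by positivity)
    have q2 : Lz * ‖h - k‖ ≤ Lz * (Dj * s * η) := mul_le_mul_of_nonneg_left hhk c0
    refine (norm_add_le _ _).trans ?_
    nlinarith
  have p := psp_joint Z hε δ x y h k
  rw [← hη] at p
  have p1 : (2 * η * ‖h - k‖ + ‖h - k‖ ^ 2) / ε ^ 2 ≤ (2 * Dj + Dj ^ 2) * (η / ε) ^ 2 * s := by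
    rw [div_pow, mul_div_assoc', div_mul_eq_mul_div]
    refine div_le_div_of_nonneg_right ?_ (by positivity)
    have q1 : 2 * η * ‖h - k‖ ≤ 2 * η * (Dj * s * η) := mul_le_mul_of_nonneg_left hhk (by positivity)
    have q2 : ‖h - k‖ ^ 2 ≤ (Dj * s * η) ^ 2 := by gcongr
    have q3 : (Dj * s * η) ^ 2 ≤ Dj ^ 2 * η ^ 2 * s := by
      have : s ^ 2 ≤ s := by nlinarith
      nlinarith [mul_le_mul_of_nonneg_left this (by positivity : 0 ≤ Dj ^ 2 * η ^ 2)]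
    nlinarith
  have p2 : ε⁻¹ * ‖(Z (x + h) - Z x) - (Z (y + k) - Z y)‖ ≤ Lz * (Cj + Dj) * (η / ε) * s := by
    calc _ ≤ ε⁻¹ * (Lz * (Cj + Dj) * η * s) := by gcongr
      _ = _ := by rw [div_eq_mul_inv]; ring
  nlinarith

/-- The nonlocal terms near the diagonal. -/
lemma near_step (hN : 0 < N) {σ : ℝ} (hσ : σ ∈ Ioo (0:ℝ) 1) : ∃ C > (0:ℝ), ∀ {Ω : Set (Euc N)}
    {g : Euc N → Euc N → ℝ} {Cμ Dμ : ℝ} (_ : AssumptionM Ω g Cμ Dμ σ)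
    {j : Euc N → Euc N → Euc N} {Aj : ℝ} (_ : AssumptionJ0 Ω j Aj)
    {Z : Euc N → Euc N} {xb : Euc N} {rm Cm : ℝ} (_ : 0 < Cm)
    (_ : ∀ x ∈ closure Ω, ∀ y ∈ closure Ω, ‖x - xb‖ < rm → ‖y - xb‖ < rm →
    ∀ s : ℝ, 0 < s → s ≤ rm →
      (volume (mis Ω j x y ∩ ball 0 s)).toReal ≤ Cm * (‖Z x - Z y‖ + s * ‖x - y‖) * s ^ (N - 1))
    {ρ : ℝ} (_ : 0 < ρ) (_ : ρ ≤ rm) {k : ℕ} {ε Λ J : ℝ} (_ : 0 < ε) (_ : 0 ≤ Λ) (_ : 0 ≤ J)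
    {x y : Euc N} (_ : x ∈ closure Ω) (_ : y ∈ closure Ω) (_ : ‖x - xb‖ < rm) (_ : ‖y - xb‖ < rm)
    (_ : ‖Z x - Z y‖ ≤ ρ * 2⁻¹ ^ k * ε ^ 2) {f1 f2 : Euc N → ℝ}
    (_ : Integrable ((TT Ω j x).indicator (fun z => f1 z * g x z)))
    (_ : Integrable ((TT Ω j y).indicator (fun z => f2 z * g y z)))
    (_ : ∀ z ∈ TT Ω j x, f1 z ≤ Λ / ε * ‖z‖) (_ : ∀ z ∈ TT Ω j y, f2 z ≤ Λ / ε * ‖z‖)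
    (_ : ∀ z, ‖z‖ < ρ → ρ * 2⁻¹ ^ k ≤ ‖z‖ → z ∈ TT Ω j x → z ∈ TT Ω j y → f1 z + f2 z ≤ J * ‖z‖),
    ∫ z in ball (0 : Euc N) ρ, ((TT Ω j x).indicator (fun z => f1 z * g x z) z +
      (TT Ω j y).indicator (fun z => f2 z * g y z) z) ≤
      C * (Λ / ε * Cμ * (ρ * 2⁻¹ ^ k) ^ (1 - σ) + (J * Cμ + Λ / ε * (Dμ * ‖x - y‖)) * ρ ^ (1 - σ) +
        Λ / ε * Cμ * Cm * (ε ^ 2 + ‖x - y‖) * ρ ^ (1 - σ)) := by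
  obtain ⟨C, hC, h⟩ := near_bound hN σ hσ
  refine ⟨C, hC, ?_⟩
  intro Ω g Cμ Dμ hM j Aj hJ0 Z xb rm Cm hCm hmis ρ hρ hρm k ε Λ J hε hΛ hJ x y hx hy hxb hyb hZ f1 f2 i1 i2 b1 b2 hj
  have hCμ := hM.1.1
  have hDμ := hM.2.1
  refine h (TT Ω j x) (TT Ω j y) f1 f2 (g x) (g y) ρ k (ε ^ 2 + ‖x - y‖) (Λ / ε) J Cμ (Dμ * ‖x - y‖) Cm hρ
    (by positivity) (by positivity) hJ hCμ.le (by positivity) hCm.le ?_ ?_ ?_ ?_ ?_ (fun z _ hz => b1 z hz)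
    (fun z _ hz => b2 z hz) hj (i1.add i2).integrableOn
  · have e : {z | ¬ (z ∈ TT Ω j x ↔ z ∈ TT Ω j y)} = symmDiff (TT Ω j x) (TT Ω j y) := by
      ext z; simp [mem_symmDiff]; tauto
    rw [e]; exact (TT_measurable hJ0 hx).symmDiff (TT_measurable hJ0 hy)
  · intro i hi
    set s := ρ * (2⁻¹:ℝ) ^ i with hs
    have hs0 : 0 < s := by positivity
    have hsm : s ≤ rm := by
      have : (2⁻¹:ℝ) ^ i ≤ 1 := pow_le_one₀ (by norm_num) (by norm_num)
      nlinarith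
    have hks : ρ * 2⁻¹ ^ k ≤ s := by
      have : (2⁻¹:ℝ) ^ k ≤ 2⁻¹ ^ i := pow_le_pow_of_le_one (by norm_num) (by norm_num) hi.le
      rw [hs]; gcongr
    refine (hmis x hx y hy hxb hyb s hs0 hsm).trans ?_
    have e : s ^ N = s * s ^ (N - 1) := by
      rw [← pow_succ']; congr 1; omega
    rw [e]
    have q : ‖Z x - Z y‖ + s * ‖x - y‖ ≤ (ε ^ 2 + ‖x - y‖) * s := by
      have : ρ * 2⁻¹ ^ k * ε ^ 2 ≤ s * ε ^ 2 := by gcongr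
      nlinarith
    calc _ ≤ Cm * ((ε ^ 2 + ‖x - y‖) * s) * s ^ (N - 1) := by gcongr
      _ = _ := by ring
  · exact fun z => ⟨hM.1.2.2.2.1 x hx z, hM.1.2.2.2.2 x hx z⟩
  · exact fun z => ⟨hM.1.2.2.2.1 y hy z, hM.1.2.2.2.2 y hy z⟩
  · exact fun z => hM.2.2 x hx y hy z

lemma qv_inner_ge {ε δ : ℝ} (hε : 0 < ε) (hδ : 0 < δ) {a w : Euc N} {c : ℝ} (hc : 0 ≤ c)
    (h : -(c * ‖a‖) ≤ ⟪a, w⟫) : -(c / ε) ≤ ⟪qv ε δ a, w⟫ := by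
  have hs := sq_pos hδ a
  have hk : 0 ≤ ε⁻¹ / sq δ a := by positivity
  rw [qv, real_inner_smul_left]
  have h1 : (ε⁻¹ / sq δ a) * (-(c * ‖a‖)) ≤ (ε⁻¹ / sq δ a) * ⟪a, w⟫ := mul_le_mul_of_nonneg_left h hk
  refine le_trans ?_ h1
  have h2 : ‖a‖ / sq δ a ≤ 1 := (div_le_one hs).2 (norm_le_sq δ a)
  have e : (ε⁻¹ / sq δ a) * (-(c * ‖a‖)) = -(c / ε * (‖a‖ / sq δ a)) := by
    field_simp
  rw [e]
  have : c / ε * (‖a‖ / sq δ a) ≤ c / ε * 1 := mul_le_mul_of_nonneg_left h2 (by positivity)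
  linarith

lemma norm_le_of_inner {P : Euc N} {c : ℝ} (hc : 0 ≤ c) (h : ∀ v, ⟪P, v⟫ ≤ c * ‖v‖) : ‖P‖ ≤ c := by
  have := h P
  rw [real_inner_self_eq_norm_sq] at this
  by_contra hlt
  push Not at hlt
  nlinarith

/-- One side of the doubling argument along a sequence. -/
lemma side_seq (hN : 0 < N) {Ω : Set (Euc N)} (hΩ : IsOpen Ω)
    {g : Euc N → Euc N → ℝ} {Cμ σ : ℝ} (hM : AssumptionM1 Ω g Cμ σ)
    {j : Euc N → Euc N → Euc N} {Aj : ℝ} (hJ0 : AssumptionJ0 Ω j Aj)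
    {Cj' Cj Dj : ℝ} (hJ1 : AssumptionJ1 Ω j Cj' Cj Dj) {nn : Euc N → Euc N}
    {F : Euc N → ℝ → ℝ → Euc N → ℝ}
    {W : Euc N → ℝ → ℝ} (hsub : IsParSubSol Ω j g nn Cj (parF F) W)
    (hW : UpperSemicontinuousOn (fun q : Euc N × ℝ => W q.1 q.2) (closure Ω ×ˢ Ici 0))
    {M T : ℝ} (hWM : ∀ y ∈ closure Ω, ∀ t ∈ Icc 0 T, |W y t| ≤ M)
    {G : Euc N → ℝ} (hG : ContDiff ℝ 1 G) {θ : ℝ → ℝ} (hθ : ContDiff ℝ 1 θ)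
    {Z : Euc N → Euc N} (hZ : ContDiff ℝ 1 Z) {xb : Euc N} {tb r LG Lz : ℝ} (hr : 0 < r)
    (hr1 : 0 < tb - r) (hr2 : tb + r ≤ T)
    (hLG : ∀ y ∈ closedBall xb r, ‖fderiv ℝ G y‖ ≤ LG)
    (hLz : ∀ y ∈ closedBall xb r, ‖fderiv ℝ Z y‖ ≤ Lz) {e : ℝ} (he : σ < e)
    {ε δ ξ t s : ℕ → ℝ} {x y : ℕ → Euc N}
    (hε : ∀ n, 0 < ε n) (hε1 : ∀ n, ε n ≤ 1) (hεr : ∀ n, ε n ≤ r / 2) (hδ : ∀ n, 0 < δ n)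
    (hξ : ∀ n, 0 < ξ n) (hξε : ∀ n, Cj * ξ n ≤ ε n) (hξε' : ∀ n, ξ n ≤ ε n) (hξr : ∀ n, ξ n ≤ r / 2)
    (hεt : Tendsto ε atTop (𝓝 0))
    (hx : ∀ n, x n ∈ closure Ω) (hxt : Tendsto x atTop (𝓝 xb))
    (htt : Tendsto t atTop (𝓝 tb))
    (hxy : Tendsto (fun n => ‖x n - y n‖ / ε n) atTop (𝓝 0))
    (hts : Tendsto (fun n => |t n - s n| / ε n ^ e) atTop (𝓝 0))
    (hmax : ∀ n, ∀ x' ∈ closure Ω, ‖x' - xb‖ ≤ r → ∀ t', |t' - tb| ≤ r →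
      W x' t' - G x' - θ t' - psp Z (ε n) (δ n) x' (y n) - (t' - s n) ^ 2 / (ε n ^ e) ^ 2 ≤
      W (x n) (t n) - G (x n) - θ (t n) - psp Z (ε n) (δ n) (x n) (y n) - (t n - s n) ^ 2 / (ε n ^ e) ^ 2)
    {κ₀ Cn : ℝ} (hκ₀ : 0 < κ₀) (hCn : 0 ≤ Cn)
    (hneu : ∀ᶠ n in atTop, x n ∈ frontier Ω → κ₀ ≤ fderiv ℝ G (x n) (nn (x n)) ∧
      -(Cn * ‖x n - y n‖ ^ 2) ≤ ⟪x n - y n, nn (x n)⟫ ∧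
      -(Cn * ‖x n - y n‖ * ‖Z (x n) - Z (y n)‖) ≤ ⟪Z (x n) - Z (y n), fderiv ℝ Z (x n) (nn (x n))⟫) :
    ∃ (P : ℕ → Euc N) (f : ℕ → Euc N → ℝ),
      (∀ᶠ n in atTop, ∀ h, ⟪P n, h⟫ = fderiv ℝ G (x n) h + 2 / ε n ^ 2 * ⟪x n - y n, h⟫ +
        ⟪qv (ε n) (δ n) (Z (x n) - Z (y n)), fderiv ℝ Z (x n) h⟫) ∧
      (∀ᶠ n in atTop, Integrable ((TT Ω j (x n)).indicator (fun z => f n z * g (x n) z))) ∧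
      (∀ᶠ n in atTop, deriv θ (t n) + 2 * (t n - s n) / (ε n ^ e) ^ 2
        - (∫ z, (TT Ω j (x n)).indicator (fun z => f n z * g (x n) z) z)
        + F (x n) (t n) (W (x n) (t n)) (P n) ≤ 0) ∧
      (∀ᶠ n in atTop, ∀ z, ξ n ≤ ‖z‖ → f n z = W (x n + j (x n) z) (t n) - W (x n) (t n)) ∧
      (∀ᶠ n in atTop, ∀ z ∈ TT Ω j (x n), f n z ≤ Cj * (3 + Lz + LG + 2 * M) / ε n * ‖z‖) ∧
      (∀ ϑ > (0:ℝ), ∀ᶠ n in atTop, -ϑ ≤ ε n ^ e * (deriv θ (t n) + 2 * (t n - s n) / (ε n ^ e) ^ 2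
        - (∫ z, (TT Ω j (x n)).indicator (fun z => f n z * g (x n) z) z))) ∧
      (∀ ϑ > (0:ℝ), ∀ᶠ n in atTop, ∀ h, |⟪P n, h⟫ -
        ⟪qv (ε n) (δ n) (Z (x n) - Z (y n)), fderiv ℝ Z (x n) h⟫| ≤ ϑ / ε n * ‖h‖) ∧
      (∀ᶠ n in atTop, ‖P n‖ ≤ (1 + Lz) / ε n) := by
  have hσ := hM.2.1
  have hCμ := hM.1
  have hCj := hJ1.2.1
  have he0 : 0 < e := hσ.1.trans he
  have exb : ∀ᶠ n in atTop, ‖x n - xb‖ ≤ r / 2 := by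
    have := (tendsto_iff_norm_sub_tendsto_zero.1 hxt).eventually (gt_mem_nhds (half_pos hr))
    filter_upwards [this] with n hn using hn.le
  have etb : ∀ᶠ n in atTop, |t n - tb| ≤ r / 2 := by
    have := (tendsto_iff_norm_sub_tendsto_zero.1 htt).eventually (gt_mem_nhds (half_pos hr))
    filter_upwards [this] with n hn using hn.le
  have exy : ∀ᶠ n in atTop, ‖x n - y n‖ ≤ ε n := by
    filter_upwards [hxy.eventually (gt_mem_nhds one_pos)] with n hn
    exact ((div_lt_one (hε n)).1 hn).le
  have hneu' : ∀ᶠ n in atTop, x n ∈ frontier Ω → 0 < fderiv ℝ G (x n) (nn (x n)) +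
      2 / ε n ^ 2 * ⟪x n - y n, nn (x n)⟫ +
      ⟪qv (ε n) (δ n) (Z (x n) - Z (y n)), fderiv ℝ Z (x n) (nn (x n))⟫ := by
    have l1 : Tendsto (fun n => 2 * Cn * (‖x n - y n‖ / ε n) ^ 2 + Cn * (‖x n - y n‖ / ε n)) atTop (𝓝 0) := by
      have := ((hxy.pow 2).const_mul (2 * Cn)).add (hxy.const_mul Cn)
      simpa using this
    filter_upwards [hneu, l1.eventually (gt_mem_nhds hκ₀)] with n h1 h2 hf
    obtain ⟨a1, a2, a3⟩ := h1 hf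
    have b3 := qv_inner_ge (hε n) (hδ n) (mul_nonneg hCn (norm_nonneg (x n - y n))) a3
    have hε2 : 0 < ε n ^ 2 := by have := hε n; positivity
    have b2 : 2 / ε n ^ 2 * (-(Cn * ‖x n - y n‖ ^ 2)) ≤ 2 / ε n ^ 2 * ⟪x n - y n, nn (x n)⟫ :=
      mul_le_mul_of_nonneg_left a2 (by positivity)
    have e1 : 2 / ε n ^ 2 * (-(Cn * ‖x n - y n‖ ^ 2)) = -(2 * Cn * (‖x n - y n‖ / ε n) ^ 2) := by
      rw [div_pow]; ring
    have e2 : Cn * ‖x n - y n‖ / ε n = Cn * (‖x n - y n‖ / ε n) := by ring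
    rw [e1] at b2; rw [e2] at b3
    linarith
  have hex : ∀ᶠ n in atTop, ∃ p : Euc N × (Euc N → ℝ),
      (∀ h, ⟪p.1, h⟫ = fderiv ℝ G (x n) h + 2 / ε n ^ 2 * ⟪x n - y n, h⟫ +
        ⟪qv (ε n) (δ n) (Z (x n) - Z (y n)), fderiv ℝ Z (x n) h⟫) ∧
      Integrable ((TT Ω j (x n)).indicator (fun z => p.2 z * g (x n) z)) ∧
      (deriv θ (t n) + 2 * (t n - s n) / (ε n ^ e) ^ 2
        - (∫ z, (TT Ω j (x n)).indicator (fun z => p.2 z * g (x n) z) z)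
        + F (x n) (t n) (W (x n) (t n)) p.1 ≤ 0) ∧
      (∀ z, ξ n ≤ ‖z‖ → p.2 z = W (x n + j (x n) z) (t n) - W (x n) (t n)) ∧
      (∀ z ∈ TT Ω j (x n), p.2 z ≤ Cj * (3 + Lz + LG + 2 * M) / ε n * ‖z‖) := by
    filter_upwards [exb, etb, exy, hneu'] with n h1 h2 h3 h4
    obtain ⟨P, f, q⟩ := one_side hN hΩ hM hJ0 hJ1 hsub hW hWM hG hθ hZ hr1 hr2 hLG hLz (hε n) (hε1 n)
      (hεr n) (hδ n) (hξ n) (hξε n) (hξr n) (hx n) h1 h2 h3 (hmax n) h4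
    exact ⟨(P, f), q⟩
  obtain ⟨p, hp⟩ := hex.choice
  have hxbb : xb ∈ closedBall xb r := mem_closedBall_self hr.le
  have hLG0 : 0 ≤ LG := (norm_nonneg _).trans (hLG xb hxbb)
  have hLz0 : 0 ≤ Lz := (norm_nonneg _).trans (hLz xb hxbb)
  have hpa : ∀ ϑ > (0:ℝ), ∀ᶠ n in atTop, ∀ h, |⟪(p n).1, h⟫ -
        ⟪qv (ε n) (δ n) (Z (x n) - Z (y n)), fderiv ℝ Z (x n) h⟫| ≤ ϑ / ε n * ‖h‖ := by
    intro ϑ hϑ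
    have l1 : Tendsto (fun n => LG * ε n + 2 * (‖x n - y n‖ / ε n)) atTop (𝓝 0) := by
      have := (hεt.const_mul LG).add (hxy.const_mul 2)
      simpa using this
    filter_upwards [hp, exb, l1.eventually (gt_mem_nhds hϑ)] with n h1 h2 h3 h
    rw [h1.1 h]
    have e1 : fderiv ℝ G (x n) h + 2 / ε n ^ 2 * ⟪x n - y n, h⟫ +
        ⟪qv (ε n) (δ n) (Z (x n) - Z (y n)), fderiv ℝ Z (x n) h⟫ -
        ⟪qv (ε n) (δ n) (Z (x n) - Z (y n)), fderiv ℝ Z (x n) h⟫ =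
        fderiv ℝ G (x n) h + 2 / ε n ^ 2 * ⟪x n - y n, h⟫ := by ring
    rw [e1]
    have hε' := hε n
    have b1 : |fderiv ℝ G (x n) h| ≤ LG * ‖h‖ := by
      have : ‖fderiv ℝ G (x n)‖ ≤ LG := hLG _ (by rw [mem_closedBall, dist_eq_norm]; linarith)
      exact ((fderiv ℝ G (x n)).le_opNorm h).trans (by gcongr)
    have b2 : |2 / ε n ^ 2 * ⟪x n - y n, h⟫| ≤ 2 / ε n ^ 2 * (‖x n - y n‖ * ‖h‖) := by
      rw [abs_mul, abs_of_pos (show 0 < 2 / ε n ^ 2 by positivity)]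
      exact mul_le_mul_of_nonneg_left (abs_real_inner_le_norm _ _) (by positivity)
    refine (abs_add_le _ _).trans ((add_le_add b1 b2).trans ?_)
    have e2 : LG * ‖h‖ + 2 / ε n ^ 2 * (‖x n - y n‖ * ‖h‖) =
        (LG * ε n + 2 * (‖x n - y n‖ / ε n)) / ε n * ‖h‖ := by
      field_simp
    rw [e2]
    gcongr
  refine ⟨fun n => (p n).1, fun n => (p n).2, hp.mono fun n h => h.1, hp.mono fun n h => h.2.1,
    hp.mono fun n h => h.2.2.1, hp.mono fun n h => h.2.2.2.1, hp.mono fun n h => h.2.2.2.2, ?_, hpa, ?_⟩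
  · intro ϑ hϑ
    obtain ⟨C, hC, hcr⟩ := crude hN hσ
    set Λ0 := Cj * (3 + Lz + LG + 2 * M) with hΛ0
    have hM0 : 0 ≤ M := by
      have : tb ∈ Icc 0 T := ⟨by linarith, by linarith⟩
      exact (abs_nonneg _).trans (hWM (x 0) (hx 0) tb this)
    have l0 : Tendsto (fun n => ε n ^ e) atTop (𝓝 0) := by
      have := hεt.rpow_const (p := e) (Or.inr he0.le)
      rwa [Real.zero_rpow he0.ne'] at this
    have l0' : Tendsto (fun n => ε n ^ (e - σ)) atTop (𝓝 0) := by
      have := hεt.rpow_const (p := e - σ) (Or.inr (by linarith))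
      rwa [Real.zero_rpow (by linarith)] at this
    have l1 : Tendsto (fun n => ε n ^ e * deriv θ (t n) - 2 * (|t n - s n| / ε n ^ e) -
        C * (Λ0 + 2 * M) * Cμ * ε n ^ (e - σ)) atTop (𝓝 0) := by
      have hd : Tendsto (fun n => deriv θ (t n)) atTop (𝓝 (deriv θ tb)) :=
        ((hθ.continuous_deriv le_rfl).tendsto tb).comp htt
      have := ((l0.mul hd).sub (hts.const_mul 2)).sub (l0'.const_mul (C * (Λ0 + 2 * M) * Cμ))
      simpa using this
    filter_upwards [hp, etb, l1.eventually (lt_mem_nhds (neg_lt_zero.2 hϑ))] with n h1 h2 h3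
    refine h3.le.trans ?_
    have hε' := hε n
    have htT : t n ∈ Icc 0 T := by
      obtain ⟨q1, q2⟩ := abs_le.1 h2
      exact ⟨by linarith, by linarith⟩
    have hI := hcr (TT Ω j (x n)) (p n).2 (g (x n)) (Λ0 / ε n) (2 * M) Cμ (ε n) hε' (by positivity) (by positivity)
      hCμ.le (fun z => ⟨hM.2.2.2.1 _ (hx n) z, hM.2.2.2.2 _ (hx n) z⟩) h1.2.2.2.2 (by
        intro z hz hzε
        rw [h1.2.2.2.1 z ((hξε' n).trans hzε)]
        have q1 := hWM _ hz _ htT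
        have q2 := hWM _ (hx n) _ htT
        have := abs_le.1 q1; have := abs_le.1 q2
        linarith) h1.2.1
    have e1 : Λ0 / ε n * Cμ * ε n ^ (1 - σ) = Λ0 * Cμ * ε n ^ (-σ) := by
      rw [sub_eq_add_neg, Real.rpow_add hε', Real.rpow_one]; field_simp
    rw [e1] at hI
    set I := ∫ z, (TT Ω j (x n)).indicator (fun z => (p n).2 z * g (x n) z) z
    have e2 : ε n ^ e * ε n ^ (-σ) = ε n ^ (e - σ) := by rw [← Real.rpow_add hε']; rfl
    have he' : 0 < ε n ^ e := Real.rpow_pos_of_pos hε' e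
    have hI2 : ε n ^ e * I ≤ C * (Λ0 + 2 * M) * Cμ * ε n ^ (e - σ) := by
      rw [← e2]
      calc ε n ^ e * I ≤ ε n ^ e * (C * (Λ0 * Cμ * ε n ^ (-σ) + 2 * M * Cμ * ε n ^ (-σ))) :=
            mul_le_mul_of_nonneg_left hI he'.le
        _ = _ := by ring
    have e3 : ε n ^ e * (2 * (t n - s n) / (ε n ^ e) ^ 2) = 2 * ((t n - s n) / ε n ^ e) := by
      field_simp
    have e4 : -(|t n - s n| / ε n ^ e) ≤ (t n - s n) / ε n ^ e := by
      rw [← neg_div]; exact div_le_div_of_nonneg_right (neg_abs_le _) he'.le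
    have e5 : ε n ^ e * (deriv θ (t n) + 2 * (t n - s n) / (ε n ^ e) ^ 2 - I) = ε n ^ e * deriv θ (t n) +
        ε n ^ e * (2 * (t n - s n) / (ε n ^ e) ^ 2) - ε n ^ e * I := by ring
    rw [e5, e3]
    linarith
  · filter_upwards [hpa 1 one_pos, exb] with n h1 h2
    have hε' := hε n
    refine norm_le_of_inner (by positivity) fun h => ?_
    have a1 := (abs_le.1 (h1 h)).2
    have a2 : ⟪qv (ε n) (δ n) (Z (x n) - Z (y n)), fderiv ℝ Z (x n) h⟫ ≤ (ε n)⁻¹ * (Lz * ‖h‖) := by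
      refine (real_inner_le_norm _ _).trans ?_
      have : ‖fderiv ℝ Z (x n)‖ ≤ Lz := hLz _ (by rw [mem_closedBall, dist_eq_norm]; linarith)
      have q : ‖fderiv ℝ Z (x n) h‖ ≤ Lz * ‖h‖ := ((fderiv ℝ Z (x n)).le_opNorm h).trans (by gcongr)
      exact mul_le_mul (norm_qv_le hε' (hδ n) _) q (norm_nonneg _) (by positivity)
    have e1 : (1 + Lz) / ε n * ‖h‖ = 1 / ε n * ‖h‖ + (ε n)⁻¹ * (Lz * ‖h‖) := by field_simp
    rw [e1]; linarith

lemma seq_params {ρ r Cj σ : ℝ} (hρ : 0 < ρ) (hr : 0 < r) (hCj : 0 < Cj) (hσ : σ ∈ Ioo (0:ℝ) 1) {D : ℝ → ℝ}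
    (hD : ∀ ε > 0, 0 < D ε) : ∃ (ε δ : ℕ → ℝ) (k : ℕ → ℕ), (∀ n, 0 < ε n) ∧ (∀ n, ε n ≤ 1) ∧ (∀ n, ε n ≤ r / 2) ∧
      Tendsto ε atTop (𝓝 0) ∧ (∀ n, Cj * (ρ * 2⁻¹ ^ k n) ≤ ε n) ∧ (∀ n, ρ * 2⁻¹ ^ k n ≤ ε n) ∧
      (∀ n, (ρ * 2⁻¹ ^ k n) ^ (1 - σ) ≤ ε n ^ 2) ∧ (∀ n, 0 < δ n) ∧ (∀ n, δ n ≤ D (ε n)) ∧ (∀ n, δ n ≤ ε n ^ 2) ∧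
      (∀ n, δ n ≤ ρ * 2⁻¹ ^ k n * ε n ^ 2) := by
  set e0 := min 1 (r / 2) with he0
  have he0p : 0 < e0 := by positivity
  set ε : ℕ → ℝ := fun n => e0 / (n + 1) with hε
  have hεp : ∀ n, 0 < ε n := fun n => by positivity
  have hεe : ∀ n, ε n ≤ e0 := fun n => div_le_self he0p.le (by linarith [Nat.cast_nonneg (α := ℝ) n])
  have hkex : ∀ n, ∃ k : ℕ, Cj * (ρ * 2⁻¹ ^ k) ≤ ε n ∧ ρ * 2⁻¹ ^ k ≤ ε n ∧ (ρ * 2⁻¹ ^ k) ^ (1 - σ) ≤ ε n ^ 2 := by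
    intro n
    have l : Tendsto (fun k : ℕ => ρ * (2⁻¹:ℝ) ^ k) atTop (𝓝 0) := by
      have := (tendsto_pow_atTop_nhds_zero_of_lt_one (r := (2⁻¹:ℝ)) (by norm_num) (by norm_num)).const_mul ρ
      simpa using this
    have l2 : Tendsto (fun k : ℕ => Cj * (ρ * (2⁻¹:ℝ) ^ k)) atTop (𝓝 0) := by
      simpa using l.const_mul Cj
    have l3 : Tendsto (fun k : ℕ => (ρ * (2⁻¹:ℝ) ^ k) ^ (1 - σ)) atTop (𝓝 0) := by
      have := l.rpow_const (p := 1 - σ) (Or.inr (by linarith [hσ.2]))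
      rwa [Real.zero_rpow (by linarith [hσ.2])] at this
    have hp := hεp n
    obtain ⟨k, h1, h2, h3⟩ := ((l2.eventually (gt_mem_nhds hp)).and ((l.eventually (gt_mem_nhds hp)).and
      (l3.eventually (gt_mem_nhds (pow_pos hp 2))))).exists
    exact ⟨k, h1.le, h2.le, h3.le⟩
  choose k h1 h2 h3 using hkex
  refine ⟨ε, fun n => min (D (ε n)) (min (ε n ^ 2) (ρ * 2⁻¹ ^ k n * ε n ^ 2)), k, hεp,
    fun n => (hεe n).trans (min_le_left _ _), fun n => (hεe n).trans (min_le_right _ _), ?_, h1, h2, h3, ?_,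
    fun n => min_le_left _ _, fun n => (min_le_right _ _).trans (min_le_left _ _),
    fun n => (min_le_right _ _).trans (min_le_right _ _)⟩
  · have := (tendsto_one_div_add_atTop_nhds_zero_nat (𝕜 := ℝ)).const_mul e0
    simpa [hε, div_eq_mul_inv] using this
  · intro n
    have a := hεp n
    have b := hD _ a
    simp only [lt_min_iff]
    exact ⟨b, by positivity, by positivity⟩

lemma pen_dist {x y : Euc N} {t s ε τ p : ℝ} (hε : 0 < ε) (hτ : 0 < τ) (hp : ‖x - y‖ ^ 2 / ε ^ 2 ≤ p) :
    dist ((x, t) : Euc N × ℝ) (y, s) ^ 2 ≤ (ε ^ 2 + τ ^ 2) * (p + (t - s) ^ 2 / τ ^ 2) := by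
  have d1 : dist ((x, t) : Euc N × ℝ) (y, s) ^ 2 ≤ ‖x - y‖ ^ 2 + (t - s) ^ 2 := by
    rw [Prod.dist_eq]
    change max (dist x y) (dist t s) ^ 2 ≤ _
    rw [dist_eq_norm, Real.dist_eq]
    rcases max_choice ‖x - y‖ |t - s| with h | h <;> rw [h]
    · have := sq_nonneg (t - s)
      linarith
    · have := sq_nonneg ‖x - y‖
      rw [sq_abs]; linarith
  refine d1.trans ?_
  generalize hA : ‖x - y‖ ^ 2 = A at *
  generalize hB : (t - s) ^ 2 = B at *
  have hA0 : 0 ≤ A := by rw [← hA]; positivity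
  have hB0 : 0 ≤ B := by rw [← hB]; positivity
  have h1 : A ≤ p * ε ^ 2 := (div_le_iff₀ (by positivity)).1 hp
  have hp0 : 0 ≤ p := le_trans (by positivity) hp
  have h2 : B / τ ^ 2 * τ ^ 2 = B := by field_simp
  have h3 : 0 ≤ B / τ ^ 2 := by positivity
  nlinarith [mul_nonneg h3 (sq_nonneg ε), mul_nonneg hp0 (sq_nonneg τ)]

set_option maxHeartbeats 400000 in
lemma core_doubling {Ω : Set (Euc N)} {W1 W2 : Euc N → ℝ → ℝ}
    (hW1 : UpperSemicontinuousOn (fun q : Euc N × ℝ => W1 q.1 q.2) (closure Ω ×ˢ Ici 0))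
    (hW2 : UpperSemicontinuousOn (fun q : Euc N × ℝ => W2 q.1 q.2) (closure Ω ×ˢ Ici 0))
    {G1 G2 : Euc N → ℝ} (hG1 : Continuous G1) (hG2 : Continuous G2) {θ : ℝ → ℝ} (hθ : Continuous θ)
    {Z : Euc N → Euc N} (hZ : Continuous Z) {xb : Euc N} {tb r : ℝ} (hxb : xb ∈ closure Ω) (hr : 0 < r)
    (hr1 : 0 < tb - r)
    (hmax : ∀ x ∈ closure Ω, ‖x - xb‖ ≤ r → ∀ t, |t - tb| ≤ r → (x, t) ≠ (xb, tb) →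
      W1 x t + W2 x t - G1 x - G2 x - θ t < W1 xb tb + W2 xb tb - G1 xb - G2 xb - θ tb)
    {e : ℝ} (he : 0 < e) {ε δ : ℕ → ℝ} (hε : ∀ n, 0 < ε n) (hεt : Tendsto ε atTop (𝓝 0))
    (hδ : ∀ n, 0 < δ n) (hδε : ∀ n, δ n ≤ ε n ^ 2) :
    ∃ (x y : ℕ → Euc N) (t s : ℕ → ℝ),
      (∀ n, x n ∈ closure Ω ∧ ‖x n - xb‖ ≤ r ∧ |t n - tb| ≤ r) ∧
      (∀ n, y n ∈ closure Ω ∧ ‖y n - xb‖ ≤ r ∧ |s n - tb| ≤ r) ∧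
      (∀ n, ∀ x' ∈ closure Ω, ‖x' - xb‖ ≤ r → ∀ t', |t' - tb| ≤ r →
        ∀ y' ∈ closure Ω, ‖y' - xb‖ ≤ r → ∀ s', |s' - tb| ≤ r →
        (W1 x' t' - G1 x' - θ t') + (W2 y' s' - G2 y') -
          (psp Z (ε n) (δ n) x' y' + (t' - s') ^ 2 / (ε n ^ e) ^ 2) ≤
        (W1 (x n) (t n) - G1 (x n) - θ (t n)) + (W2 (y n) (s n) - G2 (y n)) -
          (psp Z (ε n) (δ n) (x n) (y n) + (t n - s n) ^ 2 / (ε n ^ e) ^ 2)) ∧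
      Tendsto x atTop (𝓝 xb) ∧ Tendsto y atTop (𝓝 xb) ∧ Tendsto t atTop (𝓝 tb) ∧ Tendsto s atTop (𝓝 tb) ∧
      Tendsto (fun n => W1 (x n) (t n)) atTop (𝓝 (W1 xb tb)) ∧
      Tendsto (fun n => W2 (y n) (s n)) atTop (𝓝 (W2 xb tb)) ∧
      Tendsto (fun n => ‖x n - y n‖ / ε n) atTop (𝓝 0) ∧
      Tendsto (fun n => |t n - s n| / ε n ^ e) atTop (𝓝 0) := by
  set K : Set (Euc N × ℝ) := (closedBall xb r ∩ closure Ω) ×ˢ closedBall tb r with hK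
  have hKc : IsCompact K :=
    ((isCompact_closedBall xb r).inter_right isClosed_closure).prod (isCompact_closedBall tb r)
  have hmemK : ∀ (x : Euc N) (t : ℝ), (x, t) ∈ K ↔ x ∈ closure Ω ∧ ‖x - xb‖ ≤ r ∧ |t - tb| ≤ r := by
    intro x t
    simp only [hK, mem_prod, mem_inter_iff, mem_closedBall, dist_eq_norm, Real.norm_eq_abs]
    tauto
  have hKs : K ⊆ closure Ω ×ˢ Ici 0 := by
    rintro ⟨x, t⟩ h
    obtain ⟨h1, h2, h3⟩ := (hmemK x t).1 h
    have := (abs_le.1 h3).1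
    exact ⟨h1, by simp only [mem_Ici]; linarith⟩
  set a : Euc N × ℝ → ℝ := fun q => W1 q.1 q.2 + (-(G1 q.1 + θ q.2)) with ha
  set b : Euc N × ℝ → ℝ := fun q => W2 q.1 q.2 + (-(G2 q.1)) with hb
  have ca : Continuous (fun q : Euc N × ℝ => -(G1 q.1 + θ q.2)) := by fun_prop
  have cb : Continuous (fun q : Euc N × ℝ => -(G2 q.1)) := by fun_prop
  have hau : UpperSemicontinuousOn a K := (hW1.mono hKs).add ca.continuousOn.upperSemicontinuousOn
  have hbu : UpperSemicontinuousOn b K := (hW2.mono hKs).add cb.continuousOn.upperSemicontinuousOn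
  set pen : ℕ → Euc N × ℝ → Euc N × ℝ → ℝ := fun n q q' =>
    psp Z (ε n) (δ n) q.1 q'.1 + (q.2 - q'.2) ^ 2 / (ε n ^ e) ^ 2 with hpen
  have hεe : ∀ n, 0 < ε n ^ e := fun n => Real.rpow_pos_of_pos (hε n) e
  have psp_ge : ∀ n x y, ‖x - y‖ ^ 2 / ε n ^ 2 ≤ psp Z (ε n) (δ n) x y := by
    intro n x y
    have := mul_nonneg (inv_nonneg.2 (hε n).le) (sq_nonneg' (δ n) (Z x - Z y))
    rw [psp]; linarith
  have hp0 : ∀ n q q', 0 ≤ pen n q q' := fun n q q' =>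
    add_nonneg ((by positivity : 0 ≤ ‖q.1 - q'.1‖ ^ 2 / ε n ^ 2).trans (psp_ge _ _ _)) (by positivity)
  have l0 : Tendsto (fun n => ε n ^ e) atTop (𝓝 0) := by
    have := hεt.rpow_const (p := e) (Or.inr he.le)
    rwa [Real.zero_rpow he.ne'] at this
  have hxbK : (xb, tb) ∈ K := (hmemK _ _).2 ⟨hxb, by simpa using hr.le, by simpa using hr.le⟩
  obtain ⟨ξ, ξ', m1, m2, hmx, t1, t2, t3, t4, t5⟩ := doubling hKc hxbK hau hbu (pen := pen)
    (κ := fun n => ε n ^ 2 + (ε n ^ e) ^ 2)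
    (by
      rintro ⟨x, t⟩ h hne
      obtain ⟨h1, h2, h3⟩ := (hmemK x t).1 h
      have := hmax x h1 h2 t h3 hne
      simp only [ha, hb]; linarith)
    (by
      intro n
      have c1 : Continuous (fun q : (Euc N × ℝ) × (Euc N × ℝ) => psp Z (ε n) (δ n) q.1.1 q.2.1) := by
        unfold psp sq
        fun_prop
      exact c1.add (by fun_prop))
    hp0
    (by
      have := (hεt.pow 2).add (l0.pow 2)
      simpa using this)
    (fun n => by positivity)
    (by
      rintro n ⟨x, t⟩ ⟨y, s⟩
      exact pen_dist (hε n) (hεe n) (psp_ge n x y))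
    (by
      have e1 : ∀ n, pen n (xb, tb) (xb, tb) = (ε n)⁻¹ * δ n := by
        intro n
        simp only [hpen, psp, sq, sub_self, norm_zero]
        rw [show (0:ℝ) ^ 2 + δ n ^ 2 = δ n ^ 2 by ring, Real.sqrt_sq (hδ n).le]
        simp
      simp only [e1]
      refine squeeze_zero (fun n => mul_nonneg (inv_nonneg.2 (hε n).le) (hδ n).le) (fun n => ?_) hεt
      have := hε n
      calc (ε n)⁻¹ * δ n ≤ (ε n)⁻¹ * ε n ^ 2 := by gcongr; exact hδε n
        _ = ε n := by field_simp)
  have hx := (continuous_fst.tendsto (xb, tb)).comp t1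
  have ht := (continuous_snd.tendsto (xb, tb)).comp t1
  have hy := (continuous_fst.tendsto (xb, tb)).comp t2
  have hs := (continuous_snd.tendsto (xb, tb)).comp t2
  refine ⟨fun n => (ξ n).1, fun n => (ξ' n).1, fun n => (ξ n).2, fun n => (ξ' n).2,
    fun n => (hmemK _ _).1 (m1 n), fun n => (hmemK _ _).1 (m2 n), ?_, hx, hy, ht, hs, ?_, ?_, ?_, ?_⟩
  · intro n x' h1 h2 t' h3 y' h4 h5 s' h6
    have := hmx n (x', t') ((hmemK _ _).2 ⟨h1, h2, h3⟩) (y', s') ((hmemK _ _).2 ⟨h4, h5, h6⟩)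
    simp only [ha, hb, hpen] at this
    linarith
  · have c := (ca.tendsto (xb, tb)).comp t1
    have := t3.sub c
    simpa [ha, Function.comp_def] using this
  · have c := (cb.tendsto (xb, tb)).comp t2
    have := t4.sub c
    simpa [hb, Function.comp_def] using this
  · have hsq := t5.sqrt
    rw [Real.sqrt_zero] at hsq
    refine squeeze_zero (fun n => by have := hε n; positivity) (fun n => ?_) hsq
    refine Real.le_sqrt_of_sq_le ?_
    rw [div_pow]
    have h1 := psp_ge n (ξ n).1 (ξ' n).1
    have h2 : 0 ≤ ((ξ n).2 - (ξ' n).2) ^ 2 / (ε n ^ e) ^ 2 := by positivity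
    simp only [hpen]; linarith
  · have hsq := t5.sqrt
    rw [Real.sqrt_zero] at hsq
    refine squeeze_zero (fun n => by have := hεe n; positivity) (fun n => ?_) hsq
    refine Real.le_sqrt_of_sq_le ?_
    rw [div_pow, sq_abs]
    have h1 := psp_ge n (ξ n).1 (ξ' n).1
    have h2 : 0 ≤ ‖(ξ n).1 - (ξ' n).1‖ ^ 2 / ε n ^ 2 := by positivity
    simp only [hpen]; linarith

structure SeqD (Ω : Set (Euc N)) (F1 F2 : Euc N → ℝ → ℝ → Euc N → ℝ) (W1 W2 : Euc N → ℝ → ℝ)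
    (Z : Euc N → Euc N) (xb : Euc N) (tb e Cp b T : ℝ) (ε : ℕ → ℝ) (x y : ℕ → Euc N) (t s a1 a2 : ℕ → ℝ)
    (P1 P2 Q : ℕ → Euc N) : Prop where
  ε0 : ∀ n, 0 < ε n
  εt : Tendsto ε atTop (𝓝 0)
  xm : ∀ n, x n ∈ closure Ω
  ym : ∀ n, y n ∈ closure Ω
  tm : ∀ᶠ n in atTop, t n ∈ Icc 0 T
  sm : ∀ᶠ n in atTop, s n ∈ Icc 0 T
  xt : Tendsto x atTop (𝓝 xb)
  yt : Tendsto y atTop (𝓝 xb)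
  tt : Tendsto t atTop (𝓝 tb)
  st : Tendsto s atTop (𝓝 tb)
  xy : Tendsto (fun n => ‖x n - y n‖ / ε n) atTop (𝓝 0)
  ts : Tendsto (fun n => |t n - s n| / ε n ^ e) atTop (𝓝 0)
  e1 : ∀ᶠ n in atTop, a1 n + F1 (x n) (t n) (W1 (x n) (t n)) (P1 n) ≤ 0
  e2 : ∀ᶠ n in atTop, a2 n + F2 (y n) (s n) (W2 (y n) (s n)) (P2 n) ≤ 0
  l1 : ∀ ϑ > (0:ℝ), ∀ᶠ n in atTop, -ϑ ≤ ε n ^ e * a1 n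
  l2 : ∀ ϑ > (0:ℝ), ∀ᶠ n in atTop, -ϑ ≤ ε n ^ e * a2 n
  p1 : ∀ ϑ > (0:ℝ), ∀ᶠ n in atTop, ∀ h, |⟪P1 n, h⟫ - ⟪Q n, fderiv ℝ Z (x n) h⟫| ≤ ϑ / ε n * ‖h‖
  p2 : ∀ ϑ > (0:ℝ), ∀ᶠ n in atTop, ∀ h, |⟪P2 n, h⟫ + ⟪Q n, fderiv ℝ Z (y n) h⟫| ≤ ϑ / ε n * ‖h‖
  q : ∀ n, ‖Q n‖ ≤ (ε n)⁻¹
  qz : ∀ n, ∃ c : ℝ, Q n = c • (Z (x n) - Z (y n))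
  b1 : ∀ᶠ n in atTop, ‖P1 n‖ ≤ Cp / ε n
  b2 : ∀ᶠ n in atTop, ‖P2 n‖ ≤ Cp / ε n
  b12 : ∀ᶠ n in atTop, ‖P1 n + P2 n‖ ≤ b
  w : ∀ᶠ n in atTop, 0 ≤ W1 (x n) (t n) + W2 (y n) (s n)
  wt1 : Tendsto (fun n => W1 (x n) (t n)) atTop (𝓝 (W1 xb tb))
  wt2 : Tendsto (fun n => W2 (y n) (s n)) atTop (𝓝 (W2 xb tb))

lemma split_sum {Ω : Set (Euc N)} {g : Euc N → Euc N → ℝ}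
    {j : Euc N → Euc N → Euc N} {x y : Euc N} {f1 f2 w1 w2 : Euc N → ℝ} {ξ ρ : ℝ} (hξρ : ξ ≤ ρ)
    (i1 : Integrable ((TT Ω j x).indicator (fun z => f1 z * g x z)))
    (i2 : Integrable ((TT Ω j y).indicator (fun z => f2 z * g y z)))
    (h1 : ∀ z, ξ ≤ ‖z‖ → f1 z = w1 z) (h2 : ∀ z, ξ ≤ ‖z‖ → f2 z = w2 z) :
    (∫ z, (TT Ω j x).indicator (fun z => f1 z * g x z) z) +
      (∫ z, (TT Ω j y).indicator (fun z => f2 z * g y z) z) =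
    (∫ z in ball (0 : Euc N) ρ, ((TT Ω j x).indicator (fun z => f1 z * g x z) z +
      (TT Ω j y).indicator (fun z => f2 z * g y z) z)) +
    ((∫ z in {z : Euc N | ρ ≤ ‖z‖}, (TT Ω j x).indicator (fun z => w1 z * g x z) z) +
    (∫ z in {z : Euc N | ρ ≤ ‖z‖}, (TT Ω j y).indicator (fun z => w2 z * g y z) z)) := by
  have hc : (ball (0 : Euc N) ρ)ᶜ = {z | ρ ≤ ‖z‖} := by ext z; simp
  have key : ∀ (S : Set (Euc N)) (f w gg : Euc N → ℝ), (∀ z, ξ ≤ ‖z‖ → f z = w z) →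
      (∫ z in {z : Euc N | ρ ≤ ‖z‖}, S.indicator (fun z => f z * gg z) z) =
      ∫ z in {z : Euc N | ρ ≤ ‖z‖}, S.indicator (fun z => w z * gg z) z := by
    intro S f w gg h
    apply setIntegral_congr_fun (hc ▸ measurableSet_ball.compl)
    intro z hz
    have : f z = w z := h z (hξρ.trans hz)
    by_cases hzS : z ∈ S <;> simp [hzS, this]
  rw [← integral_add_compl measurableSet_ball i1 (s := ball (0 : Euc N) ρ),
    ← integral_add_compl measurableSet_ball i2 (s := ball (0 : Euc N) ρ), hc, key _ f1 w1 _ h1, key _ f2 w2 _ h2,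
    integral_add i1.integrableOn i2.integrableOn]
  ring

lemma qv_neg (ε δ : ℝ) (a : Euc N) : qv ε δ (-a) = -qv ε δ a := by
  simp [qv, sq]

set_option maxHeartbeats 1000000 in
lemma local_seq (hN : 0 < N) {Ω : Set (Euc N)} (hΩ : IsOpen Ω) (hfr : volume (frontier Ω) = 0)
    {g : Euc N → Euc N → ℝ} {Cμ Dμ σ : ℝ} (hM : AssumptionM Ω g Cμ Dμ σ)
    {j : Euc N → Euc N → Euc N} {Aj : ℝ} (hJ0 : AssumptionJ0 Ω j Aj)
    {Cj' Cj Dj : ℝ} (hJ1 : AssumptionJ1 Ω j Cj' Cj Dj) {nn : Euc N → Euc N}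
    {F1 F2 : Euc N → ℝ → ℝ → Euc N → ℝ} {W1 W2 : Euc N → ℝ → ℝ}
    (hsub1 : IsParSubSol Ω j g nn Cj (parF F1) W1) (hsub2 : IsParSubSol Ω j g nn Cj (parF F2) W2)
    (hW1 : UpperSemicontinuousOn (fun q : Euc N × ℝ => W1 q.1 q.2) (closure Ω ×ˢ Ici 0))
    (hW2 : UpperSemicontinuousOn (fun q : Euc N × ℝ => W2 q.1 q.2) (closure Ω ×ˢ Ici 0))
    {M T : ℝ} (hWM1 : ∀ y ∈ closure Ω, ∀ t ∈ Icc 0 T, |W1 y t| ≤ M)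
    (hWM2 : ∀ y ∈ closure Ω, ∀ t ∈ Icc 0 T, |W2 y t| ≤ M)
    {G1 G2 : Euc N → ℝ} (hG1 : ContDiff ℝ 1 G1) (hG2 : ContDiff ℝ 1 G2) {θ : ℝ → ℝ} (hθ : ContDiff ℝ 1 θ)
    {Z : Euc N → Euc N} (hZ : ContDiff ℝ 1 Z) {xb : Euc N} (hxb : xb ∈ closure Ω) {tb r b Lz : ℝ} (hr : 0 < r)
    (hr1 : 0 < tb - r) (hr2 : tb + r ≤ T) (hb : 0 < b)
    (hLG1 : ∀ y ∈ closedBall xb r, ‖fderiv ℝ G1 y‖ ≤ b / 2)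
    (hLG2 : ∀ y ∈ closedBall xb r, ‖fderiv ℝ G2 y‖ ≤ b / 4)
    (hLz : ∀ y ∈ closedBall xb r, ‖fderiv ℝ Z y‖ ≤ Lz)
    (hLz' : ∀ x ∈ ball xb r, ∀ y ∈ ball xb r, ‖fderiv ℝ Z x - fderiv ℝ Z y‖ ≤ Lz * ‖x - y‖)
    {e : ℝ} (he : σ < e)
    (hmax : ∀ x ∈ closure Ω, ‖x - xb‖ ≤ r → ∀ t, |t - tb| ≤ r → (x, t) ≠ (xb, tb) →
      W1 x t + W2 x t - G1 x - G2 x - θ t < W1 xb tb + W2 xb tb - G1 xb - G2 xb - θ tb)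
    (hpos : 0 < W1 xb tb + W2 xb tb) {κ₀ Cn rn : ℝ} (hκ₀ : 0 < κ₀) (hCn : 0 ≤ Cn) (hrn : 0 < rn)
    (hneu1 : ∀ x ∈ frontier Ω, ‖x - xb‖ < rn → κ₀ ≤ fderiv ℝ G1 x (nn x) ∧ κ₀ ≤ fderiv ℝ G2 x (nn x))
    (hneu2 : ∀ x ∈ frontier Ω, ‖x - xb‖ < rn → ∀ y ∈ closure Ω, ‖y - xb‖ < rn →
      -(Cn * ‖x - y‖ ^ 2) ≤ ⟪x - y, nn x⟫ ∧
      -(Cn * ‖x - y‖ * ‖Z x - Z y‖) ≤ ⟪Z x - Z y, fderiv ℝ Z x (nn x)⟫)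
    (hmis : MisBound Ω j Z xb) {D : ℝ → ℝ} (hD : ∀ ε > 0, 0 < D ε) {E : ℝ}
    (hfar : ∀ ρ > 0, (∫ z in {z | ρ ≤ ‖z‖}, (TT Ω j xb).indicator
        (fun z => (W1 (xb + j xb z) tb - W1 xb tb) * g xb z) z) + (∫ z in {z | ρ ≤ ‖z‖}, (TT Ω j xb).indicator
        (fun z => (W2 (xb + j xb z) tb - W2 xb tb) * g xb z) z) ≤ E) :
    ∃ C0 : ℝ, ∃ ρ0 > (0:ℝ), ∀ ρ > 0, ρ ≤ ρ0 → ∃ (ε : ℕ → ℝ) (x y : ℕ → Euc N) (t s a1 a2 : ℕ → ℝ)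
      (P1 P2 Q : ℕ → Euc N), SeqD Ω F1 F2 W1 W2 Z xb tb e (1 + Lz) b T ε x y t s a1 a2 P1 P2 Q ∧
      ((∀ᶠ n in atTop, ‖Q n‖ < 1 / (2 * ε n)) → (∀ᶠ n in atTop, ‖Z (x n) - Z (y n)‖ ≤ D (ε n)) ∧
        ∀ ϑ > (0:ℝ), ∀ᶠ n in atTop, deriv θ tb - E - C0 * ρ ^ (1 - σ) - ϑ ≤ a1 n + a2 n) := by
  obtain ⟨Cμ0, hσ, hgm, hg0, hgC⟩ := hM.1
  obtain ⟨hDμ0, hgD⟩ := hM.2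
  obtain ⟨-, hCj, hDj, hj, hjD⟩ := id hJ1
  obtain ⟨rm, hrm, Cm, hCm, hmisb⟩ := hmis
  obtain ⟨C, hC, hnear⟩ := near_step hN hσ
  have he0 : 0 < e := hσ.1.trans he
  have hxr : xb ∈ closedBall xb r := mem_closedBall_self hr.le
  have hLz0 : 0 ≤ Lz := (norm_nonneg _).trans (hLz xb hxr)
  have htb : tb ∈ Icc 0 T := ⟨by linarith, by linarith⟩
  have hM0 : 0 ≤ M := (abs_nonneg _).trans (hWM1 xb hxb tb htb)
  refine ⟨C * (Cj * b * Cμ), min (min 1 rm) (r / (2 * Cj)), by positivity, fun ρ hρ hρ0 => ?_⟩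
  have hρ1 : ρ ≤ 1 := hρ0.trans ((min_le_left _ _).trans (min_le_left _ _))
  have hρm : ρ ≤ rm := hρ0.trans ((min_le_left _ _).trans (min_le_right _ _))
  have hρr : Cj * ρ ≤ r / 2 := by
    have := hρ0.trans (min_le_right _ _)
    rw [le_div_iff₀ (by positivity)] at this; linarith
  obtain ⟨ε, δ, k, hε, hε1, hεr, hεt, hξ1, hξ2, hξ3, hδ, hδD, hδε, hδξ⟩ := seq_params hρ hr hCj hσ hD
  obtain ⟨x, y, t, s, hxm, hym, hjm, hxt, hyt, htt, hst, hw1, hw2, hxy, hts⟩ :=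
    core_doubling hW1 hW2 hG1.continuous hG2.continuous hθ.continuous hZ.continuous hxb hr hr1 hmax he0 hε hεt hδ hδε
  have hxn : ∀ r' > 0, ∀ᶠ n in atTop, ‖x n - xb‖ < r' := fun r' hr' => by
    filter_upwards [hxt (ball_mem_nhds xb hr')] with n hn using by simpa [dist_eq_norm] using hn
  have hyn : ∀ r' > 0, ∀ᶠ n in atTop, ‖y n - xb‖ < r' := fun r' hr' => by
    filter_upwards [hyt (ball_mem_nhds xb hr')] with n hn using by simpa [dist_eq_norm] using hn
  have htm : ∀ n, t n ∈ Icc 0 T := fun n => by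
    have := abs_le.1 (hxm n).2.2; exact ⟨by linarith, by linarith⟩
  have hsm : ∀ n, s n ∈ Icc 0 T := fun n => by
    have := abs_le.1 (hym n).2.2; exact ⟨by linarith, by linarith⟩
  have hξ0 : ∀ n, 0 < ρ * 2⁻¹ ^ k n := fun n => by positivity
  have hxy' : Tendsto (fun n => ‖y n - x n‖ / ε n) atTop (𝓝 0) := by simpa [norm_sub_rev] using hxy
  have hts' : Tendsto (fun n => |s n - t n| / ε n ^ e) atTop (𝓝 0) := by simpa [abs_sub_comm] using hts
  have hLG2' : ∀ y ∈ closedBall xb r, ‖fderiv ℝ G2 y‖ ≤ b / 2 := fun y hy => (hLG2 y hy).trans (by linarith)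
  obtain ⟨P1, f1, A1, A2, A3, A4, A5, A6, A7, A8⟩ := side_seq hN hΩ hM.1 hJ0 hJ1 hsub1 hW1 hWM1 hG1 hθ hZ hr hr1 hr2
    hLG1 hLz he hε hε1 hεr hδ hξ0 hξ1 hξ2 (fun n => (hξ2 n).trans (hεr n)) hεt (fun n => (hxm n).1) hxt htt hxy hts
    (fun n x' hx' hxr' t' ht' => by
      have := hjm n x' hx' hxr' t' ht' (y n) (hym n).1 (hym n).2.1 (s n) (hym n).2.2
      linarith) hκ₀ hCn (by
      filter_upwards [hxn rn hrn, hyn rn hrn] with n h1 h2 hf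
      exact ⟨(hneu1 _ hf h1).1, hneu2 _ hf h1 _ (hym n).1 h2⟩)
  obtain ⟨P2, f2, B1, B2, B3, B4, B5, B6, B7, B8⟩ := side_seq hN hΩ hM.1 hJ0 hJ1 hsub2 hW2 hWM2 hG2
    (contDiff_const (c := (0:ℝ))) hZ hr hr1 hr2
    hLG2' hLz he hε hε1 hεr hδ hξ0 hξ1 hξ2 (fun n => (hξ2 n).trans (hεr n)) hεt (fun n => (hym n).1) hyt hst hxy' hts'
    (fun n x' hx' hxr' t' ht' => by
      have := hjm n (x n) (hxm n).1 (hxm n).2.1 (t n) (hxm n).2.2 x' hx' hxr' t' ht'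
      rw [psp_symm Z _ _ x', psp_symm Z _ _ (y n)]
      have e1 : (t' - t n) ^ 2 = (t n - t') ^ 2 := by ring
      have e2 : (s n - t n) ^ 2 = (t n - s n) ^ 2 := by ring
      rw [e1, e2]
      linarith) hκ₀ hCn (by
      filter_upwards [hxn rn hrn, hyn rn hrn] with n h1 h2 hf
      exact ⟨(hneu1 _ hf h2).2, hneu2 _ hf h2 _ (hxm n).1 h1⟩)
  have hqn : ∀ n, qv (ε n) (δ n) (Z (y n) - Z (x n)) = - qv (ε n) (δ n) (Z (x n) - Z (y n)) := fun n => by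
    rw [← qv_neg, neg_sub]
  have hηe : ∀ c > (0:ℝ), ∀ᶠ n in atTop, ‖x n - y n‖ / ε n < c := fun c hc => hxy.eventually (gt_mem_nhds hc)
  refine ⟨ε, x, y, t, s, _, _, P1, P2, fun n => qv (ε n) (δ n) (Z (x n) - Z (y n)),
    ⟨hε, hεt, fun n => (hxm n).1, fun n => (hym n).1, Eventually.of_forall htm, Eventually.of_forall hsm, hxt, hyt, htt, hst, hxy, hts,
      A3, B3, A6, B6, A7, ?_, fun n => norm_qv_le (hε n) (hδ n) _, fun n => ⟨_, rfl⟩, A8, B8, ?_, ?_, hw1, hw2⟩, ?_⟩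
  · intro ϑ hϑ
    filter_upwards [B7 ϑ hϑ] with n hn h
    have := hn h
    rw [hqn, inner_neg_left, sub_neg_eq_add] at this
    exact this
  · filter_upwards [A1, B1, hxn r hr, hyn r hr, hηe (b / 4 / (Lz + 1)) (by positivity)] with n h1 h2 h3 h4 h5
    apply norm_le_of_inner hb.le
    intro v
    rw [inner_add_left, h1, h2, hqn, inner_neg_left]
    have e1 : ⟪y n - x n, v⟫ = - ⟪x n - y n, v⟫ := by rw [← inner_neg_left, neg_sub]
    have e2 : ⟪qv (ε n) (δ n) (Z (x n) - Z (y n)), fderiv ℝ Z (x n) v⟫ -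
        ⟪qv (ε n) (δ n) (Z (x n) - Z (y n)), fderiv ℝ Z (y n) v⟫ ≤ b / 4 * ‖v‖ := by
      rw [← inner_sub_right, ← sub_apply]
      refine (real_inner_le_norm _ _).trans ?_
      have g1 := norm_qv_le (hε n) (hδ n) (Z (x n) - Z (y n))
      have g2 := (fderiv ℝ Z (x n) - fderiv ℝ Z (y n)).le_opNorm v
      have g3 := hLz' (x n) (by simpa [dist_eq_norm] using h3) (y n) (by simpa [dist_eq_norm] using h4)
      have g4 : ‖(fderiv ℝ Z (x n) - fderiv ℝ Z (y n)) v‖ ≤ Lz * ‖x n - y n‖ * ‖v‖ :=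
        g2.trans (mul_le_mul_of_nonneg_right g3 (norm_nonneg _))
      have g5 : Lz * (‖x n - y n‖ / ε n) ≤ b / 4 := by
        rw [lt_div_iff₀ (by positivity)] at h5
        have : 0 ≤ ‖x n - y n‖ / ε n := div_nonneg (norm_nonneg _) (hε n).le
        nlinarith
      calc _ ≤ (ε n)⁻¹ * (Lz * ‖x n - y n‖ * ‖v‖) := mul_le_mul g1 g4 (norm_nonneg _) (inv_nonneg.2 (hε n).le)
        _ = Lz * (‖x n - y n‖ / ε n) * ‖v‖ := by ring
        _ ≤ _ := mul_le_mul_of_nonneg_right g5 (norm_nonneg _)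
    have e3 : fderiv ℝ G1 (x n) v ≤ b / 2 * ‖v‖ :=
      ((le_abs_self _).trans ((fderiv ℝ G1 (x n)).le_opNorm v)).trans
        (mul_le_mul_of_nonneg_right (hLG1 _ (by simpa [dist_eq_norm] using h3.le)) (norm_nonneg _))
    have e4 : fderiv ℝ G2 (y n) v ≤ b / 4 * ‖v‖ :=
      ((le_abs_self _).trans ((fderiv ℝ G2 (y n)).le_opNorm v)).trans
        (mul_le_mul_of_nonneg_right (hLG2 _ (by simpa [dist_eq_norm] using h4.le)) (norm_nonneg _))
    rw [e1]
    have e5 : 2 / ε n ^ 2 * -⟪x n - y n, v⟫ = - (2 / ε n ^ 2 * ⟪x n - y n, v⟫) := by ring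
    rw [e5]
    linarith
  · have := (hw1.add hw2).eventually (lt_mem_nhds hpos)
    filter_upwards [this] with n hn using hn.le
  · intro hQ
    have hQ' : ∀ᶠ n in atTop, ‖Z (x n) - Z (y n)‖ ≤ δ n := by
      filter_upwards [hQ] with n hn using qv_small (hε n) (hδ n) hn
    refine ⟨by filter_upwards [hQ'] with n hn using hn.trans (hδD n), fun ϑ hϑ => ?_⟩
    set Λ := Cj * (3 + Lz + b / 2 + 2 * M) with hΛ
    have hΛ0 : 0 ≤ Λ := by positivity
    set J : ℕ → ℝ := fun n => Cj * (b / 2 + b / 2) + (2 * Dj + Dj ^ 2) * (‖x n - y n‖ / ε n) ^ 2 +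
      Lz * (Cj + Dj) * (‖x n - y n‖ / ε n) with hJ
    set Bd : ℕ → ℝ := fun n => C * (Λ * Cμ * ε n + (J n * Cμ + Λ * Dμ * (‖x n - y n‖ / ε n)) * ρ ^ (1 - σ) +
        Λ * Cμ * Cm * (ε n + ‖x n - y n‖ / ε n) * ρ ^ (1 - σ)) with hBd
    have hBt : Tendsto Bd atTop (𝓝 (C * (Cj * b * Cμ) * ρ ^ (1 - σ))) := by
      have hJt : Tendsto J atTop (𝓝 (Cj * (b / 2 + b / 2) + (2 * Dj + Dj ^ 2) * 0 ^ 2 + Lz * (Cj + Dj) * 0)) :=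
        (((hxy.pow 2).const_mul _).const_add _).add (hxy.const_mul _)
      have := (((hεt.const_mul (Λ * Cμ)).add (((hJt.mul_const Cμ).add (hxy.const_mul (Λ * Dμ))).mul_const
        (ρ ^ (1 - σ)))).add ((((hεt.add hxy).const_mul (Λ * Cμ * Cm))).mul_const (ρ ^ (1 - σ)))).const_mul C
      convert this using 2
      ring
    have hnb : ∀ᶠ n in atTop, ∫ z in ball (0 : Euc N) ρ, ((TT Ω j (x n)).indicator (fun z => f1 n z * g (x n) z) z +
      (TT Ω j (y n)).indicator (fun z => f2 n z * g (y n) z) z) ≤ Bd n := by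
      filter_upwards [A2, B2, A4, B4, A5, B5, hxn rm hrm, hyn rm hrm, hxn (r / 2) (by positivity),
        hyn (r / 2) (by positivity), hQ'] with n a2 b2 a4 b4 a5 b5 n1 n2 n3 n4 n5
      have hη : 0 ≤ ‖x n - y n‖ / ε n := div_nonneg (norm_nonneg _) (hε n).le
      have hJ0' : 0 ≤ J n := by
        have := hLz0; simp only [hJ]; positivity
      have key := hnear hM hJ0 hCm hmisb hρ hρm (k := k n) (hε n) hΛ0 hJ0' (hxm n).1 (hym n).1 n1 n2
        (n5.trans (hδξ n)) a2 b2 a5 b5 (by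
          intro z hz1 hz2 hz3 hz4
          rw [a4 z hz2, b4 z hz2]
          have q1 : ‖j (x n) z‖ ≤ Cj * ‖z‖ := (hj _ (hxm n).1 z).2
          have q2 : ‖j (y n) z‖ ≤ Cj * ‖z‖ := (hj _ (hym n).1 z).2
          have q3 : Cj * ‖z‖ < r / 2 := (mul_lt_mul_of_pos_left hz1 hCj).trans_le hρr
          have q4 := joint_inc hG1 hG2 hZ hr (fun y hy => hLG1 y (ball_subset_closedBall hy))
            (fun y hy => hLG2' y (ball_subset_closedBall hy)) (fun y hy => hLz y (ball_subset_closedBall hy)) hLz'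
            (hε n) (δ := δ n) n3 n4 (q1.trans_lt q3) (q2.trans_lt q3) hDj.le (norm_nonneg z) (hz1.le.trans hρ1) q1 q2
            (hjD _ (hxm n).1 _ (hym n).1 z)
          have nrm : ∀ a h : Euc N, ‖a - xb‖ < r / 2 → ‖h‖ < r / 2 → ‖a + h - xb‖ ≤ r := fun a h h1 h2 => by
            have : a + h - xb = (a - xb) + h := by abel
            rw [this]; exact (norm_add_le _ _).trans (by linarith)
          have q5 := hjm n (x n + j (x n) z) hz3 (nrm _ _ n3 (q1.trans_lt q3)) (t n) (hxm n).2.2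
            (y n + j (y n) z) hz4 (nrm _ _ n4 (q2.trans_lt q3)) (s n) (hym n).2.2
          simp only [hJ]
          linarith)
      refine key.trans ?_
      simp only [hBd]
      apply mul_le_mul_of_nonneg_left _ hC.le
      have hρσ : 0 ≤ ρ ^ (1 - σ) := Real.rpow_nonneg hρ.le _
      have z1 : Λ / ε n * Cμ * (ρ * 2⁻¹ ^ k n) ^ (1 - σ) ≤ Λ * Cμ * ε n := by
        calc _ ≤ Λ / ε n * Cμ * (ε n ^ 2) :=
              mul_le_mul_of_nonneg_left (hξ3 n) (mul_nonneg (div_nonneg hΛ0 (hε n).le) Cμ0.le)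
          _ = _ := by field_simp [(hε n).ne']
      have z2 : Λ / ε n * (Dμ * ‖x n - y n‖) = Λ * Dμ * (‖x n - y n‖ / ε n) := by ring
      have z3 : Λ / ε n * Cμ * Cm * (ε n ^ 2 + ‖x n - y n‖) = Λ * Cμ * Cm * (ε n + ‖x n - y n‖ / ε n) := by
        field_simp [(hε n).ne']
      rw [z2, z3]
      linarith
    have hdt : Tendsto (fun n => deriv θ (t n)) atTop (𝓝 (deriv θ tb)) :=
      ((hθ.continuous_deriv le_rfl).tendsto tb).comp htt
    have fu1 := far_usc hN hΩ hfr hM hJ0 hJ1 hW1 hWM1 hxb htb (Eventually.of_forall fun n => (hxm n).1)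
      (Eventually.of_forall htm) hxt htt hw1 hρ (show 0 < ϑ / 4 by positivity)
    have fu2 := far_usc hN hΩ hfr hM hJ0 hJ1 hW2 hWM2 hxb htb (Eventually.of_forall fun n => (hym n).1)
      (Eventually.of_forall hsm) hyt hst hw2 hρ (show 0 < ϑ / 4 by positivity)
    filter_upwards [A2, B2, A4, B4, hnb, fu1, fu2, hdt.eventually (lt_mem_nhds (show deriv θ tb - ϑ / 4 < deriv θ tb by linarith)),
      hBt.eventually (gt_mem_nhds (show C * (Cj * b * Cμ) * ρ ^ (1 - σ) <
        C * (Cj * b * Cμ) * ρ ^ (1 - σ) + ϑ / 4 by linarith))] with n a2 b2 a4 b4 c1 c2 c3 c4 c5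
    have hsplit := split_sum (ρ := ρ) ((mul_le_of_le_one_right hρ.le (pow_le_one₀ (by norm_num) (by norm_num))))
      a2 b2 a4 b4
    have hE := hfar ρ hρ
    have e3 : 2 * (s n - t n) / (ε n ^ e) ^ 2 = - (2 * (t n - s n) / (ε n ^ e) ^ 2) := by ring
    simp only [deriv_const]
    rw [e3]
    linarith

lemma far_limit (hN : 0 < N) {Ω : Set (Euc N)}
    {g : Euc N → Euc N → ℝ} {Cμ σ : ℝ} (hM : AssumptionM1 Ω g Cμ σ)
    {j : Euc N → Euc N → Euc N} {Aj : ℝ} (hJ0 : AssumptionJ0 Ω j Aj)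
    {Cj' Cj Dj : ℝ} (hJ1 : AssumptionJ1 Ω j Cj' Cj Dj) : ∃ CI > (0:ℝ), ∀ {W1 W2 : Euc N → ℝ → ℝ}
    (_ : UpperSemicontinuousOn (fun q : Euc N × ℝ => W1 q.1 q.2) (closure Ω ×ˢ Ici 0))
    (_ : UpperSemicontinuousOn (fun q : Euc N × ℝ => W2 q.1 q.2) (closure Ω ×ˢ Ici 0))
    {M T : ℝ} (_ : ∀ y ∈ closure Ω, ∀ t ∈ Icc 0 T, |W1 y t| ≤ M)
    (_ : ∀ y ∈ closure Ω, ∀ t ∈ Icc 0 T, |W2 y t| ≤ M) {xb : Euc N} (_ : xb ∈ closure Ω) {tb : ℝ}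
    (_ : tb ∈ Icc 0 T) {Γ : ℝ} (_ : 0 ≤ Γ)
    (_ : ∀ x ∈ closure Ω, W1 x tb + W2 x tb - (W1 xb tb + W2 xb tb) ≤ Γ)
    (_ : ∀ x ∈ closure Ω, W1 x tb + W2 x tb - (W1 xb tb + W2 xb tb) ≤ Γ * ‖x - xb‖) {ρ : ℝ} (_ : 0 < ρ),
      (∫ z in {z | ρ ≤ ‖z‖}, (TT Ω j xb).indicator
        (fun z => (W1 (xb + j xb z) tb - W1 xb tb) * g xb z) z) + (∫ z in {z | ρ ≤ ‖z‖}, (TT Ω j xb).indicator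
        (fun z => (W2 (xb + j xb z) tb - W2 xb tb) * g xb z) z) ≤ CI * Γ := by
  obtain ⟨Cμ0, hσ, hgm, hg0, hgC⟩ := id hM
  obtain ⟨-, hCj, hDj, hj, hjD⟩ := id hJ1
  obtain ⟨C, hC, hk⟩ := kern_facts hN σ hσ
  obtain ⟨k1, k2, k3, k4⟩ := hk 1 one_pos
  refine ⟨Cμ * (Cj * C + C), by positivity, ?_⟩
  intro W1 W2 hW1 hW2 M T hWM1 hWM2 xb hxb tb htb Γ hΓ hi1 hi2 ρ hρ
  have hm : MeasurableSet {z : Euc N | ρ ≤ ‖z‖} := measurableSet_le measurable_const measurable_norm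
  have hm1 : MeasurableSet {z : Euc N | 1 ≤ ‖z‖} := measurableSet_le measurable_const measurable_norm
  have I1 := far_integrable hN hM hJ0 hxb (W := fun y => W1 y tb) (fun y hy => hWM1 y hy tb htb)
    (usc_indicator_measurable hW1 htb.1) hρ
  have I2 := far_integrable hN hM hJ0 hxb (W := fun y => W2 y tb) (fun y hy => hWM2 y hy tb htb)
    (usc_indicator_measurable hW2 htb.1) hρ
  rw [← integral_add I1 I2]
  set h : Euc N → ℝ := fun z => Γ * Cμ * Cj * (ball (0 : Euc N) 1).indicator (fun z => ‖z‖ * kern σ z) z +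
    Γ * Cμ * ({z : Euc N | 1 ≤ ‖z‖}).indicator (fun z => kern σ z) z with hh
  have hint1 : Integrable ((ball (0 : Euc N) 1).indicator (fun z => ‖z‖ * kern σ z)) :=
    k1.integrable_indicator measurableSet_ball
  have hint2 : Integrable (({z : Euc N | 1 ≤ ‖z‖}).indicator (fun z => kern σ z)) :=
    k3.integrable_indicator hm1
  have hint : Integrable h := (hint1.const_mul _).add (hint2.const_mul _)
  have hpos : ∀ z, 0 ≤ h z := fun z => by
    have a1 : 0 ≤ (ball (0 : Euc N) 1).indicator (fun z => ‖z‖ * kern σ z) z :=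
      indicator_nonneg (fun z _ => mul_nonneg (norm_nonneg _) (kern_nonneg σ z)) z
    have a2 : 0 ≤ ({z : Euc N | 1 ≤ ‖z‖}).indicator (fun z => kern σ z) z :=
      indicator_nonneg (fun z _ => kern_nonneg σ z) z
    simp only [hh]
    positivity
  have hle : ∀ z, (TT Ω j xb).indicator (fun z => (W1 (xb + j xb z) tb - W1 xb tb) * g xb z) z +
      (TT Ω j xb).indicator (fun z => (W2 (xb + j xb z) tb - W2 xb tb) * g xb z) z ≤ h z := by
    intro z
    by_cases hz : z ∈ TT Ω j xb
    · rw [indicator_of_mem hz, indicator_of_mem hz]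
      have b1 := hi1 _ (show xb + j xb z ∈ closure Ω from hz)
      have b2 := hi2 _ (show xb + j xb z ∈ closure Ω from hz)
      rw [add_sub_cancel_left] at b2
      have b3 := (hj xb hxb z).2
      have b4 := hg0 xb hxb z
      have b5 : g xb z ≤ Cμ * kern σ z := hgC xb hxb z
      have b6 := kern_nonneg σ z
      have e : (W1 (xb + j xb z) tb - W1 xb tb) * g xb z + (W2 (xb + j xb z) tb - W2 xb tb) * g xb z =
        (W1 (xb + j xb z) tb + W2 (xb + j xb z) tb - (W1 xb tb + W2 xb tb)) * g xb z := by ring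
      rw [e]
      by_cases hz1 : ‖z‖ < 1
      · have c1 : z ∈ ball (0 : Euc N) 1 := by simpa using hz1
        have c2 : z ∉ {z : Euc N | 1 ≤ ‖z‖} := by simpa using hz1
        simp only [hh]
        rw [indicator_of_mem c1, indicator_of_notMem c2]
        calc _ ≤ (Γ * (Cj * ‖z‖)) * g xb z :=
              mul_le_mul_of_nonneg_right (b2.trans (mul_le_mul_of_nonneg_left b3 hΓ)) b4
          _ ≤ (Γ * (Cj * ‖z‖)) * (Cμ * kern σ z) := mul_le_mul_of_nonneg_left b5 (by positivity)
          _ = _ := by ring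
      · have c1 : z ∉ ball (0 : Euc N) 1 := by simpa using hz1
        have c2 : z ∈ {z : Euc N | 1 ≤ ‖z‖} := by simpa using hz1
        simp only [hh]
        rw [indicator_of_notMem c1, indicator_of_mem c2]
        calc _ ≤ Γ * g xb z := mul_le_mul_of_nonneg_right b1 b4
          _ ≤ Γ * (Cμ * kern σ z) := mul_le_mul_of_nonneg_left b5 hΓ
          _ = _ := by ring
    · rw [indicator_of_notMem hz, indicator_of_notMem hz]
      simpa using hpos z
  calc _ ≤ ∫ z in {z : Euc N | ρ ≤ ‖z‖}, h z := setIntegral_mono_on (I1.add I2) hint.integrableOn hm (fun z _ => hle z)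
    _ ≤ ∫ z, h z := setIntegral_le_integral hint (Eventually.of_forall hpos)
    _ = Γ * Cμ * Cj * (∫ z in ball (0 : Euc N) 1, ‖z‖ * kern σ z) +
        Γ * Cμ * (∫ z in {z : Euc N | 1 ≤ ‖z‖}, kern σ z) := by
      simp only [hh]
      rw [integral_add (hint1.const_mul _) (hint2.const_mul _), integral_const_mul, integral_const_mul,
        integral_indicator measurableSet_ball, integral_indicator hm1]
    _ ≤ Γ * Cμ * Cj * C + Γ * Cμ * C := by
      rw [Real.one_rpow, mul_one] at k2 k4
      exact add_le_add (mul_le_mul_of_nonneg_left k2 (by positivity)) (mul_le_mul_of_nonneg_left k4 (by positivity))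
    _ = _ := by ring

set_option maxHeartbeats 1000000 in
lemma local_core (hN : 0 < N) {Ω : Set (Euc N)} (hΩ : IsOpen Ω) (hfr : volume (frontier Ω) = 0)
    {g : Euc N → Euc N → ℝ} {Cμ Dμ σ : ℝ} (hM : AssumptionM Ω g Cμ Dμ σ)
    {j : Euc N → Euc N → Euc N} {Aj : ℝ} (hJ0 : AssumptionJ0 Ω j Aj)
    {Cj' Cj Dj : ℝ} (hJ1 : AssumptionJ1 Ω j Cj' Cj Dj) {nn : Euc N → Euc N}
    (hnn : ∀ x ∈ frontier Ω, ‖nn x‖ = 1)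
    {F1 F2 : Euc N → ℝ → ℝ → Euc N → ℝ} {W1 W2 : Euc N → ℝ → ℝ}
    (hsub1 : IsParSubSol Ω j g nn Cj (parF F1) W1) (hsub2 : IsParSubSol Ω j g nn Cj (parF F2) W2)
    (hW1 : UpperSemicontinuousOn (fun q : Euc N × ℝ => W1 q.1 q.2) (closure Ω ×ˢ Ici 0))
    (hW2 : UpperSemicontinuousOn (fun q : Euc N × ℝ => W2 q.1 q.2) (closure Ω ×ˢ Ici 0))
    {M T : ℝ} (hWM1 : ∀ y ∈ closure Ω, ∀ t ∈ Icc 0 T, |W1 y t| ≤ M)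
    (hWM2 : ∀ y ∈ closure Ω, ∀ t ∈ Icc 0 T, |W2 y t| ≤ M)
    {G1 G2 : Euc N → ℝ} (hG1 : ContDiff ℝ 1 G1) (hG2 : ContDiff ℝ 1 G2) {θ : ℝ → ℝ} (hθ : ContDiff ℝ 1 θ)
    {Z : Euc N → Euc N} (hZ : ContDiff ℝ 1 Z) {xb : Euc N} (hxb : xb ∈ closure Ω) {tb r0 b Lz : ℝ} (hr0 : 0 < r0)
    (htb0 : 0 < tb) (htbT : tb < T) (hb : 0 < b)
    (hLG1 : ∀ y ∈ ball xb r0, ‖fderiv ℝ G1 y‖ ≤ b / 4)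
    (hLG2 : ∀ y ∈ ball xb r0, ‖fderiv ℝ G2 y‖ ≤ b / 4)
    (hLz : ∀ y ∈ ball xb r0, ‖fderiv ℝ Z y‖ ≤ Lz)
    (hLz' : ∀ x ∈ ball xb r0, ∀ y ∈ ball xb r0, ‖fderiv ℝ Z x - fderiv ℝ Z y‖ ≤ Lz * ‖x - y‖)
    {e : ℝ} (he : σ < e)
    (hmax : ∀ x ∈ closure Ω, ∀ t ∈ Icc 0 T,
      W1 x t + W2 x t - G1 x - G2 x - θ t ≤ W1 xb tb + W2 xb tb - G1 xb - G2 xb - θ tb)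
    (hpos : 0 < W1 xb tb + W2 xb tb) {κ₀ Cn rn : ℝ} (hκ₀ : 0 < κ₀) (hCn : 0 ≤ Cn) (hrn : 0 < rn)
    (hneu1 : ∀ x ∈ frontier Ω, ‖x - xb‖ < rn → κ₀ ≤ fderiv ℝ G1 x (nn x) ∧ κ₀ ≤ fderiv ℝ G2 x (nn x))
    (hneu2 : ∀ x ∈ frontier Ω, ‖x - xb‖ < rn → ∀ y ∈ closure Ω, ‖y - xb‖ < rn →
      -(Cn * ‖x - y‖ ^ 2) ≤ ⟪x - y, nn x⟫ ∧
      -(Cn * ‖x - y‖ * ‖Z x - Z y‖) ≤ ⟪Z x - Z y, fderiv ℝ Z x (nn x)⟫)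
    (hmis : MisBound Ω j Z xb) {D : ℝ → ℝ} (hD : ∀ ε > 0, 0 < D ε) {E : ℝ}
    (hfar : ∀ ρ > 0, (∫ z in {z | ρ ≤ ‖z‖}, (TT Ω j xb).indicator
        (fun z => (W1 (xb + j xb z) tb - W1 xb tb) * g xb z) z) + (∫ z in {z | ρ ≤ ‖z‖}, (TT Ω j xb).indicator
        (fun z => (W2 (xb + j xb z) tb - W2 xb tb) * g xb z) z) ≤ E)
    (hNC : ∀ ε x y t s a1 a2 P1 P2 Q, SeqD Ω F1 F2 W1 W2 Z xb tb e (1 + Lz) b T ε x y t s a1 a2 P1 P2 Q →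
      ∀ᶠ n in atTop, ‖Q n‖ < 1 / (2 * ε n)) {K e₁ : ℝ}
    (hHD : ∀ ε x y t s a1 a2 P1 P2 Q, SeqD Ω F1 F2 W1 W2 Z xb tb e (1 + Lz) b T ε x y t s a1 a2 P1 P2 Q →
      (∀ᶠ n in atTop, ‖Z (x n) - Z (y n)‖ ≤ D (ε n)) → ∀ ϑ > (0:ℝ), ∀ᶠ n in atTop,
      -(K * (W1 xb tb + W2 xb tb)) - e₁ - ϑ ≤ F1 (x n) (t n) (W1 (x n) (t n)) (P1 n) +
        F2 (y n) (s n) (W2 (y n) (s n)) (P2 n)) :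
    deriv θ tb ≤ K * (W1 xb tb + W2 xb tb) + e₁ + E := by
  obtain ⟨Cμ0, hσ, hgm, hg0, hgC⟩ := id hM.1
  obtain ⟨r, hr, q1, q2, q3, q4⟩ : ∃ r > 0, r < tb ∧ r ≤ T - tb ∧ r < r0 ∧ r ≤ b / 8 := by
    refine ⟨min (min (tb / 2) (T - tb)) (min (r0 / 2) (b / 8)), ?_, ?_, ?_, ?_, ?_⟩
    · exact lt_min (lt_min (by linarith) (by linarith)) (lt_min (by linarith) (by linarith))
    · exact ((min_le_left _ _).trans (min_le_left _ _)).trans_lt (by linarith)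
    · exact (min_le_left _ _).trans (min_le_right _ _)
    · exact ((min_le_right _ _).trans (min_le_left _ _)).trans_lt (by linarith)
    · exact (min_le_right _ _).trans (min_le_right _ _)
  have hcb : closedBall xb r ⊆ ball xb r0 := closedBall_subset_ball q3
  have hsqd : ∀ y v : Euc N, fderiv ℝ (fun y => G1 y + ‖y - xb‖ ^ 2) y v = fderiv ℝ G1 y v + 2 * ⟪y - xb, v⟫ := by
    intro y v
    have h1 := (hG1.differentiable one_ne_zero y).hasFDerivAt
    have h2 : HasFDerivAt (fun y : Euc N => ‖y - xb‖ ^ 2) (2 • (innerSL ℝ (y - xb)).comp (ContinuousLinearMap.id ℝ (Euc N))) y :=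
      ((hasFDerivAt_id y).sub_const xb).norm_sq
    have h3 : HasFDerivAt (fun y : Euc N => G1 y + ‖y - xb‖ ^ 2) _ y := h1.add h2
    rw [h3.fderiv]
    simp [inner_sub_left]
  have hG1' : ContDiff ℝ 1 (fun y => G1 y + ‖y - xb‖ ^ 2) :=
    hG1.add ((contDiff_id.sub contDiff_const).norm_sq ℝ)
  have hθ' : ContDiff ℝ 1 (fun t => θ t + (t - tb) ^ 2) := hθ.add ((contDiff_id.sub contDiff_const).pow 2)
  have hdθ : deriv (fun t => θ t + (t - tb) ^ 2) tb = deriv θ tb := by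
    have h1 := (hθ.differentiable one_ne_zero tb).hasDerivAt
    have h2 : HasDerivAt (fun t : ℝ => (t - tb) ^ 2) _ tb := ((hasDerivAt_id tb).sub_const tb).pow 2
    have h3 : HasDerivAt (fun t : ℝ => θ t + (t - tb) ^ 2) _ tb := h1.add h2
    rw [h3.deriv]
    simp
  obtain ⟨C0, ρ0, hρ0, hloc⟩ := local_seq hN hΩ hfr hM hJ0 hJ1 hsub1 hsub2 hW1 hW2 hWM1 hWM2 hG1' hG2 hθ' hZ hxb hr
    (by linarith) (by linarith) hb (Lz := Lz) (by
      intro y hy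
      apply ContinuousLinearMap.opNorm_le_bound _ (by positivity)
      intro v
      rw [hsqd, Real.norm_eq_abs]
      have h1 := (fderiv ℝ G1 y).le_opNorm v
      have h2 := abs_real_inner_le_norm (y - xb) v
      have h3 := mul_le_mul_of_nonneg_right (hLG1 y (hcb hy)) (norm_nonneg v)
      have h4 : ‖y - xb‖ ≤ r := by simpa [dist_eq_norm] using hy
      have h5 : ‖y - xb‖ * ‖v‖ ≤ b / 8 * ‖v‖ := mul_le_mul_of_nonneg_right (h4.trans q4) (norm_nonneg v)
      rw [Real.norm_eq_abs] at h1
      calc _ ≤ |fderiv ℝ G1 y v| + |2 * ⟪y - xb, v⟫| := abs_add_le _ _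
        _ = |fderiv ℝ G1 y v| + 2 * |⟪y - xb, v⟫| := by rw [abs_mul]; norm_num
        _ ≤ _ := by linarith)
    (fun y hy => hLG2 y (hcb hy)) (fun y hy => hLz y (hcb hy))
    (fun x hx y hy => hLz' x (hcb (ball_subset_closedBall hx)) y (hcb (ball_subset_closedBall hy))) he
    (by
      intro x hx hxr t ht hne
      have h1 := hmax x hx t (by have := abs_le.1 ht; exact ⟨by linarith, by linarith⟩)
      have h2 : 0 < ‖x - xb‖ ^ 2 + (t - tb) ^ 2 := by
        by_cases hxx : x = xb
        · have : t - tb ≠ 0 := fun h => hne (by rw [hxx, sub_eq_zero.1 h])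
          positivity
        · have : 0 < ‖x - xb‖ := norm_pos_iff.2 (sub_ne_zero.2 hxx)
          positivity
      simp only [sub_self, norm_zero]
      linarith) hpos (κ₀ := κ₀ / 2) (by positivity) hCn (rn := min rn (κ₀ / 4)) (lt_min hrn (by positivity))
    (by
      intro x hx hxr
      obtain ⟨n1, n2⟩ := hneu1 x hx (hxr.trans_le (min_le_left _ _))
      refine ⟨?_, by linarith⟩
      rw [hsqd]
      have := abs_le.1 (abs_real_inner_le_norm (x - xb) (nn x))
      rw [hnn x hx, mul_one] at this
      have := hxr.trans_le (min_le_right _ _)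
      linarith)
    (fun x hx hxr y hy hyr => hneu2 x hx (hxr.trans_le (min_le_left _ _)) y hy (hyr.trans_le (min_le_left _ _)))
    hmis hD hfar
  have hlim : Tendsto (fun ρ : ℝ => C0 * ρ ^ (1 - σ)) (𝓝[>] 0) (𝓝 0) := by
    have h1 : Tendsto (fun ρ : ℝ => ρ ^ (1 - σ)) (𝓝 0) (𝓝 (0 ^ (1 - σ))) :=
      (Real.continuousAt_rpow_const 0 (1 - σ) (Or.inr (by linarith [hσ.2]))).tendsto
    rw [Real.zero_rpow (by linarith [hσ.2])] at h1
    simpa using (h1.const_mul C0).mono_left nhdsWithin_le_nhds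
  apply le_of_forall_pos_le_add
  intro ϑ hϑ
  obtain ⟨ρ, hρ1, hρ2, hρ3⟩ := ((hlim.eventually (gt_mem_nhds (show (0:ℝ) < ϑ / 3 by positivity))).and
    ((eventually_mem_nhdsWithin).and (mem_nhdsWithin_of_mem_nhds (Iic_mem_nhds hρ0)))).exists
  obtain ⟨ε, x, y, t, s, a1, a2, P1, P2, Q, hS, hS2⟩ := hloc ρ hρ2 hρ3
  obtain ⟨hS3, hS4⟩ := hS2 (hNC _ _ _ _ _ _ _ _ _ _ hS)
  obtain ⟨n, h1, h2, h3, h4⟩ := ((hS4 (ϑ / 3) (by positivity)).and ((hHD _ _ _ _ _ _ _ _ _ _ hS hS3 (ϑ / 3) (by positivity)).and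
    (hS.e1.and hS.e2))).exists
  rw [hdθ] at h1
  linarith

lemma cutoff_contDiff {xb : Euc N} {r : ℝ} (χ : ContDiffBump xb) (hr : χ.rOut < r) {f : Euc N → ℝ}
    (hf : ContDiffOn ℝ 1 f (ball xb r)) : ContDiff ℝ 1 (fun x => χ x * f x) := by
  rw [contDiff_iff_contDiffAt]
  intro x
  by_cases hx : x ∈ ball xb r
  · exact χ.contDiffAt.mul (hf.contDiffAt (isOpen_ball.mem_nhds hx))
  · have hx' : x ∈ (closedBall xb χ.rOut)ᶜ := by
      simp only [mem_ball, not_lt, mem_compl_iff, mem_closedBall, not_le] at *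
      linarith
    have : (fun x => χ x * f x) =ᶠ[𝓝 x] fun _ => 0 := by
      filter_upwards [isClosed_closedBall.isOpen_compl.mem_nhds hx'] with y hy
      have : χ y = 0 := χ.zero_of_le_dist (by simp only [mem_compl_iff, mem_closedBall, not_le] at hy; exact hy.le)
      simp [this]
    exact contDiffAt_const.congr_of_eventuallyEq this

def ZOK (Ω : Set (Euc N)) (j : Euc N → Euc N → Euc N) (nn : Euc N → Euc N) (Z : Euc N → Euc N) (xb : Euc N) : Prop :=
  ContDiff ℝ 1 Z ∧ (∃ Lz, ∃ r0 > (0:ℝ), (∀ y ∈ ball xb r0, ‖fderiv ℝ Z y‖ ≤ Lz) ∧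
    (∀ x ∈ ball xb r0, ∀ y ∈ ball xb r0, ‖fderiv ℝ Z x - fderiv ℝ Z y‖ ≤ Lz * ‖x - y‖)) ∧
  (∃ Cn ≥ (0:ℝ), ∃ rn > (0:ℝ), ∀ x ∈ frontier Ω, ‖x - xb‖ < rn → ∀ y ∈ closure Ω, ‖y - xb‖ < rn →
      -(Cn * ‖x - y‖ ^ 2) ≤ ⟪x - y, nn x⟫ ∧
      -(Cn * ‖x - y‖ * ‖Z x - Z y‖) ≤ ⟪Z x - Z y, fderiv ℝ Z x (nn x)⟫) ∧
  MisBound Ω j Z xb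

lemma frontier_far {Ω : Set (Euc N)} (hΩ : IsOpen Ω) {xb : Euc N} (hxb : xb ∈ Ω) :
    ∃ rn > (0:ℝ), ∀ x ∈ frontier Ω, ¬ ‖x - xb‖ < rn := by
  obtain ⟨r, hr, h⟩ := Metric.isOpen_iff.1 hΩ xb hxb
  refine ⟨r, hr, fun x hx hlt => ?_⟩
  have : x ∈ Ω := h (by simpa [dist_eq_norm] using hlt)
  rw [hΩ.frontier_eq] at hx
  exact hx.2 this

lemma zok_interior {Ω : Set (Euc N)} (hΩ : IsOpen Ω) {j : Euc N → Euc N → Euc N}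
    {Cj' Cj Dj : ℝ} (hJ1 : AssumptionJ1 Ω j Cj' Cj Dj) (nn : Euc N → Euc N) (Z : Euc N →L[ℝ] Euc N) {xb : Euc N}
    (hxb : xb ∈ Ω) : ZOK Ω j nn Z xb := by
  refine ⟨Z.contDiff, ⟨‖Z‖, 1, one_pos, ?_, ?_⟩, ?_, misBound_interior hΩ hJ1 _ hxb⟩
  · intro y _; simp
  · intro x _ y _; simp; positivity
  · obtain ⟨rn, hrn, h⟩ := frontier_far hΩ hxb
    exact ⟨0, le_rfl, rn, hrn, fun x hx hx' => absurd hx' (h x hx)⟩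

lemma normal_quad {hN : 0 < N} {Ω : Set (Euc N)} (hΩ : IsW2Domain hN Ω)
    {nn : Euc N → Euc N} (hn : IsExteriorNormal Ω nn) {xb : Euc N} (hxb : xb ∈ frontier Ω) :
    ∃ Cn ≥ (0:ℝ), ∃ rn > (0:ℝ), ∀ x ∈ frontier Ω, ‖x - xb‖ < rn → ∀ y ∈ closure Ω, ‖y - xb‖ < rn →
      -(Cn * ‖x - y‖ ^ 2) ≤ ⟪x - y, nn x⟫ := by
  obtain ⟨r, hr, L, hL, hd, hLip⟩ := sdist_regular hΩ hxb
  have hne : Ω.Nonempty := by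
    by_contra h
    rw [not_nonempty_iff_eq_empty] at h
    simp [h] at hxb
  refine ⟨L, hL.le, r, hr, fun x hx hxr y hy hyr => ?_⟩
  have h := taylor_quad hL.le (fun z hz => (hd.contDiffAt (isOpen_ball.mem_nhds hz)).differentiableAt one_ne_zero) hLip
    (show x ∈ ball xb r by simpa [dist_eq_norm] using hxr) (show y ∈ ball xb r by simpa [dist_eq_norm] using hyr)
  rw [fderiv_sdist_frontier hn hx, sdist_frontier hΩ.1 hx, Real.norm_eq_abs] at h
  have h1 := (mem_closure_iff_sdist hne y).1 hy
  have h2 := (abs_le.1 h).2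
  have h3 : ⟪x - y, nn x⟫ = - ⟪nn x, y - x⟫ := by rw [real_inner_comm, ← inner_neg_right, neg_sub]
  nlinarith [h3]

lemma zok_id_frontier {hN : 0 < N} {Ω : Set (Euc N)} (hΩ : IsW2Domain hN Ω)
    {nn : Euc N → Euc N} (hn : IsExteriorNormal Ω nn) {j : Euc N → Euc N → Euc N}
    {Aj : ℝ} (hJ0 : AssumptionJ0 Ω j Aj)
    {Cj' Cj Dj : ℝ} (hJ1 : AssumptionJ1 Ω j Cj' Cj Dj) {xb : Euc N}
    (hxb : xb ∈ frontier Ω) : ZOK Ω j nn (fun x => x) xb := by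
  refine ⟨contDiff_id, ⟨1, 1, one_pos, ?_, ?_⟩, ?_,
    misBound_frontier hΩ hn hJ0 hJ1 hxb _ one_pos two_pos (fun x _ y _ _ _ => sdist_lip Ω x y)⟩
  · intro y _
    rw [fderiv_fun_id]
    exact ContinuousLinearMap.norm_id_le
  · intro x _ y _; rw [fderiv_fun_id, fderiv_fun_id]; simp
  · obtain ⟨Cn, hCn, rn, hrn, h⟩ := normal_quad hΩ hn hxb
    refine ⟨Cn, hCn, rn, hrn, fun x hx hxr y hy hyr => ⟨h x hx hxr y hy hyr, ?_⟩⟩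
    have := h x hx hxr y hy hyr
    rw [fderiv_fun_id]
    simp only [ContinuousLinearMap.coe_id', id_eq]
    rw [mul_assoc, ← pow_two]
    exact this

lemma zok_id {hN : 0 < N} {Ω : Set (Euc N)} (hΩ : IsW2Domain hN Ω)
    {nn : Euc N → Euc N} (hn : IsExteriorNormal Ω nn) {j : Euc N → Euc N → Euc N}
    {Aj : ℝ} (hJ0 : AssumptionJ0 Ω j Aj)
    {Cj' Cj Dj : ℝ} (hJ1 : AssumptionJ1 Ω j Cj' Cj Dj) {xb : Euc N}
    (hxb : xb ∈ closure Ω) : ZOK Ω j nn (fun x => x) xb := by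
  by_cases h : xb ∈ Ω
  · exact zok_interior hΩ.1 hJ1 nn (ContinuousLinearMap.id ℝ (Euc N)) h
  · exact zok_id_frontier hΩ hn hJ0 hJ1 (by rw [hΩ.1.frontier_eq]; exact ⟨hxb, h⟩)

lemma zok_sdist {hN : 0 < N} {Ω : Set (Euc N)} (hΩ : IsW2Domain hN Ω)
    {nn : Euc N → Euc N} (hn : IsExteriorNormal Ω nn) {j : Euc N → Euc N → Euc N}
    {Aj : ℝ} (hJ0 : AssumptionJ0 Ω j Aj)
    {Cj' Cj Dj : ℝ} (hJ1 : AssumptionJ1 Ω j Cj' Cj Dj) {xb : Euc N}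
    (hxb : xb ∈ frontier Ω) : ∃ Z e0, ZOK Ω j nn Z xb ∧ ‖e0‖ = 1 ∧ ∃ r > (0:ℝ), ContDiffOn ℝ 1 (sdist Ω) (ball xb r) ∧
      ∀ x ∈ ball xb r, Z x = sdist Ω x • e0 ∧ ∀ h, fderiv ℝ Z x h = (fderiv ℝ (sdist Ω) x h) • e0 := by
  obtain ⟨r, hr, L, hL, hd, hLip⟩ := sdist_regular hΩ hxb
  have hne : Ω.Nonempty := by
    by_contra h
    rw [not_nonempty_iff_eq_empty] at h
    simp [h] at hxb
  let χ : ContDiffBump xb := ⟨r / 2, 3 * r / 4, by positivity, by linarith⟩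
  set e0 : Euc N := EuclideanSpace.single ⟨0, hN⟩ 1 with he0
  have hen : ‖e0‖ = 1 := by simp [he0]
  set Z : Euc N → Euc N := fun x => (χ x * sdist Ω x) • e0 with hZ
  have hZc : ContDiff ℝ 1 Z := (cutoff_contDiff χ (show 3 * r / 4 < r by linarith) hd).smul contDiff_const
  have hloc : ∀ x ∈ ball xb (r / 2), Z =ᶠ[𝓝 x] fun x => sdist Ω x • e0 := by
    intro x hx
    filter_upwards [isOpen_ball.mem_nhds hx] with y hy
    have : χ y = 1 := χ.one_of_mem_closedBall (ball_subset_closedBall hy)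
    simp [hZ, this]
  have hval : ∀ x ∈ ball xb (r / 2), Z x = sdist Ω x • e0 := fun x hx => (hloc x hx).self_of_nhds
  have hsub : ball xb (r / 2) ⊆ ball xb r := ball_subset_ball (by linarith)
  have hfd : ∀ x ∈ ball xb (r / 2), fderiv ℝ Z x = (fderiv ℝ (sdist Ω) x).smulRight e0 := by
    intro x hx
    rw [(hloc x hx).fderiv_eq]
    have h1 := ((hd.contDiffAt (isOpen_ball.mem_nhds (hsub hx))).differentiableAt one_ne_zero).hasFDerivAt
    exact (h1.smul_const e0).fderiv
  refine ⟨Z, e0, ⟨hZc, ⟨2 + L, r / 2, by positivity, ?_, ?_⟩, ?_, ?_⟩, hen, r / 2, by positivity, hd.mono hsub,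
    fun x hx => ⟨(hloc x hx).self_of_nhds, fun h => by rw [hfd x hx]; rfl⟩⟩
  · intro y hy
    rw [hfd y hy, ContinuousLinearMap.norm_smulRight_apply, hen, mul_one]
    linarith [norm_fderiv_sdist_le Ω y]
  · intro x hx y hy
    have : fderiv ℝ Z x - fderiv ℝ Z y = (fderiv ℝ (sdist Ω) x - fderiv ℝ (sdist Ω) y).smulRight e0 := by
      rw [hfd x hx, hfd y hy]; ext1 v; simp [sub_smul]
    rw [this, ContinuousLinearMap.norm_smulRight_apply, hen, mul_one]
    refine (hLip x (hsub hx) y (hsub hy)).trans ?_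
    nlinarith [norm_nonneg (x - y)]
  · obtain ⟨Cn, hCn, rn, hrn, h⟩ := normal_quad hΩ hn hxb
    refine ⟨Cn, hCn, min rn (r / 2), by positivity, fun x hx hxr y hy hyr =>
      ⟨h x hx (hxr.trans_le (min_le_left _ _)) y hy (hyr.trans_le (min_le_left _ _)), ?_⟩⟩
    have hx' : x ∈ ball xb (r / 2) := by simpa [dist_eq_norm] using hxr.trans_le (min_le_right _ _)
    have hy' : y ∈ ball xb (r / 2) := by simpa [dist_eq_norm] using hyr.trans_le (min_le_right _ _)
    rw [hval x hx', hval y hy', hfd x hx', ContinuousLinearMap.smulRight_apply,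
      fderiv_sdist_frontier hn hx, sdist_frontier hΩ.1 hx, ← sub_smul, inner_smul_left, inner_smul_right,
      real_inner_self_eq_norm_sq, real_inner_self_eq_norm_sq, hen, (hn x hx).1]
    have h1 := (mem_closure_iff_sdist hne y).1 hy
    have h2 : 0 ≤ Cn * ‖x - y‖ * ‖(0 - sdist Ω y) • e0‖ := by positivity
    simp at h2 ⊢
    linarith
  · refine misBound_frontier hΩ hn hJ0 hJ1 hxb _ (rZ := r / 2) (by positivity) one_pos (fun x _ y _ hx hy => ?_)
    have hx' : x ∈ ball xb (r / 2) := by simpa [dist_eq_norm] using hx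
    have hy' : y ∈ ball xb (r / 2) := by simpa [dist_eq_norm] using hy
    rw [hval x hx', hval y hy', ← sub_smul, norm_smul, hen, Real.norm_eq_abs]
    simp

def HC (Ω : Set (Euc N)) (j : Euc N → Euc N → Euc N) (nn : Euc N → Euc N) (F1 F2 : Euc N → ℝ → ℝ → Euc N → ℝ)
    (W1 W2 : Euc N → ℝ → ℝ) (T K σ b e₁ : ℝ) (xb : Euc N) (tb : ℝ) : Prop :=
  ∃ (Z : Euc N → Euc N) (e : ℝ), ZOK Ω j nn Z xb ∧ σ < e ∧ ∀ Cp, ∃ D : ℝ → ℝ, (∀ ε > 0, 0 < D ε) ∧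
    ∀ ε x y t s a1 a2 P1 P2 Q, SeqD Ω F1 F2 W1 W2 Z xb tb e Cp b T ε x y t s a1 a2 P1 P2 Q →
      (∀ᶠ n in atTop, ‖Q n‖ < 1 / (2 * ε n)) ∧
      ((∀ᶠ n in atTop, ‖Z (x n) - Z (y n)‖ ≤ D (ε n)) → ∀ ϑ > (0:ℝ), ∀ᶠ n in atTop,
      -(K * (W1 xb tb + W2 xb tb)) - e₁ - ϑ ≤ F1 (x n) (t n) (W1 (x n) (t n)) (P1 n) +
        F2 (y n) (s n) (W2 (y n) (s n)) (P2 n))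

lemma lc {hN : 0 < N} {Ω : Set (Euc N)} (hΩ : IsW2Domain hN Ω) {nn : Euc N → Euc N} (hn : IsExteriorNormal Ω nn)
    {g : Euc N → Euc N → ℝ} {Cμ Dμ σ : ℝ} (hM : AssumptionM Ω g Cμ Dμ σ)
    {j : Euc N → Euc N → Euc N} {Aj : ℝ} (hJ0 : AssumptionJ0 Ω j Aj)
    {Cj' Cj Dj : ℝ} (hJ1 : AssumptionJ1 Ω j Cj' Cj Dj) : ∃ CI > (0:ℝ), ∀ 
    {F1 F2 : Euc N → ℝ → ℝ → Euc N → ℝ} {W1 W2 : Euc N → ℝ → ℝ}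
    (_ : IsParSubSol Ω j g nn Cj (parF F1) W1) (_ : IsParSubSol Ω j g nn Cj (parF F2) W2)
    (_ : UpperSemicontinuousOn (fun q : Euc N × ℝ => W1 q.1 q.2) (closure Ω ×ˢ Ici 0))
    (_ : UpperSemicontinuousOn (fun q : Euc N × ℝ => W2 q.1 q.2) (closure Ω ×ˢ Ici 0))
    {M T : ℝ} (_ : ∀ y ∈ closure Ω, ∀ t ∈ Icc 0 T, |W1 y t| ≤ M)
    (_ : ∀ y ∈ closure Ω, ∀ t ∈ Icc 0 T, |W2 y t| ≤ M)
    {G1 G2 : Euc N → ℝ} (_ : ContDiff ℝ 1 G1) (_ : ContDiff ℝ 1 G2) {θ : ℝ → ℝ} (_ : ContDiff ℝ 1 θ)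
    {xb : Euc N} (_ : xb ∈ closure Ω) {tb b Γ K e₁ : ℝ}
    (_ : 0 < tb) (_ : tb < T) (_ : 0 < b)
    (_ : ∀ y, ‖fderiv ℝ G1 y‖ ≤ b / 4)
    (_ : ∀ y, ‖fderiv ℝ G2 y‖ ≤ b / 4)
    (_ : ∀ x ∈ closure Ω, ∀ t ∈ Icc 0 T,
      W1 x t + W2 x t - G1 x - G2 x - θ t ≤ W1 xb tb + W2 xb tb - G1 xb - G2 xb - θ tb)
    (_ : 0 < W1 xb tb + W2 xb tb) {κ₀ rn : ℝ} (_ : 0 < κ₀) (_ : 0 < rn)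
    (_ : ∀ x ∈ frontier Ω, ‖x - xb‖ < rn → κ₀ ≤ fderiv ℝ G1 x (nn x) ∧ κ₀ ≤ fderiv ℝ G2 x (nn x))
    (_ : 0 ≤ Γ)
    (_ : ∀ x, G1 x + G2 x - (G1 xb + G2 xb) ≤ Γ)
    (_ : HC Ω j nn F1 F2 W1 W2 T K σ b e₁ xb tb),
    deriv θ tb ≤ K * (W1 xb tb + W2 xb tb) + e₁ + CI * (Γ + b) := by
  obtain ⟨CI, hCI, hfar⟩ := far_limit hN hM.1 hJ0 hJ1
  refine ⟨CI, hCI, ?_⟩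
  intro F1 F2 W1 W2 hs1 hs2 hW1 hW2 M T hWM1 hWM2 G1 G2 hG1 hG2 θ hθ xb hxb tb b Γ K e₁ ht0 htT hb hb1 hb2 hmax hpos κ₀ rn
    hκ hrn hneu hΓ hinc ⟨Z, e, ⟨hZ, ⟨Lz, r0, hr0, hLz, hLz'⟩, ⟨Cn, hCn, rn', hrn', hneu2⟩, hmis⟩, he, hD⟩
  obtain ⟨D, hD0, hD⟩ := hD (1 + Lz)
  have htb : tb ∈ Icc 0 T := ⟨ht0.le, htT.le⟩
  have hG12 : ∀ x, G1 x + G2 x - (G1 xb + G2 xb) ≤ b * ‖x - xb‖ := by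
    intro x
    have k : ∀ G : Euc N → ℝ, ContDiff ℝ 1 G → (∀ y, ‖fderiv ℝ G y‖ ≤ b / 4) → G x - G xb ≤ b / 4 * ‖x - xb‖ := by
      intro G hG hb
      refine (le_abs_self _).trans ?_
      exact Convex.norm_image_sub_le_of_norm_fderiv_le (fun x _ => (hG.differentiable one_ne_zero x)) (fun x _ => hb x)
        convex_univ (mem_univ _) (mem_univ _)
    have k1 := k G1 hG1 hb1
    have k2 := k G2 hG2 hb2
    have := mul_nonneg hb.le (norm_nonneg (x - xb))
    linarith
  refine local_core hN hΩ.1 (frontier_null hΩ hn) hM hJ0 hJ1 (fun x hx => (hn x hx).1) hs1 hs2 hW1 hW2 hWM1 hWM2 hG1 hG2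
    hθ hZ hxb hr0 ht0 htT hb (fun y _ => hb1 y) (fun y _ => hb2 y) hLz hLz' he hmax hpos hκ hCn (rn := min rn rn') (by positivity)
    (fun x hx hxr => hneu x hx (hxr.trans_le (min_le_left _ _)))
    (fun x hx hxr y hy hyr => hneu2 x hx (hxr.trans_le (min_le_right _ _)) y hy (hyr.trans_le (min_le_right _ _)))
    hmis hD0 ?_ (fun ε x y t s a1 a2 P1 P2 Q h => (hD ε x y t s a1 a2 P1 P2 Q h).1)
    (fun ε x y t s a1 a2 P1 P2 Q h => (hD ε x y t s a1 a2 P1 P2 Q h).2)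
  intro ρ hρ
  refine hfar hW1 hW2 hWM1 hWM2 hxb htb (by positivity) (fun x hx => ?_) (fun x hx => ?_) hρ
  · have := hmax x hx tb htb
    have := hinc x
    linarith
  · have := hmax x hx tb htb
    have := hG12 x
    have := mul_nonneg hΓ (norm_nonneg (x - xb))
    linarith

lemma attain {Ω : Set (Euc N)} {m : Euc N → ℝ → ℝ} {T : ℝ}
    (husc : UpperSemicontinuousOn (fun q : Euc N × ℝ => m q.1 q.2) (closure Ω ×ˢ Icc 0 T))
    {P : Euc N → ℝ} (hP : Continuous P) {x1 : Euc N} {t1 : ℝ} (hx1 : x1 ∈ closure Ω) (ht1 : t1 ∈ Icc 0 T)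
    {R : ℝ} (hR : 0 ≤ R)
    (h : ∀ x ∈ closure Ω, R < ‖x - x1‖ → ∀ t ∈ Icc 0 T, m x t - P x ≤ m x1 t1 - P x1) :
    ∃ xb ∈ closure Ω, ∃ tb ∈ Icc 0 T, ‖xb - x1‖ ≤ R ∧ ∀ x ∈ closure Ω, ∀ t ∈ Icc 0 T, m x t - P x ≤ m xb tb - P xb := by
  set S : Set (Euc N × ℝ) := (closure Ω ∩ closedBall x1 R) ×ˢ Icc 0 T with hS
  have hc : IsCompact S := ((isCompact_closedBall x1 R).inter_left isClosed_closure).prod isCompact_Icc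
  have hne : S.Nonempty := ⟨(x1, t1), ⟨hx1, mem_closedBall_self hR⟩, ht1⟩
  have hu : UpperSemicontinuousOn (fun q : Euc N × ℝ => m q.1 q.2 + (- P q.1)) S := by
    apply UpperSemicontinuousOn.add
    · exact husc.mono (prod_mono inter_subset_left le_rfl)
    · exact ((hP.comp continuous_fst).neg).continuousOn.upperSemicontinuousOn
  obtain ⟨⟨xb, tb⟩, ⟨⟨hxb, hxr⟩, htb⟩, hmax⟩ := hu.exists_isMaxOn hne hc
  simp only at hxb hxr htb
  have key : ∀ x ∈ closure Ω, ‖x - x1‖ ≤ R → ∀ t ∈ Icc 0 T, m x t - P x ≤ m xb tb - P xb := by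
    intro x hx hxR t ht
    have := hmax (show (x, t) ∈ S from ⟨⟨hx, by simpa [dist_eq_norm] using hxR⟩, ht⟩)
    change m x t + - P x ≤ m xb tb + - P xb at this
    linarith
  refine ⟨xb, hxb, tb, htb, by simpa [dist_eq_norm] using hxr, fun x hx t ht => ?_⟩
  by_cases hxR : ‖x - x1‖ ≤ R
  · exact key x hx hxR t ht
  · exact (h x hx (not_le.1 hxR) t ht).trans (key x1 hx1 (by simpa using hR) t1 ht1)

def Bf (c x : Euc N) : ℝ := ‖x - c‖ ^ 2 / (1 + ‖x - c‖ ^ 2)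

lemma Bf_self (c : Euc N) : Bf c c = 0 := by simp [Bf]
lemma Bf_nonneg (c x : Euc N) : 0 ≤ Bf c x := by unfold Bf; positivity
lemma Bf_le_one (c x : Euc N) : Bf c x ≤ 1 := by
  unfold Bf; rw [div_le_one (by positivity)]; linarith
lemma Bf_ge {ρ : ℝ} (hρ : 0 ≤ ρ) {c x : Euc N} (h : ρ ≤ ‖x - c‖) : ρ ^ 2 / (1 + ρ ^ 2) ≤ Bf c x := by
  unfold Bf
  have : ρ ^ 2 ≤ ‖x - c‖ ^ 2 := by gcongr
  rw [div_le_div_iff₀ (by positivity) (by positivity)]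
  nlinarith
lemma Bf_contDiff (c : Euc N) : ContDiff ℝ 1 (Bf c) := by
  unfold Bf
  have h : ContDiff ℝ 1 (fun x : Euc N => ‖x - c‖ ^ 2) := (contDiff_id.sub contDiff_const).norm_sq ℝ
  exact h.div (contDiff_const.add h) (fun x => by positivity)
lemma Bf_fderiv (c x : Euc N) : ‖fderiv ℝ (Bf c) x‖ ≤ 1 := by
  have h1 : HasFDerivAt (fun x : Euc N => ‖x - c‖ ^ 2) (2 • (innerSL ℝ (x - c))) x := by
    have := ((hasFDerivAt_id x).sub_const c).norm_sq
    simpa using this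
  have h2 : HasDerivAt (fun s : ℝ => s / (1 + s)) (1 / (1 + ‖x - c‖ ^ 2) ^ 2) (‖x - c‖ ^ 2) := by
    have := (hasDerivAt_id (‖x - c‖ ^ 2)).div ((hasDerivAt_id (‖x - c‖ ^ 2)).const_add 1) (by simp only [id_eq]; positivity)
    refine this.congr_deriv ?_
    simp only [id_eq]; ring
  have h3' := HasDerivAt.comp_hasFDerivAt x h2 h1
  have h3 : HasFDerivAt (Bf c) ((1 / (1 + ‖x - c‖ ^ 2) ^ 2) • 2 • (innerSL ℝ (x - c))) x := h3'
  rw [h3.fderiv, norm_smul, Real.norm_of_nonneg (by positivity), two_nsmul, ← two_smul ℝ, norm_smul, innerSL_apply_norm]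
  simp only [Real.norm_ofNat]
  set s := ‖x - c‖
  have hs : 0 ≤ s := norm_nonneg _
  rw [one_div, inv_mul_le_iff₀ (by positivity)]
  nlinarith [sq_nonneg (s - 1), sq_nonneg (s ^ 2)]

lemma kfun {hN : 0 < N} {Ω : Set (Euc N)} (hΩ : IsW2Domain hN Ω) {nn : Euc N → Euc N} (hn : IsExteriorNormal Ω nn)
    {xb : Euc N} (hxb : xb ∈ frontier Ω) : ∃ r > (0:ℝ), ∀ τ₀ > (0:ℝ), ∃ k : Euc N → ℝ, ContDiff ℝ 1 k ∧
      (∀ x, |k x| ≤ τ₀) ∧ (∀ x, ‖fderiv ℝ k x‖ ≤ 3) ∧ k xb = 0 ∧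
      ∀ x ∈ frontier Ω, ‖x - xb‖ < r → fderiv ℝ k x (nn x) = 1 := by
  obtain ⟨r, hr, L, hL, hd, hLip⟩ := sdist_regular hΩ hxb
  let χ : ContDiffBump xb := ⟨r / 2, 3 * r / 4, by positivity, by linarith⟩
  have hχo : χ.rOut < r := show 3 * r / 4 < r by linarith
  have hχ1 : ContDiff ℝ 1 χ := χ.contDiff
  obtain ⟨Cχ, hCχ⟩ := (χ.hasCompactSupport.fderiv ℝ).exists_bound_of_continuous (hχ1.continuous_fderiv one_ne_zero)
  have hCχ0 : 0 ≤ Cχ := (norm_nonneg _).trans (hCχ xb)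
  refine ⟨r / 2, by positivity, fun τ₀ hτ₀ => ?_⟩
  set τ := min τ₀ (1 / (Cχ + 1)) with hτ
  have hτ0 : 0 < τ := by positivity
  have hτC : τ * Cχ ≤ 1 := by
    have : τ ≤ 1 / (Cχ + 1) := min_le_right _ _
    rw [le_div_iff₀ (by positivity)] at this
    nlinarith
  set f : Euc N → ℝ := fun x => -τ * Real.sin (sdist Ω x / τ) with hf
  have hfd : ContDiffOn ℝ 1 f (ball xb r) := contDiffOn_const.mul ((hd.div_const τ).sin)
  have hfb : ∀ x, |f x| ≤ τ := by
    intro x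
    simp only [hf, abs_mul, abs_neg, abs_of_pos hτ0]
    have := Real.abs_sin_le_one (sdist Ω x / τ)
    nlinarith
  have hff : ∀ x ∈ ball xb r, HasFDerivAt f (-Real.cos (sdist Ω x / τ) • fderiv ℝ (sdist Ω) x) x := by
    intro x hx
    have h1 := ((hd.contDiffAt (isOpen_ball.mem_nhds hx)).differentiableAt one_ne_zero).hasFDerivAt
    have h2 : HasFDerivAt (fun x => sdist Ω x / τ) (τ⁻¹ • fderiv ℝ (sdist Ω) x) x := by
      have h : HasFDerivAt (fun x => τ⁻¹ * sdist Ω x) (τ⁻¹ • fderiv ℝ (sdist Ω) x) x := h1.const_mul τ⁻¹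
      simpa [div_eq_inv_mul] using h
    have h3 := h2.sin.const_mul (-τ)
    refine h3.congr_fderiv ?_
    rw [smul_smul, smul_smul]
    congr 1
    field_simp
  have hkd : ∀ x ∈ ball xb r, HasFDerivAt (fun x => χ x * f x)
      (χ x • (-Real.cos (sdist Ω x / τ) • fderiv ℝ (sdist Ω) x) + f x • fderiv ℝ χ x) x := by
    intro x hx
    exact (hχ1.differentiable one_ne_zero x).hasFDerivAt.mul (hff x hx)
  refine ⟨fun x => χ x * f x, cutoff_contDiff χ hχo hfd, fun x => ?_, fun x => ?_, ?_, fun x hx hxr => ?_⟩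
  · rw [abs_mul, abs_of_nonneg χ.nonneg]
    have h1 := χ.le_one (x := x)
    have h2 := hfb x
    have h3 : τ ≤ τ₀ := min_le_left _ _
    have := mul_le_mul h1 h2 (abs_nonneg _) zero_le_one
    linarith
  · by_cases hx : x ∈ ball xb r
    · rw [(hkd x hx).fderiv]
      refine (norm_add_le _ _).trans ?_
      rw [norm_smul, norm_smul, norm_smul, Real.norm_eq_abs, Real.norm_eq_abs, Real.norm_eq_abs, abs_neg, abs_of_nonneg χ.nonneg]
      have h1 := χ.le_one (x := x)
      have h2 := hfb x
      have h3 := Real.abs_cos_le_one (sdist Ω x / τ)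
      have h4 := norm_fderiv_sdist_le Ω x
      have h5 := hCχ x
      have h6 : χ x * (|Real.cos (sdist Ω x / τ)| * ‖fderiv ℝ (sdist Ω) x‖) ≤ 1 * (1 * 2) :=
        mul_le_mul h1 (mul_le_mul h3 h4 (norm_nonneg _) zero_le_one) (by positivity) zero_le_one
      have h7 := mul_le_mul h2 h5 (norm_nonneg _) hτ0.le
      linarith
    · have hx' : x ∈ (closedBall xb χ.rOut)ᶜ := by
        simp only [mem_ball, not_lt, mem_compl_iff, mem_closedBall, not_le] at *
        linarith
      have : (fun x => χ x * f x) =ᶠ[𝓝 x] fun _ => 0 := by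
        filter_upwards [isClosed_closedBall.isOpen_compl.mem_nhds hx'] with y hy
        have : χ y = 0 := χ.zero_of_le_dist (by simp only [mem_compl_iff, mem_closedBall, not_le] at hy; exact hy.le)
        simp [this]
      rw [this.fderiv_eq]
      simp
  · simp [hf, sdist_frontier hΩ.1 hxb]
  · have hx' : x ∈ ball xb (r / 2) := by simpa [dist_eq_norm] using hxr
    have hx2 : x ∈ ball xb r := ball_subset_ball (by linarith) hx'
    rw [(hkd x hx2).fderiv]
    have h1 : χ x = 1 := χ.one_of_mem_closedBall (ball_subset_closedBall hx')
    have h2 : f x = 0 := by simp [hf, sdist_frontier hΩ.1 hx]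
    rw [h1, h2, sdist_frontier hΩ.1 hx]
    simp [fderiv_sdist_frontier hn hx, (hn x hx).1]

lemma global_stage {hN : 0 < N} {Ω : Set (Euc N)} (hΩ : IsW2Domain hN Ω) {nn : Euc N → Euc N} (hn : IsExteriorNormal Ω nn)
    {g : Euc N → Euc N → ℝ} {Cμ Dμ σ : ℝ} (hM : AssumptionM Ω g Cμ Dμ σ)
    {j : Euc N → Euc N → Euc N} {Aj : ℝ} (hJ0 : AssumptionJ0 Ω j Aj)
    {Cj' Cj Dj : ℝ} (hJ1 : AssumptionJ1 Ω j Cj' Cj Dj) : ∃ CI > (0:ℝ), ∀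
    {F1 F2 : Euc N → ℝ → ℝ → Euc N → ℝ} {W1 W2 : Euc N → ℝ → ℝ}
    (_ : IsParSubSol Ω j g nn Cj (parF F1) W1) (_ : IsParSubSol Ω j g nn Cj (parF F2) W2)
    (_ : UpperSemicontinuousOn (fun q : Euc N × ℝ => W1 q.1 q.2) (closure Ω ×ˢ Ici 0))
    (_ : UpperSemicontinuousOn (fun q : Euc N × ℝ => W2 q.1 q.2) (closure Ω ×ˢ Ici 0))
    {M T : ℝ} (_ : ∀ y ∈ closure Ω, ∀ t ∈ Icc 0 T, |W1 y t| ≤ M)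
    (_ : ∀ y ∈ closure Ω, ∀ t ∈ Icc 0 T, |W2 y t| ≤ M)
    {θ : ℝ → ℝ} (_ : ContDiff ℝ 1 θ) (_ : ∀ t, 0 ≤ θ t)
    (_ : ∀ x ∈ closure Ω, ∀ t ∈ Icc 0 T, 0 < W1 x t + W2 x t - θ t → t ∈ Ioo 0 T)
    {β η K e₁ : ℝ} {x0 : Euc N} {t0 : ℝ} (_ : x0 ∈ closure Ω) (_ : t0 ∈ Icc 0 T)
    (_ : η ≤ W1 x0 t0 + W2 x0 t0 - θ t0) (_ : 0 < β) (_ : β ≤ η / 10)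
    (_ : ∀ xb ∈ closure Ω, ∀ tb ∈ Ioo 0 T, 0 < W1 xb tb + W2 xb tb → HC Ω j nn F1 F2 W1 W2 T K σ (44 * β) e₁ xb tb),
    ∃ xb ∈ closure Ω, ∃ tb ∈ Ioo 0 T, 0 < W1 xb tb + W2 xb tb - θ tb ∧
      deriv θ tb ≤ K * (W1 xb tb + W2 xb tb) + e₁ + CI * β := by
  obtain ⟨CI, hCI, hlc⟩ := lc hΩ hn hM hJ0 hJ1
  refine ⟨CI * 47, by positivity, ?_⟩
  intro F1 F2 W1 W2 hs1 hs2 hW1 hW2 M T hWM1 hWM2 θ hθ hθ0 hIoo β η K e₁ x0 t0 hx0 ht0 hη hβ hβη hHC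
  set m : Euc N → ℝ → ℝ := fun x t => W1 x t + W2 x t - θ t with hm
  have husc : UpperSemicontinuousOn (fun q : Euc N × ℝ => m q.1 q.2) (closure Ω ×ˢ Icc 0 T) := by
    have hs : closure Ω ×ˢ Icc 0 T ⊆ closure Ω ×ˢ Ici 0 := prod_mono le_rfl Icc_subset_Ici_self
    have h3 : UpperSemicontinuousOn (fun q : Euc N × ℝ => - θ q.2) (closure Ω ×ˢ Icc 0 T) :=
      ((hθ.continuous.comp continuous_snd).neg).continuousOn.upperSemicontinuousOn
    have h4 := ((hW1.mono hs).add (hW2.mono hs)).add h3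
    simpa [hm, sub_eq_add_neg] using h4
  -- near maximum
  set V : Set ℝ := {a | ∃ x ∈ closure Ω, ∃ t ∈ Icc 0 T, a = m x t} with hV
  have hVb : BddAbove V := by
    refine ⟨M + M, ?_⟩
    rintro a ⟨x, hx, t, ht, rfl⟩
    have := (abs_le.1 (hWM1 x hx t ht)).2
    have := (abs_le.1 (hWM2 x hx t ht)).2
    have := hθ0 t
    simp only [hm]
    linarith
  have hVn : V.Nonempty := ⟨_, x0, hx0, t0, ht0, rfl⟩
  have hS : ∀ x ∈ closure Ω, ∀ t ∈ Icc 0 T, m x t ≤ sSup V := fun x hx t ht => le_csSup hVb ⟨x, hx, t, ht, rfl⟩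
  obtain ⟨_, ⟨x1, hx1, t1, ht1, rfl⟩, hlt⟩ := exists_lt_of_lt_csSup hVn (show sSup V - β / 4 < sSup V by linarith)
  have hη1 : η - β / 4 < m x1 t1 := by linarith [hS x0 hx0 t0 ht0]
  have hA : ∀ x ∈ closure Ω, 1 < ‖x - x1‖ → ∀ t ∈ Icc 0 T, m x t - β * Bf x1 x ≤ m x1 t1 - β * Bf x1 x1 := by
    intro x hx hx1 t ht
    have h1 := hS x hx t ht
    have h2 := Bf_ge zero_le_one hx1.le
    rw [Bf_self]
    norm_num at h2
    nlinarith
  have hBc : ∀ c : Euc N, ContDiff ℝ 1 (fun x => β * Bf c x) := fun c => contDiff_const.mul (Bf_contDiff c)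
  have hBd : ∀ c x : Euc N, HasFDerivAt (fun x => β * Bf c x) (β • fderiv ℝ (Bf c) x) x := fun c x =>
    ((Bf_contDiff c).differentiable one_ne_zero x).hasFDerivAt.const_mul β
  have hBn : ∀ c x : Euc N, ‖β • fderiv ℝ (Bf c) x‖ ≤ β := by
    intro c x
    rw [norm_smul, Real.norm_of_nonneg hβ.le]
    have := Bf_fderiv c x
    nlinarith
  obtain ⟨y1, hy1, s1, hs1', hyx, hmax1⟩ := attain husc (hBc x1).continuous hx1 ht1 zero_le_one hA
  have hm1 : η - β / 4 < m y1 s1 := by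
    have h1 := hmax1 x1 hx1 t1 ht1
    rw [Bf_self] at h1
    have := Bf_nonneg x1 y1
    nlinarith
  by_cases hy1Ω : y1 ∈ Ω
  · have hp : 0 < m y1 s1 := by linarith
    have hIo := hIoo y1 hy1 s1 hs1' hp
    have hp' : 0 < W1 y1 s1 + W2 y1 s1 := by have := hθ0 s1; simp only [hm] at hp; linarith
    refine ⟨y1, hy1, s1, hIo, hp, ?_⟩
    obtain ⟨rn, hrn, hfar⟩ := frontier_far hΩ.1 hy1Ω
    have := hlc hs1 hs2 hW1 hW2 hWM1 hWM2 (hBc x1) (contDiff_const (c := (0:ℝ))) hθ hy1 hIo.1 hIo.2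
      (b := 44 * β) (by positivity) (fun y => by rw [(hBd x1 y).fderiv]; linarith [hBn x1 y])
      (fun y => by simp; positivity) (fun x hx t ht => by
        have := hmax1 x hx t ht
        simp only [hm] at this
        linarith) hp' one_pos hrn (fun x hx hxr => absurd hxr (hfar x hx)) (Γ := 3 * β) (by positivity)
        (fun x => by
          have h1 := Bf_le_one x1 x
          have h2 := Bf_nonneg x1 y1
          nlinarith) (hHC y1 hy1 s1 hIo hp')
    linarith
  · have hy1f : y1 ∈ frontier Ω := by rw [hΩ.1.frontier_eq]; exact ⟨hy1, hy1Ω⟩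
    obtain ⟨r, hr, hk⟩ := kfun hΩ hn hy1f
    have hB0 : 0 < (r / 2) ^ 2 / (1 + (r / 2) ^ 2) := by positivity
    obtain ⟨k, hkc, hkτ, hk3, hk0, hkn⟩ := hk (min (1 / 12) ((r / 2) ^ 2 / (1 + (r / 2) ^ 2) / 6)) (by positivity)
    have hk1 : ∀ x, |k x| ≤ 1 / 12 := fun x => (hkτ x).trans (min_le_left _ _)
    have hk2 : ∀ x, |k x| ≤ (r / 2) ^ 2 / (1 + (r / 2) ^ 2) / 6 := fun x => (hkτ x).trans (min_le_right _ _)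
    have hG2c : ContDiff ℝ 1 (fun x => 3 * β * k x) := contDiff_const.mul hkc
    have hG1c : ContDiff ℝ 1 (fun x => β * Bf x1 x + β * Bf y1 x + 3 * β * k x) := ((hBc x1).add (hBc y1)).add hG2c
    have hG2d : ∀ x : Euc N, HasFDerivAt (fun x => 3 * β * k x) ((3 * β) • fderiv ℝ k x) x := fun x =>
      (hkc.differentiable one_ne_zero x).hasFDerivAt.const_mul (3 * β)
    have hG1d : ∀ x : Euc N, HasFDerivAt (fun x => β * Bf x1 x + β * Bf y1 x + 3 * β * k x)
      (β • fderiv ℝ (Bf x1) x + β • fderiv ℝ (Bf y1) x + (3 * β) • fderiv ℝ k x) x := fun x =>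
      ((hBd x1 x).add (hBd y1 x)).add (hG2d x)
    have hG2n : ∀ x, ‖(3 * β) • fderiv ℝ k x‖ ≤ 9 * β := by
      intro x
      rw [norm_smul, Real.norm_of_nonneg (by positivity)]
      have := hk3 x
      nlinarith
    have hG12 : ContDiff ℝ 1 (fun x => (β * Bf x1 x + β * Bf y1 x + 3 * β * k x) + 3 * β * k x) := hG1c.add hG2c
    obtain ⟨xb, hxb, tb, htb, hxy, hmax⟩ := attain husc hG12.continuous hy1 hs1' (R := r / 2) (by positivity) (by
      intro x hx hxr t ht
      have h1 := hmax1 x hx t ht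
      have h2 := Bf_ge (by positivity) hxr.le
      have h3 := (abs_le.1 (hk2 x)).1
      rw [Bf_self, hk0]
      nlinarith)
    have hmx : ∀ x ∈ closure Ω, ∀ t ∈ Icc 0 T, W1 x t + W2 x t - (β * Bf x1 x + β * Bf y1 x + 3 * β * k x) - 3 * β * k x - θ t
        ≤ W1 xb tb + W2 xb tb - (β * Bf x1 xb + β * Bf y1 xb + 3 * β * k xb) - 3 * β * k xb - θ tb := by
      intro x hx t ht
      have := hmax x hx t ht
      simp only [hm] at this
      linarith
    have hp : 0 < m xb tb := by
      have h1 := hmx y1 hy1 s1 hs1'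
      rw [Bf_self, hk0] at h1
      have h2 := Bf_le_one x1 y1
      have h3 := Bf_nonneg x1 xb
      have h4 := Bf_nonneg y1 xb
      have h5 := (abs_le.1 (hk1 xb)).1
      have h6 : -(β * (1/12)) ≤ β * k xb := by nlinarith
      have h7 : 0 ≤ β * Bf x1 xb := by positivity
      have h8 : 0 ≤ β * Bf y1 xb := by positivity
      have h9 : β * Bf x1 y1 ≤ β := by nlinarith
      simp only [hm] at hm1 ⊢
      linarith
    have hIo := hIoo xb hxb tb htb hp
    have hp' : 0 < W1 xb tb + W2 xb tb := by have := hθ0 tb; simp only [hm] at hp; linarith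
    refine ⟨xb, hxb, tb, hIo, hp, ?_⟩
    have := hlc hs1 hs2 hW1 hW2 hWM1 hWM2 hG1c hG2c hθ hxb hIo.1 hIo.2
      (b := 44 * β) (by positivity) (fun y => by
        rw [(hG1d y).fderiv]
        refine (norm_add_le _ _).trans ((add_le_add (norm_add_le _ _) le_rfl).trans ?_)
        linarith [hBn x1 y, hBn y1 y, hG2n y])
      (fun y => by rw [(hG2d y).fderiv]; linarith [hG2n y]) hmx hp' hβ (rn := r / 2) (by positivity)
      (fun x hx hxr => by
        have hxr' : ‖x - y1‖ < r := by
          have : x - y1 = (x - xb) + (xb - y1) := by abel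
          rw [this]
          linarith [norm_add_le (x - xb) (xb - y1)]
        have h1 := hkn x hx hxr'
        have hc : ∀ c, -β ≤ (β • fderiv ℝ (Bf c) x) (nn x) := by
          intro c
          have h := (β • fderiv ℝ (Bf c) x).le_opNorm (nn x)
          rw [(hn x hx).1, mul_one, Real.norm_eq_abs] at h
          linarith [(abs_le.1 h).1, hBn c x]
        have c1 := hc x1
        have c2 := hc y1
        rw [(hG1d x).fderiv, (hG2d x).fderiv]
        simp only [add_apply, _root_.smul_apply, smul_eq_mul] at c1 c2 ⊢
        rw [h1]
        constructor <;> linarith)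
      (Γ := 3 * β) (by positivity)
      (fun x => by
        have h1 := Bf_le_one x1 x
        have h2 := Bf_nonneg x1 xb
        have h3 := Bf_le_one y1 x
        have h4 := Bf_nonneg y1 xb
        have h5 := (abs_le.1 (hk1 xb)).1
        have h6 := (abs_le.1 (hk1 x)).2
        nlinarith) (hHC xb hxb tb hIo hp')
    linarith

lemma modulus_small {ω : ℝ → ℝ} (hω : IsModulus ω) {η : ℝ} (hη : 0 < η) : ∃ δ > (0:ℝ), ω δ < η := by
  have h := hω.2.2.eventually (gt_mem_nhds hη)
  obtain ⟨δ, h1, h2⟩ := (h.and self_mem_nhdsWithin).exists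
  exact ⟨δ, h2, h1⟩

lemma hc_coercive {hN : 0 < N} {Ω : Set (Euc N)} (hΩ : IsW2Domain hN Ω) {nn : Euc N → Euc N} (hn : IsExteriorNormal Ω nn)
    {j : Euc N → Euc N → Euc N} {Aj : ℝ} (hJ0 : AssumptionJ0 Ω j Aj)
    {Cj' Cj Dj : ℝ} (hJ1 : AssumptionJ1 Ω j Cj' Cj Dj)
    {F1 F2 : Euc N → ℝ → ℝ → Euc N → ℝ} {W1 W2 : Euc N → ℝ → ℝ} {T K b e₁ σ : ℝ} {xb : Euc N} (hxb : xb ∈ closure Ω) {tb : ℝ}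
    {m c₀ Dc : ℝ} (hσ : 0 < σ) (hm : σ < m) (hc₀ : 0 < c₀)
    (hcoer : ∀ x ∈ closure Ω, ∀ t ∈ Icc 0 T, ∀ p, c₀ * ‖p‖ ^ m - Dc ≤ F1 x t (W1 x t) p)
    {f : Euc N → ℝ → ℝ} (hf : UniformContinuous (fun q : Euc N × ℝ => f q.1 q.2)) {ω₁ : ℝ → ℝ} (hω : IsModulus ω₁)
    {G : ℝ → ℝ} (hG0 : ∀ a, 0 ≤ a → 0 ≤ G a) (hGm : ∀ a c, 0 ≤ a → a ≤ c → G a ≤ G c)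
    (hF : ∀ x ∈ closure Ω, ∀ y ∈ closure Ω, ∀ t ∈ Icc 0 T, ∀ s ∈ Icc 0 T, ∀ p q : Euc N, ‖p + q‖ ≤ b →
      0 ≤ W1 x t + W2 y s → -(K * (W1 x t + W2 y s)) - e₁ - ω₁ ‖x - y‖ * G (max ‖p‖ ‖q‖) - |f y t - f y s| ≤
        F1 x t (W1 x t) p + F2 y s (W2 y s) q) : HC Ω j nn F1 F2 W1 W2 T K σ b e₁ xb tb := by
  have hm0 : 0 < m := hσ.trans hm
  refine ⟨fun x => x, m, zok_id hΩ hn hJ0 hJ1 hxb, hm, fun Cp => ?_⟩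
  have hDex : ∀ ε : ℝ, ∃ δ : ℝ, 0 < ε → 0 < δ ∧ ω₁ δ * G (|Cp| / ε) ≤ ε := by
    intro ε
    by_cases hε : 0 < ε
    · have hG := hG0 (|Cp| / ε) (by positivity)
      obtain ⟨δ, hδ, h⟩ := modulus_small hω (show 0 < ε / (G (|Cp| / ε) + 1) by positivity)
      refine ⟨δ, fun _ => ⟨hδ, ?_⟩⟩
      rw [lt_div_iff₀ (by positivity)] at h
      have := hω.1 δ
      nlinarith
    · exact ⟨0, fun h => absurd h hε⟩
  choose D hD using hDex
  refine ⟨D, fun ε hε => (hD ε hε).1, ?_⟩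
  intro ε x y t s a1 a2 P1 P2 Q S
  refine ⟨?_, ?_⟩
  · have h4 : (0:ℝ) < (1/4) ^ m := by positivity
    have hεm : Tendsto (fun n => ε n ^ m * Dc) atTop (𝓝 0) := by
      have := (S.εt.rpow_const (p := m) (Or.inr hm0.le)).mul_const Dc
      simpa [Real.zero_rpow hm0.ne'] using this
    filter_upwards [S.e1, S.tm, S.l1 (c₀ * (1/4) ^ m / 4) (by positivity), S.p1 (1/8) (by norm_num),
      hεm.eventually (gt_mem_nhds (show 0 < c₀ * (1/4) ^ m / 4 by positivity))] with n h1 h2 h3 h5 h6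
    have hε := S.ε0 n
    have h7 := hcoer (x n) (S.xm n) (t n) h2 (P1 n)
    have h8 : ε n ^ m * (c₀ * ‖P1 n‖ ^ m - Dc) ≤ ε n ^ m * (- a1 n) :=
      mul_le_mul_of_nonneg_left (by linarith) (by positivity)
    have h9 : (ε n * ‖P1 n‖) ^ m = ε n ^ m * ‖P1 n‖ ^ m := Real.mul_rpow hε.le (norm_nonneg _)
    have h10 : c₀ * (ε n * ‖P1 n‖) ^ m < c₀ * (1/4) ^ m := by
      rw [h9]; nlinarith
    have h11 : ε n * ‖P1 n‖ < 1/4 := by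
      rw [← Real.rpow_lt_rpow_iff (by positivity) (by norm_num) hm0]
      exact lt_of_mul_lt_mul_left h10 hc₀.le
    have h12 : ‖Q n - P1 n‖ ≤ 1/8 / ε n := by
      apply norm_le_of_inner (by positivity)
      intro v
      have := (abs_le.1 (h5 v)).1
      rw [fderiv_fun_id] at this
      simp only [ContinuousLinearMap.coe_id', id_eq] at this
      rw [inner_sub_left]; linarith
    have h13 : ‖Q n‖ ≤ ‖P1 n‖ + 1/8 / ε n := by
      have : Q n = P1 n + (Q n - P1 n) := by abel
      rw [this]
      exact (norm_add_le _ _).trans (by simpa using h12)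
    rw [lt_div_iff₀ (by positivity)]
    have h14 : 1/8 / ε n * ε n = 1/8 := by field_simp
    nlinarith
  · intro hDn ϑ hϑ
    have hfts : Tendsto (fun n => |f (y n) (t n) - f (y n) (s n)|) atTop (𝓝 0) := by
      rw [Metric.tendsto_atTop]
      intro η hη
      obtain ⟨δ, hδ, h⟩ := Metric.uniformContinuous_iff.1 hf η hη
      have h2 := (S.tt.sub S.st).eventually (Metric.ball_mem_nhds _ hδ)
      rw [eventually_atTop] at h2
      obtain ⟨n0, hn0⟩ := h2
      refine ⟨n0, fun n hn => ?_⟩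
      have h3 := hn0 n hn
      have h4 := @h (y n, t n) (y n, s n) (by
        rw [Prod.dist_eq]
        simp only [dist_self]
        simp only [sub_self, dist_zero_right] at h3
        rw [Real.dist_eq]
        exact max_lt hδ h3)
      simp only [Real.dist_eq] at h4 ⊢
      simpa using h4
    have hK : Tendsto (fun n => K * (W1 (x n) (t n) + W2 (y n) (s n))) atTop (𝓝 (K * (W1 xb tb + W2 xb tb))) :=
      (S.wt1.add S.wt2).const_mul K
    filter_upwards [hDn, S.tm, S.sm, S.b1, S.b2, S.b12, S.w, hfts.eventually (gt_mem_nhds (show 0 < ϑ / 3 by positivity)),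
      hK.eventually (gt_mem_nhds (show K * (W1 xb tb + W2 xb tb) < K * (W1 xb tb + W2 xb tb) + ϑ / 3 by linarith)),
      S.εt.eventually (gt_mem_nhds (show 0 < ϑ / 3 by positivity))] with n h1 h2 h3 h4 h5 h6 h7 h8 h9 h10
    have hε := S.ε0 n
    have key := hF (x n) (S.xm n) (y n) (S.ym n) (t n) h2 (s n) h3 (P1 n) (P2 n) h6 h7
    have h11 : max ‖P1 n‖ ‖P2 n‖ ≤ |Cp| / ε n := by
      have : Cp / ε n ≤ |Cp| / ε n := by gcongr; exact le_abs_self _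
      exact max_le (h4.trans this) (h5.trans this)
    have h12 : 0 ≤ max ‖P1 n‖ ‖P2 n‖ := le_max_of_le_left (norm_nonneg _)
    have h13 : ω₁ ‖x n - y n‖ * G (max ‖P1 n‖ ‖P2 n‖) ≤ ω₁ (D (ε n)) * G (|Cp| / ε n) :=
      mul_le_mul (hω.2.1 h1) (hGm _ _ h12 h11) (hG0 _ h12) (hω.1 _)
    have h14 := (hD (ε n) hε).2
    linarith

lemma modulus_eventually {ω : ℝ → ℝ} (hω : IsModulus ω) {a : ℕ → ℝ} (ha : Tendsto a atTop (𝓝 0)) {η : ℝ} (hη : 0 < η) :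
    ∀ᶠ n in atTop, ω (a n) < η := by
  obtain ⟨δ, hδ, h⟩ := modulus_small hω hη
  filter_upwards [ha.eventually (gt_mem_nhds hδ)] with n hn
  exact (hω.2.1 hn.le).trans_lt h

set_option linter.unusedSectionVars false

section bell

variable {A : Type} [MetricSpace A] [CompactSpace A] [Nonempty A]
    {lam : Euc N → ℝ → A → ℝ} {b : Euc N → ℝ → A → Euc N} {l : Euc N → ℝ → A → ℝ}
    {H : Euc N → ℝ → ℝ → Euc N → ℝ}

lemma bell_bdd (hD : ParBellmanData lam b l) (x : Euc N) (t r : ℝ) (p : Euc N) :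
    BddAbove (range (fun α : A => lam x t α * r - ⟪b x t α, p⟫ - l x t α)) := by
  obtain ⟨-, ⟨M1, h1⟩, -, ⟨M2, h2⟩, -, ⟨M3, h3⟩⟩ := hD
  refine ⟨M1 * |r| + M2 * ‖p‖ + M3, ?_⟩
  rintro _ ⟨α, rfl⟩
  have e1 : lam x t α * r ≤ M1 * |r| := by
    refine (le_abs_self _).trans ?_
    rw [abs_mul]
    exact mul_le_mul_of_nonneg_right (h1 x t α) (abs_nonneg _)
  have e2 : -⟪b x t α, p⟫ ≤ M2 * ‖p‖ := by
    refine (neg_le_abs _).trans ((abs_real_inner_le_norm _ _).trans ?_)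
    exact mul_le_mul_of_nonneg_right (h2 x t α) (norm_nonneg _)
  have e3 := (abs_le.1 (h3 x t α)).1
  simp only
  linarith

lemma bell_ge (hD : ParBellmanData lam b l) (hB : IsParBellman lam b l H) (x : Euc N) (t r : ℝ) (p : Euc N) (α : A) :
    lam x t α * r - ⟪b x t α, p⟫ - l x t α ≤ H x t r p := by
  rw [hB]
  exact le_ciSup (bell_bdd hD x t r p) α

lemma bell_le (hB : IsParBellman lam b l H) (x : Euc N) (t r : ℝ) (p : Euc N) {c : ℝ}
    (h : ∀ α, lam x t α * r - ⟪b x t α, p⟫ - l x t α ≤ c) : H x t r p ≤ c := by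
  rw [hB]
  exact ciSup_le h

lemma bell_hd {Ω : Set (Euc N)} {nn : Euc N → Euc N} (hB : ParBellmanOK Ω nn lam b l H) {Bc : ℝ}
    (hBc : ∀ x t α, ‖b x t α‖ ≤ Bc) {W1 W2 : Euc N → ℝ → ℝ} {M T K bb : ℝ} (hM0 : 0 ≤ M)
    (hWM1 : ∀ y ∈ closure Ω, ∀ t ∈ Icc 0 T, |W1 y t| ≤ M)
    (hWM2 : ∀ y ∈ closure Ω, ∀ t ∈ Icc 0 T, |W2 y t| ≤ M)
    (hmono : ∀ x ∈ closure Ω, ∀ t ∈ Icc 0 T, ∀ r s : ℝ, |r| ≤ M → |s| ≤ M → s ≤ r → ∀ p,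
      -(K * (r - s)) ≤ H x t r p - H x t s p) {Z : Euc N → Euc N} {xb : Euc N} {tb Cp : ℝ}
    {ε : ℕ → ℝ} {x y : ℕ → Euc N} {t s a1 a2 : ℕ → ℝ} {P1 P2 Q : ℕ → Euc N}
    (S : SeqD Ω H (fun x t r p => -H x t (-r) (-p)) W1 W2 Z xb tb 1 Cp bb T ε x y t s a1 a2 P1 P2 Q)
    {ϑ : ℝ} (hϑ : 0 < ϑ) : ∀ᶠ n in atTop,
      -(K * (W1 xb tb + W2 xb tb)) - Bc * bb - ϑ ≤ H (x n) (t n) (W1 (x n) (t n)) (P1 n) +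
        (-H (y n) (s n) (-W2 (y n) (s n)) (-P2 n)) := by
  obtain ⟨hD, hH, ⟨⟨ωl, hωl, hl⟩, ⟨ωk, hωk, hk⟩⟩, ⟨C, hC, hL⟩, -⟩ := hB
  have hBc0 : 0 ≤ Bc := (norm_nonneg _).trans (hBc xb tb (Classical.arbitrary A))
  have hη : Tendsto (fun n => ‖x n - y n‖ + |t n - s n|) atTop (𝓝 0) := by
    have h1 := (S.xt.sub S.yt).norm
    have h2 := (S.tt.sub S.st).abs
    simpa using h1.add h2
  have hη2 : Tendsto (fun n => C * |Cp| * (‖x n - y n‖ / ε n + |t n - s n| / ε n ^ (1:ℝ))) atTop (𝓝 0) := by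
    simpa using (S.xy.add S.ts).const_mul (C * |Cp|)
  have hK : Tendsto (fun n => K * (W1 (x n) (t n) + W2 (y n) (s n))) atTop (𝓝 (K * (W1 xb tb + W2 xb tb))) :=
    (S.wt1.add S.wt2).const_mul K
  filter_upwards [S.tm, S.sm, S.b1, S.b12, S.w,
    hK.eventually (gt_mem_nhds (show K * (W1 xb tb + W2 xb tb) < K * (W1 xb tb + W2 xb tb) + ϑ / 4 by linarith)),
    modulus_eventually hωl hη (show 0 < ϑ / 4 by positivity),
    modulus_eventually hωk hη (show 0 < ϑ / 4 / (M + 1) by positivity),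
    hη2.eventually (gt_mem_nhds (show 0 < ϑ / 4 by positivity))] with n h1 h2 h3 h4 h5 h6 h7 h8 h9
  have hε := S.ε0 n
  have hv : |-W2 (y n) (s n)| ≤ M := by rw [abs_neg]; exact hWM2 _ (S.ym n) _ h2
  have hm := hmono (x n) (S.xm n) (t n) h1 (W1 (x n) (t n)) (-W2 (y n) (s n)) (hWM1 _ (S.xm n) _ h1) hv (by linarith) (P1 n)
  have hd : H (y n) (s n) (-W2 (y n) (s n)) (-P2 n) ≤ H (x n) (t n) (-W2 (y n) (s n)) (P1 n) + 3 * (ϑ / 4) + Bc * bb := by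
    apply bell_le hH
    intro α
    have g1 := bell_ge hD hH (x n) (t n) (-W2 (y n) (s n)) (P1 n) α
    have g2 := hl α (x n) (S.xm n) (y n) (S.ym n) (t n) h1.1 (s n) h2.1
    have g3 := hk α (x n) (S.xm n) (y n) (S.ym n) (t n) h1.1 (s n) h2.1
    have g4 := hL α (x n) (S.xm n) (y n) (S.ym n) (t n) h1.1 (s n) h2.1
    have g5 : (lam (y n) (s n) α - lam (x n) (t n) α) * -W2 (y n) (s n) ≤ ϑ / 4 := by
      refine (le_abs_self _).trans ?_
      rw [abs_mul, abs_sub_comm]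
      rw [lt_div_iff₀ (by positivity)] at h8
      have := mul_le_mul g3 hv (abs_nonneg _) (hωk.1 _)
      have := hωk.1 (‖x n - y n‖ + |t n - s n|)
      linarith
    have g6 : ⟪b (x n) (t n) α - b (y n) (s n) α, P1 n⟫ ≤ ϑ / 4 := by
      refine (real_inner_le_norm _ _).trans ?_
      have h3' : ‖P1 n‖ ≤ |Cp| / ε n := h3.trans (by gcongr; exact le_abs_self _)
      refine (mul_le_mul g4 h3' (norm_nonneg _) (by positivity)).trans ?_
      refine le_trans (le_of_eq ?_) h9.le
      rw [Real.rpow_one]; ring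
    have g7 : ⟪b (y n) (s n) α, P1 n + P2 n⟫ ≤ Bc * bb :=
      (real_inner_le_norm _ _).trans (mul_le_mul (hBc _ _ _) h4 (norm_nonneg _) hBc0)
    rw [inner_sub_left] at g6
    rw [inner_add_right] at g7
    rw [inner_neg_right]
    have := (abs_le.1 g2).2
    linarith
  have e : W1 (x n) (t n) - -W2 (y n) (s n) = W1 (x n) (t n) + W2 (y n) (s n) := by ring
  rw [e] at hm
  linarith

end bell

set_option linter.unusedSectionVars false

section bell

variable {A : Type} [MetricSpace A] [CompactSpace A] [Nonempty A]
    {lam : Euc N → ℝ → A → ℝ} {b : Euc N → ℝ → A → Euc N} {l : Euc N → ℝ → A → ℝ}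
    {H : Euc N → ℝ → ℝ → Euc N → ℝ}

lemma bd_conv {Ω : Set (Euc N)} (hL : AssumptionL' Ω b) {Bc : ℝ}
    (hBc : ∀ x t α, ‖b x t α‖ ≤ Bc) {xb : Euc N} (hxb : xb ∈ closure Ω) {tb T : ℝ} (htb : 0 ≤ tb)
    {r : ℝ} (hr : 0 < r) (hd : ContDiffOn ℝ 1 (sdist Ω) (ball xb r)) {x : ℕ → Euc N} {t : ℕ → ℝ}
    (hx : ∀ n, x n ∈ closure Ω) (ht : ∀ᶠ n in atTop, t n ∈ Icc 0 T) (hxt : Tendsto x atTop (𝓝 xb))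
    (htt : Tendsto t atTop (𝓝 tb)) {c : ℝ} (hc : 0 < c) :
    ∀ᶠ n in atTop, ∀ α, |fderiv ℝ (sdist Ω) (x n) (b (x n) (t n) α) - fderiv ℝ (sdist Ω) xb (b xb tb α)| ≤ c := by
  obtain ⟨C, hC, hL⟩ := hL
  have h1 : ContinuousAt (fderiv ℝ (sdist Ω)) xb :=
    (hd.continuousOn_fderiv_of_isOpen isOpen_ball le_rfl).continuousAt (isOpen_ball.mem_nhds (mem_ball_self hr))
  have h2 : Tendsto (fun n => ‖fderiv ℝ (sdist Ω) (x n) - fderiv ℝ (sdist Ω) xb‖ * Bc +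
      2 * (C * (‖x n - xb‖ + |t n - tb|))) atTop (𝓝 0) := by
    have e1 := (((h1.tendsto.comp hxt).sub_const (fderiv ℝ (sdist Ω) xb)).norm).mul_const Bc
    have e2 := (((hxt.sub_const xb).norm.add (htt.sub_const tb).abs).const_mul C).const_mul 2
    simpa using e1.add e2
  filter_upwards [ht, h2.eventually (gt_mem_nhds hc)] with n hn1 hn2 α
  refine le_trans ?_ hn2.le
  have e : fderiv ℝ (sdist Ω) (x n) (b (x n) (t n) α) - fderiv ℝ (sdist Ω) xb (b xb tb α) =
      (fderiv ℝ (sdist Ω) (x n) - fderiv ℝ (sdist Ω) xb) (b (x n) (t n) α) +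
      fderiv ℝ (sdist Ω) xb (b (x n) (t n) α - b xb tb α) := by
    rw [sub_apply, map_sub]; ring
  rw [e]
  refine (abs_add_le _ _).trans (add_le_add ?_ ?_)
  · exact ((fderiv ℝ (sdist Ω) (x n) - fderiv ℝ (sdist Ω) xb).le_opNorm _).trans
      (mul_le_mul_of_nonneg_left (hBc _ _ _) (norm_nonneg _))
  · exact ((fderiv ℝ (sdist Ω) xb).le_opNorm _).trans
      (mul_le_mul (norm_fderiv_sdist_le Ω xb) (hL α (x n) (hx n) xb hxb (t n) hn1.1 tb htb) (norm_nonneg _) zero_le_two)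

lemma bell_nc {Ω : Set (Euc N)} {nn : Euc N → Euc N} (hn : IsExteriorNormal Ω nn) (hB : ParBellmanOK Ω nn lam b l H) {Bc : ℝ}
    (hBc : ∀ x t α, ‖b x t α‖ ≤ Bc) {W1 W2 : Euc N → ℝ → ℝ} {M T bb : ℝ}
    (hWM1 : ∀ y ∈ closure Ω, ∀ t ∈ Icc 0 T, |W1 y t| ≤ M)
    (hWM2 : ∀ y ∈ closure Ω, ∀ t ∈ Icc 0 T, |W2 y t| ≤ M) {Z : Euc N → Euc N} {xb : Euc N} (hxb : xb ∈ frontier Ω)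
    {tb Cp : ℝ} (htb : 0 ≤ tb) {e0 : Euc N} (he0 : ‖e0‖ = 1) {r : ℝ} (hr : 0 < r)
    (hd : ContDiffOn ℝ 1 (sdist Ω) (ball xb r))
    (hZ : ∀ x ∈ ball xb r, Z x = sdist Ω x • e0 ∧ ∀ h, fderiv ℝ Z x h = (fderiv ℝ (sdist Ω) x h) • e0)
    {ε : ℕ → ℝ} {x y : ℕ → Euc N} {t s a1 a2 : ℕ → ℝ} {P1 P2 Q : ℕ → Euc N}
    (S : SeqD Ω H (fun x t r p => -H x t (-r) (-p)) W1 W2 Z xb tb 1 Cp bb T ε x y t s a1 a2 P1 P2 Q) :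
    ∀ᶠ n in atTop, ‖Q n‖ < 1 / (2 * ε n) := by
  obtain ⟨hD, hH, -, hL, ⟨hun, -, -, -⟩⟩ := hB
  have hBc0 : 0 ≤ Bc := (norm_nonneg _).trans (hBc xb tb (Classical.arbitrary A))
  have hxbc : xb ∈ closure Ω := frontier_subset_closure hxb
  have hxball : ∀ᶠ n in atTop, x n ∈ ball xb r := S.xt.eventually (ball_mem_nhds _ hr)
  have hyball : ∀ᶠ n in atTop, y n ∈ ball xb r := S.yt.eventually (ball_mem_nhds _ hr)
  set q : ℕ → ℝ := fun n => ⟪Q n, e0⟫ with hq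
  have hQq : ∀ᶠ n in atTop, ‖Q n‖ = |q n| := by
    filter_upwards [hxball, hyball] with n h1 h2
    obtain ⟨c, hc⟩ := S.qz n
    rw [(hZ _ h1).1, (hZ _ h2).1, ← sub_smul, smul_smul] at hc
    simp only [hq]
    rw [hc, norm_smul, inner_smul_left, real_inner_self_eq_norm_sq, he0]
    simp
  obtain ⟨-, ⟨M1, hM1⟩, hbc, -, -, ⟨M3, hM3⟩⟩ := id hD
  set C0 := M1 * M + M3 with hC0
  have hεC : Tendsto (fun n => ε n * C0) atTop (𝓝 0) := by simpa using S.εt.mul_const C0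
  have hlam : ∀ x t α r, |r| ≤ M → |lam x t α * r| ≤ M1 * M := by
    intro x t α r hr
    rw [abs_mul]
    exact mul_le_mul (hM1 _ _ _) hr (abs_nonneg _) ((abs_nonneg _).trans (hM1 x t α))
  have hI : ∀ ϑ > 0, ∀ᶠ n in atTop, ∀ α, -(ε n * q n * fderiv ℝ (sdist Ω) (x n) (b (x n) (t n) α)) ≤ ϑ := by
    intro ϑ hϑ
    filter_upwards [hxball, S.e1, S.tm, S.l1 (ϑ / 4) (by positivity), S.p1 (ϑ / 4 / (Bc + 1)) (by positivity),
      hεC.eventually (gt_mem_nhds (show 0 < ϑ / 4 by positivity))] with n h1 h2 h3 h4 h5 h6 α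
    have hε := S.ε0 n
    have g1 := bell_ge hD hH (x n) (t n) (W1 (x n) (t n)) (P1 n) α
    have g2 := (abs_le.1 (hlam (x n) (t n) α _ (hWM1 _ (S.xm n) _ h3))).1
    have g3 := (abs_le.1 (hM3 (x n) (t n) α)).2
    have g4 := (abs_le.1 (h5 (b (x n) (t n) α))).2
    rw [(hZ _ h1).2, inner_smul_right, real_inner_comm] at g4
    rw [Real.rpow_one] at h4
    have g5 : -⟪b (x n) (t n) α, P1 n⟫ ≤ - a1 n + C0 := by rw [hC0]; linarith
    have g6 : -(q n * fderiv ℝ (sdist Ω) (x n) (b (x n) (t n) α)) ≤ - a1 n + C0 + ϑ / 4 / (Bc + 1) / ε n * Bc := by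
      have : ϑ / 4 / (Bc + 1) / ε n * ‖b (x n) (t n) α‖ ≤ ϑ / 4 / (Bc + 1) / ε n * Bc := by gcongr; exact hBc _ _ _
      have g4' := (abs_le.1 (h5 (b (x n) (t n) α))).1
      rw [(hZ _ h1).2, inner_smul_right] at g4'
      have e : ⟪P1 n, b (x n) (t n) α⟫ = ⟪b (x n) (t n) α, P1 n⟫ := real_inner_comm _ _
      have g4'' := (abs_le.1 (h5 (b (x n) (t n) α))).2
      rw [(hZ _ h1).2, inner_smul_right] at g4''
      simp only [hq]
      linarith
    have g7 := mul_le_mul_of_nonneg_left g6 hε.le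
    have g8 : ε n * (ϑ / 4 / (Bc + 1) / ε n * Bc) ≤ ϑ / 4 := by
      have : ε n * (ϑ / 4 / (Bc + 1) / ε n * Bc) = ϑ / 4 * (Bc / (Bc + 1)) := by field_simp
      rw [this]
      have : Bc / (Bc + 1) ≤ 1 := by rw [div_le_one (by positivity)]; linarith
      nlinarith
    linarith
  have hII : ∀ ϑ > 0, ∀ᶠ n in atTop, ∀ X, (∀ α, X ≤ q n * fderiv ℝ (sdist Ω) (y n) (b (y n) (s n) α)) → ε n * X ≤ ϑ := by
    intro ϑ hϑ
    filter_upwards [hyball, S.e2, S.sm, S.l2 (ϑ / 4) (by positivity), S.p2 (ϑ / 4 / (Bc + 1)) (by positivity),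
      hεC.eventually (gt_mem_nhds (show 0 < ϑ / 4 by positivity))] with n h1 h2 h3 h4 h5 h6 X hX
    have hε := S.ε0 n
    rw [Real.rpow_one] at h4
    have g6 : H (y n) (s n) (-W2 (y n) (s n)) (-P2 n) ≤ C0 - X + ϑ / 4 / (Bc + 1) / ε n * Bc := by
      apply bell_le hH
      intro α
      have g2 := (abs_le.1 (hlam (y n) (s n) α (-W2 (y n) (s n)) (by rw [abs_neg]; exact hWM2 _ (S.ym n) _ h3))).2
      have g3 := (abs_le.1 (hM3 (y n) (s n) α)).1
      have : ϑ / 4 / (Bc + 1) / ε n * ‖b (y n) (s n) α‖ ≤ ϑ / 4 / (Bc + 1) / ε n * Bc := by gcongr; exact hBc _ _ _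
      have g4'' := (abs_le.1 (h5 (b (y n) (s n) α))).2
      rw [(hZ _ h1).2, inner_smul_right] at g4''
      have e : ⟪P2 n, b (y n) (s n) α⟫ = ⟪b (y n) (s n) α, P2 n⟫ := real_inner_comm _ _
      have hXα := hX α
      simp only [hq] at hXα
      rw [inner_neg_right]
      linarith
    have g7 := mul_le_mul_of_nonneg_left (show X ≤ - a2 n + C0 + ϑ / 4 / (Bc + 1) / ε n * Bc by linarith) hε.le
    have g8 : ε n * (ϑ / 4 / (Bc + 1) / ε n * Bc) ≤ ϑ / 4 := by
      have : ε n * (ϑ / 4 / (Bc + 1) / ε n * Bc) = ϑ / 4 * (Bc / (Bc + 1)) := by field_simp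
      rw [this]
      have : Bc / (Bc + 1) ≤ 1 := by rw [div_le_one (by positivity)]; linarith
      nlinarith
    linarith
  -- reduction
  suffices hmain : ∃ c > 0, ∀ᶠ n in atTop, c * (ε n * |q n|) ≤ c / 4 by
    obtain ⟨c, hc, hev⟩ := hmain
    filter_upwards [hev, hQq] with n h1 h2
    have hε := S.ε0 n
    rw [h2, lt_div_iff₀ (by positivity)]
    have : ε n * |q n| ≤ 1 / 4 := by nlinarith
    linarith
  have hβ : ∀ α, fderiv ℝ (sdist Ω) xb (b xb tb α) = - ⟪b xb tb α, nn xb⟫ := by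
    intro α; rw [fderiv_sdist_frontier hn hxb, real_inner_comm]
  have hcx := fun (c : ℝ) (hc : 0 < c) => bd_conv hL hBc hxbc htb hr hd S.xm S.tm S.xt S.tt (c := c) hc
  have hcy := fun (c : ℝ) (hc : 0 < c) => bd_conv hL hBc hxbc htb hr hd S.ym S.sm S.yt S.st (c := c) hc
  have hcont : Continuous (fun α => ⟪b xb tb α, nn xb⟫) := by
    have : Continuous (fun α => b xb tb α) := hbc.comp (by fun_prop : Continuous (fun α : A => (xb, tb, α)))
    exact this.inner continuous_const
  rw [← hun] at hxb
  rcases hxb with (⟨-, hin⟩ | ⟨-, hout⟩) | ⟨-, hmix⟩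
  · obtain ⟨α0, -, hα0⟩ := isCompact_univ.exists_isMaxOn (univ_nonempty (α := A)) hcont.continuousOn
    have hneg := hin tb htb α0
    set c := -⟪b xb tb α0, nn xb⟫ / 2 with hc
    have hc0 : 0 < c := by rw [hc]; linarith
    have hall : ∀ α, 2 * c ≤ fderiv ℝ (sdist Ω) xb (b xb tb α) := by
      intro α; rw [hβ]; have : ⟪b xb tb α, nn xb⟫ ≤ ⟪b xb tb α0, nn xb⟫ := hα0 (mem_univ α); rw [hc]; linarith
    refine ⟨c, hc0, ?_⟩
    filter_upwards [hcx c hc0, hcy c hc0, hI (c / 4) (by positivity), hII (c / 4) (by positivity)] with n h1 h2 h3 h4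
    have hε := S.ε0 n
    rcases le_total 0 (q n) with hq0 | hq0
    · have := h4 (c * q n) (fun α => by
        have := (abs_le.1 (h2 α)).1
        have := hall α
        nlinarith)
      rw [abs_of_nonneg hq0]; linarith
    · have e1 := h3 α0
      have e2 := (abs_le.1 (h1 α0)).1
      have e3 := hall α0
      rw [abs_of_nonpos hq0]
      have : 0 ≤ ε n * (-q n) := by nlinarith
      nlinarith
  · obtain ⟨α0, -, hα0⟩ := isCompact_univ.exists_isMinOn (univ_nonempty (α := A)) hcont.continuousOn
    have hpos := hout tb htb α0
    set c := ⟪b xb tb α0, nn xb⟫ / 2 with hc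
    have hc0 : 0 < c := by rw [hc]; linarith
    have hall : ∀ α, fderiv ℝ (sdist Ω) xb (b xb tb α) ≤ -(2 * c) := by
      intro α; rw [hβ]; have : ⟪b xb tb α0, nn xb⟫ ≤ ⟪b xb tb α, nn xb⟫ := hα0 (mem_univ α); rw [hc]; linarith
    refine ⟨c, hc0, ?_⟩
    filter_upwards [hcx c hc0, hcy c hc0, hI (c / 4) (by positivity), hII (c / 4) (by positivity)] with n h1 h2 h3 h4
    have hε := S.ε0 n
    rcases le_total 0 (q n) with hq0 | hq0
    · have e1 := h3 α0
      have e2 := (abs_le.1 (h1 α0)).2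
      have e3 := hall α0
      rw [abs_of_nonneg hq0]
      have : 0 ≤ ε n * q n := by positivity
      nlinarith
    · have := h4 (c * -q n) (fun α => by
        have := (abs_le.1 (h2 α)).2
        have := hall α
        nlinarith)
      rw [abs_of_nonpos hq0]; linarith
  · obtain ⟨α₁, α₂, hα1, hα2⟩ := hmix tb htb
    set c := min (-⟪b xb tb α₁, nn xb⟫) ⟪b xb tb α₂, nn xb⟫ / 2 with hc
    have hc0 : 0 < c := by
      have : 0 < min (-⟪b xb tb α₁, nn xb⟫) ⟪b xb tb α₂, nn xb⟫ := lt_min (by linarith) hα2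
      rw [hc]; linarith
    have k1 : 2 * c ≤ fderiv ℝ (sdist Ω) xb (b xb tb α₁) := by
      rw [hβ, hc]; linarith [min_le_left (-⟪b xb tb α₁, nn xb⟫) ⟪b xb tb α₂, nn xb⟫]
    have k2 : fderiv ℝ (sdist Ω) xb (b xb tb α₂) ≤ -(2 * c) := by
      rw [hβ, hc]; linarith [min_le_right (-⟪b xb tb α₁, nn xb⟫) ⟪b xb tb α₂, nn xb⟫]
    refine ⟨c, hc0, ?_⟩
    filter_upwards [hcx c hc0, hI (c / 4) (by positivity)] with n h1 h3
    have hε := S.ε0 n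
    rcases le_total 0 (q n) with hq0 | hq0
    · have e1 := h3 α₂
      have e2 := (abs_le.1 (h1 α₂)).2
      rw [abs_of_nonneg hq0]
      have : 0 ≤ ε n * q n := by positivity
      nlinarith
    · have e1 := h3 α₁
      have e2 := (abs_le.1 (h1 α₁)).1
      rw [abs_of_nonpos hq0]
      have : 0 ≤ ε n * (-q n) := by nlinarith
      nlinarith

lemma hc_bellman {hN : 0 < N} {Ω : Set (Euc N)} (hΩ : IsW2Domain hN Ω) {nn : Euc N → Euc N} (hn : IsExteriorNormal Ω nn)
    {j : Euc N → Euc N → Euc N} {Aj : ℝ} (hJ0 : AssumptionJ0 Ω j Aj)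
    {Cj' Cj Dj : ℝ} (hJ1 : AssumptionJ1 Ω j Cj' Cj Dj) (hB : ParBellmanOK Ω nn lam b l H) {Bc : ℝ}
    (hBc : ∀ x t α, ‖b x t α‖ ≤ Bc) {W1 W2 : Euc N → ℝ → ℝ} {M T K bb σ : ℝ} (hM0 : 0 ≤ M) (hσ : σ < 1)
    (hWM1 : ∀ y ∈ closure Ω, ∀ t ∈ Icc 0 T, |W1 y t| ≤ M)
    (hWM2 : ∀ y ∈ closure Ω, ∀ t ∈ Icc 0 T, |W2 y t| ≤ M)
    (hmono : ∀ x ∈ closure Ω, ∀ t ∈ Icc 0 T, ∀ r s : ℝ, |r| ≤ M → |s| ≤ M → s ≤ r → ∀ p,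
      -(K * (r - s)) ≤ H x t r p - H x t s p) {xb : Euc N} (hxb : xb ∈ closure Ω) {tb : ℝ} (htb : 0 ≤ tb) :
    HC Ω j nn H (fun x t r p => -H x t (-r) (-p)) W1 W2 T K σ bb (Bc * bb) xb tb := by
  by_cases h : xb ∈ Ω
  · refine ⟨fun _ => 0, 1, zok_interior hΩ.1 hJ1 nn (0 : Euc N →L[ℝ] Euc N) h, hσ, fun Cp => ⟨fun _ => 1, fun _ _ => one_pos, ?_⟩⟩
    intro ε x y t s a1 a2 P1 P2 Q S
    refine ⟨Eventually.of_forall fun n => ?_, fun _ ϑ hϑ => bell_hd hB hBc hM0 hWM1 hWM2 hmono S hϑ⟩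
    obtain ⟨c, hc⟩ := S.qz n
    have := S.ε0 n
    rw [hc]; simp; positivity
  · have hxf : xb ∈ frontier Ω := by rw [hΩ.1.frontier_eq]; exact ⟨hxb, h⟩
    obtain ⟨Z, e0, hZok, he0, r, hr, hd, hZ⟩ := zok_sdist hΩ hn hJ0 hJ1 hxf
    refine ⟨Z, 1, hZok, hσ, fun Cp => ⟨fun _ => 1, fun _ _ => one_pos, ?_⟩⟩
    intro ε x y t s a1 a2 P1 P2 Q S
    exact ⟨bell_nc hn hB hBc hWM1 hWM2 hxf htb he0 hr hd hZ S, fun _ ϑ hϑ => bell_hd hB hBc hM0 hWM1 hWM2 hmono S hϑ⟩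

end bell

lemma gradient_scale {φ : Euc N → ℝ} {x : Euc N} (c : ℝ) (h : DifferentiableAt ℝ φ x) :
    gradient (fun y => c * φ y) x = c • gradient φ x := by
  unfold gradient
  rw [fderiv_const_mul h, map_smulₛₗ]
  simp

lemma Iin_scale (Ω : Set (Euc N)) (j : Euc N → Euc N → Euc N) (g : Euc N → Euc N → ℝ) (ξ c : ℝ)
    (φ : Euc N → ℝ) (x : Euc N) : Iin Ω j g ξ (fun y => c * φ y) x = c * Iin Ω j g ξ φ x := by
  unfold Iin
  rw [← integral_const_mul]
  congr 1; ext z; ring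

lemma Iout_scale (Ω : Set (Euc N)) (j : Euc N → Euc N → Euc N) (g : Euc N → Euc N → ℝ) (ξ c d : ℝ)
    (φ : Euc N → ℝ) (x : Euc N) : Iout Ω j g ξ (fun y => c * φ y + d) x = c * Iout Ω j g ξ φ x := by
  unfold Iout
  rw [← integral_const_mul]
  congr 1; ext z; ring

lemma slice_diff {φ : Euc N → ℝ → ℝ} (h : ContDiff ℝ 1 (fun q : Euc N × ℝ => φ q.1 q.2)) (x : Euc N) (t : ℝ) :
    DifferentiableAt ℝ (fun y => φ y t) x := by
  have h1 : ContDiff ℝ 1 (fun y : Euc N => φ y t) := h.comp (contDiff_id.prodMk contDiff_const)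
  exact (h1.differentiable one_ne_zero) x

lemma super_to_sub {Ω : Set (Euc N)} {j : Euc N → Euc N → Euc N} {g : Euc N → Euc N → ℝ}
    {n : Euc N → Euc N} {Cj : ℝ} {H : Euc N → ℝ → ℝ → Euc N → ℝ} {v : Euc N → ℝ → ℝ}
    (h : IsParSuperSol Ω j g n Cj (parF H) v) :
    IsParSubSol Ω j g n Cj (parF (fun x t r p => -H x t (-r) (-p))) (fun x t => - v x t) := by
  intro ξ hξ φ hφ x hx t ht hmax
  have hd := slice_diff hφ x t
  have key := h ξ hξ (fun y s => (-1) * φ y s) (contDiff_const.mul hφ) x hx t ht (by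
    intro y hy s hs hst
    have := hmax y hy s hs hst
    linarith)
  have e1 : deriv (fun s => (-1) * φ x s) t = - deriv (φ x) t := by
    rw [deriv_const_mul_field]; ring
  have e2 := gradient_scale (-1) hd
  have e3 := Iin_scale Ω j g ξ (-1) (fun y => φ y t) x
  have e4 : Iout Ω j g ξ (fun y => - v y t) x = - Iout Ω j g ξ (fun y => v y t) x := by
    have := Iout_scale Ω j g ξ (-1) 0 (fun y => v y t) x
    simpa using this
  beta_reduce at e3
  rw [e1, e2, e3] at key
  rw [e4]
  obtain ⟨k1, k2⟩ := key
  constructor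
  · intro hxo
    have := k1 hxo
    simp only [parF, neg_neg, neg_smul, one_smul] at this ⊢
    linarith
  · intro hxf
    have := k2 hxf
    simp only [parF, neg_neg, neg_smul, one_smul, inner_neg_left] at this ⊢
    rcases le_max_iff.1 this with h1 | h1
    · exact (min_le_left _ _).trans (by linarith)
    · exact (min_le_right _ _).trans (by linarith)

lemma sub_scale {Ω : Set (Euc N)} {j : Euc N → Euc N → Euc N} {g : Euc N → Euc N → ℝ}
    {n : Euc N → Euc N} {Cj : ℝ} {H : Euc N → ℝ → ℝ → Euc N → ℝ} {u : Euc N → ℝ → ℝ}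
    (h : IsParSubSol Ω j g n Cj (parF H) u) {μ : ℝ} (hμ : 0 < μ) (M : ℝ) :
    IsParSubSol Ω j g n Cj (parF (fun x t r p => μ * H x t ((r + M) / μ - M) (μ⁻¹ • p)))
      (fun x t => μ * u x t + (μ * M - M)) := by
  intro ξ hξ φ hφ x hx t ht hmax
  have hd := slice_diff hφ x t
  have hi : 0 < μ⁻¹ := inv_pos.2 hμ
  have key := h ξ hξ (fun y s => μ⁻¹ * φ y s) (contDiff_const.mul hφ) x hx t ht (by
    intro y hy s hs hst
    have := hmax y hy s hs hst
    have h2 : μ⁻¹ * (μ * u y s - φ y s) ≤ μ⁻¹ * (μ * u x t - φ x t) :=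
      mul_le_mul_of_nonneg_left (by linarith) hi.le
    have h3 : μ⁻¹ * μ = 1 := inv_mul_cancel₀ hμ.ne'
    have h4 : ∀ a b : ℝ, μ⁻¹ * (μ * a - b) = a - μ⁻¹ * b := by
      intro a b; rw [mul_sub, ← mul_assoc, h3, one_mul]
    rw [h4, h4] at h2
    exact h2)
  have e1 : deriv (fun s => μ⁻¹ * φ x s) t = μ⁻¹ * deriv (φ x) t := by
    rw [deriv_const_mul_field]
  have e2 := gradient_scale μ⁻¹ hd
  have e3 := Iin_scale Ω j g ξ μ⁻¹ (fun y => φ y t) x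
  have e4 := Iout_scale Ω j g ξ μ (μ * M - M) (fun y => u y t) x
  beta_reduce at e3 e4
  rw [e1, e2, e3] at key
  rw [e4]
  have er : (μ * u x t + (μ * M - M) + M) / μ - M = u x t := by field_simp; ring
  have hF : ∀ a I J p : ℝ, a - (I + μ * J) + μ * p = μ * (μ⁻¹ * a - (μ⁻¹ * I + J) + p) := by
    intro a I J p; field_simp
  obtain ⟨k1, k2⟩ := key
  simp only [parF] at k1 k2 ⊢
  rw [er, hF]
  constructor
  · intro hxo
    exact mul_nonpos_of_nonneg_of_nonpos hμ.le (k1 hxo)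
  · intro hxf
    have := k2 hxf
    rw [inner_smul_left] at this
    rcases min_le_iff.1 this with h1 | h1
    · exact (min_le_left _ _).trans (mul_nonpos_of_nonneg_of_nonpos hμ.le h1)
    · refine (min_le_right _ _).trans ?_
      simp only [conj_trivial] at h1
      exact nonpos_of_mul_nonpos_right h1 hi

def Approx (Ω : Set (Euc N)) (j : Euc N → Euc N → Euc N) (g : Euc N → Euc N → ℝ)
    (nn : Euc N → Euc N) (Cj σ : ℝ) (H : Euc N → ℝ → ℝ → Euc N → ℝ) (u v : Euc N → ℝ → ℝ) (M T K e : ℝ) : Prop :=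
  ∃ (F1 : Euc N → ℝ → ℝ → Euc N → ℝ) (w : Euc N → ℝ → ℝ), IsParSubSol Ω j g nn Cj (parF F1) w ∧
    UpperSemicontinuousOn (fun q : Euc N × ℝ => w q.1 q.2) (closure Ω ×ˢ Ici 0) ∧
    (∀ x ∈ closure Ω, ∀ t ∈ Icc 0 T, |w x t| ≤ M ∧ w x t ≤ u x t ∧ u x t - e ≤ w x t) ∧
    ∃ β₀ > (0:ℝ), ∀ β, 0 < β → β < β₀ → ∃ e₁ ≤ e, ∀ xb ∈ closure Ω, ∀ tb ∈ Ioo 0 T,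
      HC Ω j nn F1 (fun x t r p => -H x t (-r) (-p)) w (fun x t => - v x t) T K σ (44 * β) e₁ xb tb

set_option maxHeartbeats 1600000 in
lemma final_core {hN : 0 < N} {Ω : Set (Euc N)} (hΩ : IsW2Domain hN Ω) {n : Euc N → Euc N} (hn : IsExteriorNormal Ω n)
    {g : Euc N → Euc N → ℝ} {Cμ Dμ σ : ℝ} (hM : AssumptionM Ω g Cμ Dμ σ)
    {j : Euc N → Euc N → Euc N} {Aj : ℝ} (hJ0 : AssumptionJ0 Ω j Aj)
    {Cj' Cj Dj : ℝ} (hJ1 : AssumptionJ1 Ω j Cj' Cj Dj) {H : Euc N → ℝ → ℝ → Euc N → ℝ}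
    (hH' : AssumptionH' Ω H) {u₀ : Euc N → ℝ} {u v : Euc N → ℝ → ℝ}
    (hub : ∀ T > (0:ℝ), BddOnT u (closure Ω) (Icc 0 T))
    (hu0 : ∀ x ∈ closure Ω, u x 0 ≤ u₀ x)
    (hvb : ∀ T > (0:ℝ), BddOnT v (closure Ω) (Icc 0 T))
    (hlsc : LowerSemicontinuousOn (fun q : Euc N × ℝ => v q.1 q.2) (closure Ω ×ˢ Ici 0))
    (hsup : IsParSuperSol Ω j g n Cj (parF H) v)
    (hv0 : ∀ x ∈ closure Ω, u₀ x ≤ v x 0)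
    (hApp : ∀ M T K e : ℝ, 0 < M → 0 < T → 0 ≤ K → 0 < e →
      (∀ x ∈ closure Ω, ∀ t ∈ Icc 0 T, |u x t| ≤ M) → (∀ x ∈ closure Ω, ∀ t ∈ Icc 0 T, |v x t| ≤ M) →
      (∀ x ∈ closure Ω, ∀ t ∈ Icc 0 T, ∀ r s : ℝ, |r| ≤ M → |s| ≤ M → s ≤ r → ∀ p,
      -(K * (r - s)) ≤ H x t r p - H x t s p) → Approx Ω j g n Cj σ H u v M T K e) :
    ∀ x ∈ closure Ω, ∀ t ∈ Ici (0:ℝ), u x t ≤ v x t := by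
  intro x₁ hx₁ t₁ ht₁
  by_contra hcon
  push Not at hcon
  have ht₁' : (0:ℝ) ≤ t₁ := ht₁
  set m₁ := u x₁ t₁ - v x₁ t₁ with hm₁
  have hm₁0 : 0 < m₁ := by rw [hm₁]; linarith
  set T := t₁ + 2 with hT
  have hT0 : 0 < T := by linarith
  obtain ⟨Mu, hMu⟩ := hub T hT0
  obtain ⟨Mv, hMv⟩ := hvb T hT0
  set M := max (max Mu Mv) 1 with hMdef
  have hM0 : 0 < M := lt_of_lt_of_le one_pos (le_max_right _ _)
  have huM : ∀ x ∈ closure Ω, ∀ t ∈ Icc 0 T, |u x t| ≤ M := fun x hx t ht =>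
    (hMu x hx t ht).trans ((le_max_left _ _).trans (le_max_left _ _))
  have hvM : ∀ x ∈ closure Ω, ∀ t ∈ Icc 0 T, |v x t| ≤ M := fun x hx t ht =>
    (hMv x hx t ht).trans ((le_max_right _ _).trans (le_max_left _ _))
  obtain ⟨K0, hK0⟩ := hH'
  set K := max K0 0 with hK
  have hKn : 0 ≤ K := le_max_right _ _
  have hmono : ∀ x ∈ closure Ω, ∀ t ∈ Icc 0 T, ∀ r s : ℝ, |r| ≤ M → |s| ≤ M → s ≤ r → ∀ p,
      -(K * (r - s)) ≤ H x t r p - H x t s p := by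
    obtain ⟨γ, hγ, hh⟩ := hK0 (M + T) (by linarith)
    intro x hx t ht r s hr hs hrs p
    have := hh x hx t ⟨ht.1, by linarith [ht.2]⟩ r s (by linarith) (by linarith) hrs p
    have h2 : K0 ≤ K := le_max_left _ _
    nlinarith
  set L := 2 * K + 2 + 4 * M / m₁ with hL
  have hL1 : 4 * M / m₁ ≤ L := by rw [hL]; linarith
  have hLK : 2 ≤ L - 2 * K := by
    have : 0 < 4 * M / m₁ := by positivity
    rw [hL]; linarith
  have hL0 : 0 < L := by linarith
  have hexp2 : 4 * M ≤ m₁ * Real.exp (L * 2) := by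
    have h1 := Real.add_one_le_exp (L * 2)
    rw [div_le_iff₀ hm₁0] at hL1
    nlinarith
  set V : Set ℝ := {a | ∃ x ∈ closure Ω, ∃ t ∈ Icc 0 T, a = Real.exp (-(L * t)) * (u x t - v x t)} with hV
  have hVb : BddAbove V := by
    refine ⟨2 * M, ?_⟩
    rintro a ⟨x, hx, t, ht, rfl⟩
    have h1 := abs_le.1 (huM x hx t ht)
    have h2 := abs_le.1 (hvM x hx t ht)
    have h3 : Real.exp (-(L * t)) ≤ 1 := Real.exp_le_one_iff.2 (by have := mul_nonneg hL0.le ht.1; linarith)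
    have h4 := Real.exp_pos (-(L * t))
    nlinarith
  have hmem : Real.exp (-(L * t₁)) * m₁ ∈ V := ⟨x₁, hx₁, t₁, ⟨ht₁', by linarith⟩, rfl⟩
  set S := sSup V with hS
  have hS1 : Real.exp (-(L * t₁)) * m₁ ≤ S := le_csSup hVb hmem
  have hS0 : 0 < S := lt_of_lt_of_le (by positivity) hS1
  set c := S / 2 with hc
  have hc0 : 0 < c := by rw [hc]; linarith
  have hexp : ∀ t : ℝ, Real.exp (L * t) * Real.exp (-(L * t)) = 1 := by
    intro t; rw [← Real.exp_add]; simp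
  have hle : ∀ x ∈ closure Ω, ∀ t ∈ Icc 0 T, u x t - v x t ≤ 2 * c * Real.exp (L * t) := by
    intro x hx t ht
    have h1 : Real.exp (-(L * t)) * (u x t - v x t) ≤ S := le_csSup hVb ⟨x, hx, t, ht, rfl⟩
    have h2 := mul_le_mul_of_nonneg_left h1 (Real.exp_pos (L * t)).le
    rw [← mul_assoc, hexp, one_mul] at h2
    rw [hc]; linarith
  have hIoo : ∀ x ∈ closure Ω, ∀ t ∈ Icc 0 T, 0 < u x t - v x t - c * Real.exp (L * t) → t ∈ Ioo 0 T := by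
    intro x hx t ht hpos
    refine ⟨lt_of_le_of_ne ht.1 ?_, lt_of_le_of_ne ht.2 ?_⟩
    · rintro rfl
      have h1 := hu0 x hx
      have h2 := hv0 x hx
      have h3 : 0 < c * Real.exp (L * 0) := by positivity
      linarith
    · rintro rfl
      have h1 := abs_le.1 (huM x hx _ ht)
      have h2 := abs_le.1 (hvM x hx _ ht)
      have h3 : Real.exp (L * T) = Real.exp (L * t₁) * Real.exp (L * 2) := by rw [← Real.exp_add, hT]; ring_nf
      have h4 : m₁ ≤ S * Real.exp (L * t₁) := by
        have := mul_le_mul_of_nonneg_left hS1 (Real.exp_pos (L * t₁)).le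
        rw [← mul_assoc, hexp, one_mul] at this
        linarith
      have h5 : m₁ * Real.exp (L * 2) ≤ S * Real.exp (L * T) := by
        rw [h3, ← mul_assoc]
        exact mul_le_mul_of_nonneg_right h4 (Real.exp_pos _).le
      have h6 : c * Real.exp (L * T) = S * Real.exp (L * T) / 2 := by rw [hc]; ring
      linarith
  obtain ⟨a, ⟨x0, hx0, t0, ht0, ha⟩, haS⟩ := exists_lt_of_lt_csSup ⟨_, hmem⟩ (show 3 / 4 * S < S by linarith)
  have hη : c / 2 ≤ u x0 t0 - v x0 t0 - c * Real.exp (L * t0) := by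
    have h1 : 1 ≤ Real.exp (L * t0) := Real.one_le_exp (mul_nonneg hL0.le ht0.1)
    have h2 := mul_le_mul_of_nonneg_left haS.le (Real.exp_pos (L * t0)).le
    rw [ha, ← mul_assoc (Real.exp (L * t0)) (Real.exp (-(L * t0))), hexp, one_mul] at h2
    have h3 : S = 2 * c := by rw [hc]; ring
    rw [h3] at h2
    nlinarith
  obtain ⟨CI, hCI, hgs⟩ := global_stage hΩ hn hM hJ0 hJ1
  obtain ⟨F1, w, hws, hwu, hwb, β₀, hβ₀, hβ⟩ := hApp M T K (c / 4) hM0 hT0 hKn (by linarith) huM hvM hmono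
  set β := min (β₀ / 2) (min (c / 40) (c / (4 * CI))) with hβdef
  have hβ0 : 0 < β := by rw [hβdef]; positivity
  have hβ1 : β < β₀ := lt_of_le_of_lt (min_le_left _ _) (by linarith)
  have hβ2 : β ≤ c / 40 := (min_le_right _ _).trans (min_le_left _ _)
  have hβ3 : CI * β ≤ c / 4 := by
    have : β ≤ c / (4 * CI) := (min_le_right _ _).trans (min_le_right _ _)
    rw [le_div_iff₀ (by positivity)] at this
    linarith
  obtain ⟨e₁, he₁, hHC⟩ := hβ β hβ0 hβ1
  have hvusc : UpperSemicontinuousOn (fun q : Euc N × ℝ => - v q.1 q.2) (closure Ω ×ˢ Ici 0) := by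
    intro q hq y hy
    filter_upwards [hlsc q hq (-y) (by linarith)] with z hz
    linarith
  have hθ : ContDiff ℝ 1 (fun t : ℝ => c * Real.exp (L * t)) := by fun_prop
  obtain ⟨xb, hxb, tb, htb, hpos, hder⟩ := hgs (M := M) (T := T) (η := c / 4) hws (super_to_sub hsup) hwu hvusc
    (fun x hx t ht => (hwb x hx t ht).1) (fun x hx t ht => by rw [abs_neg]; exact hvM x hx t ht)
    hθ (fun t => by positivity)
    (fun x hx t ht hp => hIoo x hx t ht (by have := (hwb x hx t ht).2.1; linarith))
    hx0 ht0 (by have := (hwb x0 hx0 t0 ht0).2.2; linarith) hβ0 (by linarith)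
    (fun xb hxb tb htb _ => hHC xb hxb tb htb)
  have hd : deriv (fun t : ℝ => c * Real.exp (L * t)) tb = c * (L * Real.exp (L * tb)) := by
    have h1 : HasDerivAt (fun t : ℝ => L * t) L tb := by simpa using (hasDerivAt_id tb).const_mul L
    have h2 := (h1.exp).const_mul c
    rw [h2.deriv]; ring
  rw [hd] at hder
  have htb' : tb ∈ Icc 0 T := ⟨htb.1.le, htb.2.le⟩
  have h1 := hle xb hxb tb htb'
  have h2 := (hwb xb hxb tb htb').2.1
  have h3 : 1 ≤ Real.exp (L * tb) := Real.one_le_exp (mul_nonneg hL0.le htb.1.le)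
  have h4 : K * (w xb tb + - v xb tb) ≤ K * (2 * c * Real.exp (L * tb)) :=
    mul_le_mul_of_nonneg_left (by linarith) hKn
  have h5 : 2 * c ≤ (L - 2 * K) * (c * Real.exp (L * tb)) := by
    have : c ≤ c * Real.exp (L * tb) := by nlinarith
    nlinarith
  nlinarith

lemma approx_bellman {A : Type} [MetricSpace A] [CompactSpace A] [Nonempty A]
    {hN : 0 < N} {Ω : Set (Euc N)} (hΩ : IsW2Domain hN Ω) {n : Euc N → Euc N} (hn : IsExteriorNormal Ω n)
    {g : Euc N → Euc N → ℝ} {σ : ℝ} (hσ : σ < 1)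
    {j : Euc N → Euc N → Euc N} {Aj : ℝ} (hJ0 : AssumptionJ0 Ω j Aj)
    {Cj' Cj Dj : ℝ} (hJ1 : AssumptionJ1 Ω j Cj' Cj Dj)
    {lam : Euc N → ℝ → A → ℝ} {b : Euc N → ℝ → A → Euc N} {l : Euc N → ℝ → A → ℝ}
    {H : Euc N → ℝ → ℝ → Euc N → ℝ} (hB : ParBellmanOK Ω n lam b l H) {u v : Euc N → ℝ → ℝ}
    (husc : UpperSemicontinuousOn (fun q : Euc N × ℝ => u q.1 q.2) (closure Ω ×ˢ Ici 0))
    (hsub : IsParSubSol Ω j g n Cj (parF H) u) {M T K e : ℝ} (hM0 : 0 < M) (he : 0 < e)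
    (huM : ∀ x ∈ closure Ω, ∀ t ∈ Icc 0 T, |u x t| ≤ M) (hvM : ∀ x ∈ closure Ω, ∀ t ∈ Icc 0 T, |v x t| ≤ M)
    (hmono : ∀ x ∈ closure Ω, ∀ t ∈ Icc 0 T, ∀ r s : ℝ, |r| ≤ M → |s| ≤ M → s ≤ r → ∀ p,
      -(K * (r - s)) ≤ H x t r p - H x t s p) : Approx Ω j g n Cj σ H u v M T K e := by
  obtain ⟨B0, hB0⟩ := hB.1.2.2.2.1
  set Bc := max B0 0 with hBcdef
  have hBn : 0 ≤ Bc := le_max_right _ _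
  have hBc : ∀ x t α, ‖b x t α‖ ≤ Bc := fun x t α => (hB0 x t α).trans (le_max_left _ _)
  refine ⟨H, u, hsub, husc, fun x hx t ht => ⟨huM x hx t ht, le_rfl, by linarith⟩, e / (44 * (Bc + 1)), by positivity, ?_⟩
  intro β hβ hβ1
  rw [lt_div_iff₀ (by positivity)] at hβ1
  refine ⟨Bc * (44 * β), by nlinarith, fun xb hxb tb htb => ?_⟩
  exact hc_bellman hΩ hn hJ0 hJ1 hB hBc hM0.le hσ huM (fun x hx t ht => by rw [abs_neg]; exact hvM x hx t ht) hmono hxb htb.1.le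

lemma approx_sublin {hN : 0 < N} {Ω : Set (Euc N)} (hΩ : IsW2Domain hN Ω) {n : Euc N → Euc N} (hn : IsExteriorNormal Ω n)
    {g : Euc N → Euc N → ℝ} {σ : ℝ} (hσ : 0 < σ)
    {j : Euc N → Euc N → Euc N} {Aj : ℝ} (hJ0 : AssumptionJ0 Ω j Aj)
    {Cj' Cj Dj : ℝ} (hJ1 : AssumptionJ1 Ω j Cj' Cj Dj)
    {H : Euc N → ℝ → ℝ → Euc N → ℝ} (hH0 : AssumptionH0' H) (hHe : AssumptionHe' Ω H σ) {u v : Euc N → ℝ → ℝ}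
    (husc : UpperSemicontinuousOn (fun q : Euc N × ℝ => u q.1 q.2) (closure Ω ×ˢ Ici 0))
    (hsub : IsParSubSol Ω j g n Cj (parF H) u) {M T K e : ℝ} (hM0 : 0 < M) (he : 0 < e)
    (huM : ∀ x ∈ closure Ω, ∀ t ∈ Icc 0 T, |u x t| ≤ M) (hvM : ∀ x ∈ closure Ω, ∀ t ∈ Icc 0 T, |v x t| ≤ M)
    (hmono : ∀ x ∈ closure Ω, ∀ t ∈ Icc 0 T, ∀ r s : ℝ, |r| ≤ M → |s| ≤ M → s ≤ r → ∀ p,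
      -(K * (r - s)) ≤ H x t r p - H x t s p) : Approx Ω j g n Cj σ H u v M T K e := by
  obtain ⟨H₀, f, -, hf, -, hHf⟩ := hH0
  obtain ⟨m, hm, -, hR⟩ := hHe
  obtain ⟨⟨c₀, hc₀, D, -, hco⟩, ⟨C, hC, ω₁, hω, hHa⟩⟩ := hR M hM0
  refine ⟨H, u, hsub, husc, fun x hx t ht => ⟨huM x hx t ht, le_rfl, by linarith⟩, e / (44 * C), by positivity, ?_⟩
  intro β hβ hβ1
  rw [lt_div_iff₀ (by positivity)] at hβ1
  refine ⟨C * (44 * β), by nlinarith, fun xb hxb tb htb => ?_⟩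
  refine hc_coercive hΩ hn hJ0 hJ1 hxb hσ hm hc₀ (Dc := D) (fun x hx t ht p => hco x hx t ht.1 _ (huM x hx t ht) p)
    hf hω (G := fun a => 1 + a) (fun a ha => by linarith) (fun a c _ h => by linarith) ?_
  intro x hx y hy t ht s hs p q hpq hW
  simp only [neg_neg]
  have h1 := hmono x hx t ht (u x t) (v y s) (huM x hx t ht) (hvM y hy s hs) (by linarith) p
  have h2 := hHa x y t ht.1 (v y s) (hvM y hy s hs) (-q) p
  have h3 : H y t (v y s) (-q) - H y s (v y s) (-q) = -(f y t - f y s) := by rw [hHf, hHf]; ring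
  have h4 := le_abs_self (f y t - f y s)
  have h5 : ‖-q - p‖ = ‖p + q‖ := by rw [← norm_neg]; congr 1; abel
  rw [h5, norm_neg] at h2
  have h6 : C * ‖p + q‖ ≤ C * (44 * β) := mul_le_mul_of_nonneg_left hpq hC.le
  have h7 : ω₁ ‖x - y‖ * (1 + ‖q‖) ≤ ω₁ ‖x - y‖ * (1 + max ‖p‖ ‖q‖) :=
    mul_le_mul_of_nonneg_left (by linarith [le_max_right ‖p‖ ‖q‖]) (hω.1 _)
  linarith

lemma pow_aux {a m : ℝ} (ha : 0 ≤ a) (hm : 1 < m) : (a + 1) ^ (m - 1) ≤ 2 ^ m * (1 + a ^ m) := by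
  have h1 : (a + 1) ^ (m - 1) ≤ (a + 1) ^ m := Real.rpow_le_rpow_of_exponent_le (by linarith) (by linarith)
  have h2 : (0:ℝ) < 2 ^ m := by positivity
  have h3 : 0 ≤ a ^ m := by positivity
  refine h1.trans ?_
  rcases le_total a 1 with h | h
  · have : (a + 1) ^ m ≤ 2 ^ m := Real.rpow_le_rpow (by linarith) (by linarith) (by linarith)
    nlinarith
  · have : (a + 1) ^ m ≤ (2 * a) ^ m := Real.rpow_le_rpow (by linarith) (by linarith) (by linarith)
    rw [Real.mul_rpow (by norm_num) ha] at this
    nlinarith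

lemma approx_superlin {hN : 0 < N} {Ω : Set (Euc N)} (hΩ : IsW2Domain hN Ω) {n : Euc N → Euc N} (hn : IsExteriorNormal Ω n)
    {g : Euc N → Euc N → ℝ} {σ : ℝ} (hσ : 0 < σ)
    {j : Euc N → Euc N → Euc N} {Aj : ℝ} (hJ0 : AssumptionJ0 Ω j Aj)
    {Cj' Cj Dj : ℝ} (hJ1 : AssumptionJ1 Ω j Cj' Cj Dj)
    {H : Euc N → ℝ → ℝ → Euc N → ℝ} (hH0 : AssumptionH0' H) {m : ℝ} (hHe : AssumptionHe'' Ω H σ m) {u v : Euc N → ℝ → ℝ}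
    (husc : UpperSemicontinuousOn (fun q : Euc N × ℝ => u q.1 q.2) (closure Ω ×ˢ Ici 0))
    (hsub : IsParSubSol Ω j g n Cj (parF H) u) {M T K e : ℝ} (hM0 : 0 < M) (hK : 0 ≤ K) (he : 0 < e)
    (huM : ∀ x ∈ closure Ω, ∀ t ∈ Icc 0 T, |u x t| ≤ M) (hvM : ∀ x ∈ closure Ω, ∀ t ∈ Icc 0 T, |v x t| ≤ M)
    (hmono : ∀ x ∈ closure Ω, ∀ t ∈ Icc 0 T, ∀ r s : ℝ, |r| ≤ M → |s| ≤ M → s ≤ r → ∀ p,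
      -(K * (r - s)) ≤ H x t r p - H x t s p) : Approx Ω j g n Cj σ H u v M T K e := by
  obtain ⟨H₀, f, -, hf, -, hHf⟩ := hH0
  obtain ⟨hm1, hm, hR⟩ := hHe
  obtain ⟨⟨c₀, hc₀, D, -, hco⟩, ⟨A, hA, Cb, hCb, hHb⟩, ⟨C, hC, ω₁, hω, hHc⟩⟩ := hR M hM0
  set X := A + 2 * M * K + 2 * M with hX
  have hX0 : 0 < X := by positivity
  obtain ⟨κ, hκ0, hκ1, hκ2⟩ : ∃ κ : ℝ, 0 < κ ∧ κ ≤ 1 / 2 ∧ κ * X ≤ e / 2 := by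
    refine ⟨min (1 / 2) (e / (2 * X)), by positivity, min_le_left _ _, ?_⟩
    have := min_le_right (1 / 2) (e / (2 * X))
    rw [le_div_iff₀ (by positivity)] at this
    linarith
  have hκA : κ * A + κ * (2 * M * K) + κ * (2 * M) ≤ e / 2 := by rw [hX] at hκ2; linarith
  have hκA1 : 0 < κ * A := by positivity
  have hκA2 : 0 ≤ κ * (2 * M * K) := by positivity
  have hκA3 : 0 < κ * (2 * M) := by positivity
  obtain ⟨μ, hμ⟩ : ∃ μ, μ = 1 - κ := ⟨_, rfl⟩
  have hμ0 : 0 < μ := by linarith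
  have hμ1 : μ < 1 := by linarith
  have hwu : ∀ x ∈ closure Ω, ∀ t ∈ Icc 0 T, u x t - (μ * u x t + (μ * M - M)) = κ * (u x t + M) ∧
      0 ≤ κ * (u x t + M) ∧ κ * (u x t + M) ≤ κ * (2 * M) := by
    intro x hx t ht
    have h1 := abs_le.1 (huM x hx t ht)
    refine ⟨by rw [hμ]; ring, mul_nonneg hκ0.le (by linarith), mul_le_mul_of_nonneg_left (by linarith) hκ0.le⟩
  have hwM : ∀ x ∈ closure Ω, ∀ t ∈ Icc 0 T, |μ * u x t + (μ * M - M)| ≤ M := by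
    intro x hx t ht
    have h1 := abs_le.1 (huM x hx t ht)
    have h2 := hwu x hx t ht
    rw [abs_le]
    constructor
    · nlinarith
    · linarith
  have h2m : (0:ℝ) < 2 ^ m := by positivity
  obtain ⟨b₀, hb₀, hb1, hb2, hb3⟩ : ∃ b₀ : ℝ, 0 < b₀ ∧ b₀ ≤ 1 ∧ C * b₀ * 2 ^ m ≤ κ * (Cb * (m - 1)) ∧ C * b₀ * 2 ^ m ≤ e / 2 := by
    have hmm : 0 < m - 1 := by linarith
    refine ⟨min 1 (min (κ * (Cb * (m - 1)) / (C * 2 ^ m)) (e / 2 / (C * 2 ^ m))), by positivity, min_le_left _ _, ?_, ?_⟩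
    · have := (min_le_right 1 (min (κ * (Cb * (m - 1)) / (C * 2 ^ m)) (e / 2 / (C * 2 ^ m)))).trans (min_le_left _ _)
      rw [le_div_iff₀ (by positivity)] at this
      linarith
    · have := (min_le_right 1 (min (κ * (Cb * (m - 1)) / (C * 2 ^ m)) (e / 2 / (C * 2 ^ m)))).trans (min_le_right _ _)
      rw [le_div_iff₀ (by positivity)] at this
      linarith
  refine ⟨_, _, sub_scale hsub hμ0 M, ?_, ?_, b₀ / 44, by positivity, ?_⟩
  · intro q hq y hy
    have hy' : u q.1 q.2 < (y - (μ * M - M)) / μ := by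
      rw [lt_div_iff₀ hμ0]; beta_reduce at hy; linarith
    filter_upwards [husc q hq _ hy'] with z hz
    rw [lt_div_iff₀ hμ0] at hz
    linarith
  · intro x hx t ht
    have := hwu x hx t ht
    refine ⟨hwM x hx t ht, by linarith, by linarith⟩
  intro β hβ hβ1
  have hbb : 44 * β ≤ b₀ := by linarith
  have hb3' : C * b₀ * 2 ^ m ≤ e / 2 := hb3
  refine ⟨κ * A + C * b₀ * 2 ^ m + K * (κ * (2 * M)), by linarith, fun xb hxb tb htb => ?_⟩
  have er : ∀ r : ℝ, (μ * r + (μ * M - M) + M) / μ - M = r := by intro r; field_simp; ring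
  refine hc_coercive hΩ hn hJ0 hJ1 hxb hσ hm (c₀ := μ * c₀ * (μ⁻¹) ^ m) (by positivity) (Dc := μ * D) ?_
    hf hω (G := fun a => 1 + a ^ m) (fun a ha => by positivity)
    (fun a c h1 h2 => by have := Real.rpow_le_rpow h1 h2 (show 0 ≤ m by linarith); linarith) ?_
  · intro x hx t ht p
    rw [er]
    have h1 := mul_le_mul_of_nonneg_left (hco x hx t ht.1 _ (huM x hx t ht) (μ⁻¹ • p)) hμ0.le
    rw [norm_smul, Real.norm_of_nonneg (inv_pos.2 hμ0).le, Real.mul_rpow (inv_pos.2 hμ0).le (norm_nonneg _)] at h1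
    linarith
  intro x hx y hy t ht s hs p q hpq hW
  simp only [neg_neg]
  rw [er]
  obtain ⟨g1, g2, g3⟩ := hwu x hx t ht
  have h0 := hHb μ ⟨hμ0, hμ1⟩ x hx t ht.1 _ (huM x hx t ht) p
  have hμκ : 1 - μ = κ := by linarith
  rw [hμκ] at h0
  have h1 := hmono x hx t ht (u x t) (v y s) (huM x hx t ht) (hvM y hy s hs) (by linarith) p
  have h1' : K * (u x t - v y s) ≤ K * (μ * u x t + (μ * M - M) + -v y s) + K * (κ * (2 * M)) := by
    rw [← mul_add]; exact mul_le_mul_of_nonneg_left (by linarith) hK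
  have h2 := hHc x y t ht.1 (v y s) (hvM y hy s hs) (-q) p
  have h3 : H y t (v y s) (-q) - H y s (v y s) (-q) = -(f y t - f y s) := by rw [hHf, hHf]; ring
  have h4 := le_abs_self (f y t - f y s)
  have h5 : ‖-q - p‖ = ‖p + q‖ := by rw [← norm_neg]; congr 1; abel
  rw [h5, norm_neg, max_comm] at h2
  have hq : ‖q‖ ≤ ‖p‖ + 1 := by
    have : ‖q‖ ≤ ‖p + q‖ + ‖p‖ := by
      have := norm_sub_le (p + q) p
      simpa using this
    linarith
  have hmax : max ‖p‖ ‖q‖ ≤ ‖p‖ + 1 := max_le (by linarith) hq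
  have hmax0 : 0 ≤ max ‖p‖ ‖q‖ := (norm_nonneg p).trans (le_max_left _ _)
  have h6 : (max ‖p‖ ‖q‖) ^ (m - 1) ≤ 2 ^ m * (1 + ‖p‖ ^ m) :=
    (Real.rpow_le_rpow hmax0 hmax (by linarith)).trans (pow_aux (norm_nonneg p) hm1)
  have h6' : 0 ≤ (max ‖p‖ ‖q‖) ^ (m - 1) := by positivity
  have hpm : 0 ≤ ‖p‖ ^ m := by positivity
  have h7 : C * ‖p + q‖ * (max ‖p‖ ‖q‖) ^ (m - 1) ≤ C * b₀ * (2 ^ m * (1 + ‖p‖ ^ m)) :=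
    mul_le_mul (mul_le_mul_of_nonneg_left (hpq.trans hbb) hC.le) h6 h6' (by positivity)
  have h8 : C * b₀ * 2 ^ m * ‖p‖ ^ m ≤ κ * (Cb * (m - 1)) * ‖p‖ ^ m := mul_le_mul_of_nonneg_right hb2 hpm
  linarith

/-- **Parabolic comparison principle.**  Under (O), (M), (J0), (J1), for `H` either of
Bellman type with (C'), (L'), (B') or coercive with (H0') and (He') or (He''), and
assuming (H'), any bounded-in-finite-time usc subsolution `u` and lsc supersolution `v`
of `∂_t u - I[u(·,t)] + H(x,t,u,Du) = 0` in `Ω × (0,∞)`, with generalized Neumann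
condition on `∂Ω × (0,∞)` and initial condition `u(·,0) ≤ u₀ ≤ v(·,0)`, satisfy
`u ≤ v` on `closure Ω × [0,∞)`. -/
theorem parabolic_comparison
    (hN : 0 < N) (Ω : Set (Euc N)) (hΩ : IsW2Domain hN Ω)
    (n : Euc N → Euc N) (hn : IsExteriorNormal Ω n)
    (g : Euc N → Euc N → ℝ) (Cμ Dμ σ : ℝ) (hM : AssumptionM Ω g Cμ Dμ σ)
    (j : Euc N → Euc N → Euc N) (Aj : ℝ) (hJ0 : AssumptionJ0 Ω j Aj)
    (Cj' Cj Dj : ℝ) (hJ1 : AssumptionJ1 Ω j Cj' Cj Dj)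
    {A : Type} [MetricSpace A] [CompactSpace A] [Nonempty A]
    (lam : Euc N → ℝ → A → ℝ) (b : Euc N → ℝ → A → Euc N) (l : Euc N → ℝ → A → ℝ)
    (H : Euc N → ℝ → ℝ → Euc N → ℝ)
    (hHam : ParBellmanOK Ω n lam b l H ∨ ParCoerciveOK Ω H σ)
    (hH' : AssumptionH' Ω H)
    (u₀ : Euc N → ℝ) (hu₀ : ContinuousOn u₀ (closure Ω))
    (u v : Euc N → ℝ → ℝ)
    (hub : ∀ T > (0:ℝ), BddOnT u (closure Ω) (Icc 0 T))
    (husc : UpperSemicontinuousOn (fun q : Euc N × ℝ => u q.1 q.2) (closure Ω ×ˢ Ici 0))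
    (hsub : IsParSubSol Ω j g n Cj (parF H) u)
    (hu0 : ∀ x ∈ closure Ω, u x 0 ≤ u₀ x)
    (hvb : ∀ T > (0:ℝ), BddOnT v (closure Ω) (Icc 0 T))
    (hlsc : LowerSemicontinuousOn (fun q : Euc N × ℝ => v q.1 q.2) (closure Ω ×ˢ Ici 0))
    (hsup : IsParSuperSol Ω j g n Cj (parF H) v)
    (hv0 : ∀ x ∈ closure Ω, u₀ x ≤ v x 0) :
    ∀ x ∈ closure Ω, ∀ t ∈ Ici (0:ℝ), u x t ≤ v x t := by
  have hσ := hM.1.2.1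
  refine final_core hΩ hn hM hJ0 hJ1 hH' hub hu0 hvb hlsc hsup hv0 ?_
  intro M T K e hM0 _ hK he huM hvM hmono
  rcases hHam with hB | ⟨hH0, hHe | ⟨m, hHe⟩⟩
  · exact approx_bellman hΩ hn hσ.2 hJ0 hJ1 hB husc hsub hM0 he huM hvM hmono
  · exact approx_sublin hΩ hn hσ.1 hJ0 hJ1 hH0 hHe husc hsub hM0 he huM hvM hmono
  · exact approx_superlin hΩ hn hσ.1 hJ0 hJ1 hH0 hHe husc hsub hM0 hK he huM hvM hmono

end Censored

end
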